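/- Fix real numbers A, B ≥ 1. There is a constant C = C(A,B) > 0 such that for all real x ≥ 3, all real N with 1 ≤ N ≤ (log x)^A, all real R with N ≤ R ≤ x/(log x)^{A+B}, and every nonzero integer a with |a| < x/N, one has | Σ_{x/N < q ≤ x} ( ψ*(x;q,a) − ρ_R*(x;q,a) ) | ≤ C·( x/(log x)^B + |a|·log 2N ), where q runs over positive integers. -/

import Mathlib

open Finset Real

/-- Vaughan's function `F_R(n) = ∑_{r ≤ R} μ(r)² μ((r,n)) φ((r,n)) / φ(r)`. -/
noncomputable def FR (R : ℝ) (n : ℤ) : ℝ :=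
  ∑ r ∈ Finset.Icc 1 ⌊R⌋₊,
    (ArithmeticFunction.moebius r : ℝ) ^ 2 *
      (ArithmeticFunction.moebius (Int.gcd (r : ℤ) n) : ℝ) *
      (Nat.totient (Int.gcd (r : ℤ) n) : ℝ) / (Nat.totient r : ℝ)

/-- `ρ_R^*(x;q,a) = ∑_{n ≤ x, n ≡ a (q), n > a} F_R(n)`. -/
noncomputable def rhoStar (R x : ℝ) (q : ℕ) (a : ℤ) : ℝ :=
  ∑ n ∈ (Finset.Icc 1 ⌊x⌋₊).filter (fun n : ℕ => a < (n : ℤ) ∧ (q : ℤ) ∣ (n : ℤ) - a),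
    FR R n

/-- `ψ^*(x;q,a) = ∑_{n ≤ x, n ≡ a (q), n > a} Λ(n)`. -/
noncomputable def psiStar (x : ℝ) (q : ℕ) (a : ℤ) : ℝ :=
  ∑ n ∈ (Finset.Icc 1 ⌊x⌋₊).filter (fun n : ℕ => a < (n : ℤ) ∧ (q : ℤ) ∣ (n : ℤ) - a),
    ArithmeticFunction.vonMangoldt n

namespace SiegelWalfisz

/-- The mean value of a Dirichlet character over a period. -/
noncomputable def charMean {q : ℕ} [NeZero q] (χ : DirichletCharacter ℂ q) : ℂ :=
  (∑ j : ZMod q, χ j) / q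

lemma charMean_eq_zero {q : ℕ} [NeZero q] {χ : DirichletCharacter ℂ q} (h : χ ≠ 1) :
    charMean χ = 0 := by
  simp [charMean, χ.sum_eq_zero_of_ne_one h]

lemma norm_charMean_le {q : ℕ} [NeZero q] (χ : DirichletCharacter ℂ q) : ‖charMean χ‖ ≤ 1 := by
  have hq : (0 : ℝ) < q := by exact_mod_cast Nat.pos_of_ne_zero (NeZero.ne q)
  rw [charMean, norm_div, Complex.norm_natCast, div_le_one hq]
  calc ‖∑ j : ZMod q, χ j‖ ≤ ∑ j : ZMod q, (1 : ℝ) :=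
        norm_sum_le_of_le _ fun j _ ↦ χ.norm_le_one j
    _ = q := by simp [ZMod.card]

/-- The sum of a character over a block of `q` consecutive integers. -/
lemma sum_range_add_period {q : ℕ} [NeZero q] (χ : DirichletCharacter ℂ q) (m : ℕ) :
    ∑ k ∈ range q, χ ((m + k : ℕ) : ZMod q) = ∑ j : ZMod q, χ j := by
  refine Finset.sum_bij (fun k _ ↦ ((m + k : ℕ) : ZMod q)) (by simp) ?_ ?_ (by simp)
  · intro a ha b hb hab
    rw [mem_range] at ha hb
    have : (a : ZMod q) = b := by simpa using hab
    rw [ZMod.natCast_eq_natCast_iff'] at this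
    rwa [Nat.mod_eq_of_lt ha, Nat.mod_eq_of_lt hb] at this
  · intro j _
    refine ⟨(j - m).val, by simpa using ZMod.val_lt _, ?_⟩
    simp

lemma norm_sum_range_sub_le {q : ℕ} [NeZero q] (χ : DirichletCharacter ℂ q) (m n : ℕ) :
    ‖∑ k ∈ range n, χ ((m + k : ℕ) : ZMod q) - charMean χ * n‖ ≤ 2 * q := by
  induction n using Nat.strong_induction_on generalizing m with
  | _ n ih =>
    have hq0 : 0 < q := Nat.pos_of_ne_zero (NeZero.ne q)
    have hq : (q : ℂ) ≠ 0 := by exact_mod_cast NeZero.ne q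
    rcases lt_or_ge n q with h | h
    · have h1 : ‖∑ k ∈ range n, χ ((m + k : ℕ) : ZMod q)‖ ≤ n := by
        calc _ ≤ ∑ k ∈ range n, (1 : ℝ) := norm_sum_le_of_le _ fun j _ ↦ χ.norm_le_one _
          _ = n := by simp
      have h2 : ‖charMean χ * n‖ ≤ n := by
        rw [norm_mul, Complex.norm_natCast]
        exact mul_le_of_le_one_left (by positivity) (norm_charMean_le χ)
      have h3 : (n : ℝ) ≤ q := by exact_mod_cast h.le
      linarith [norm_sub_le (∑ k ∈ range n, χ ((m + k : ℕ) : ZMod q)) (charMean χ * n)]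
    · obtain ⟨r, rfl⟩ := Nat.exists_eq_add_of_le h
      have := ih r (by omega) (m + q)
      convert this using 2
      rw [sum_range_add, sum_range_add_period, charMean]
      push_cast
      field_simp
      simp only [add_assoc]
      ring

lemma norm_sum_Ioc_sub_le {q : ℕ} [NeZero q] (χ : DirichletCharacter ℂ q) {m n : ℕ} (h : m ≤ n) :
    ‖∑ k ∈ Ioc m n, χ (k : ZMod q) - charMean χ * (n - m : ℝ)‖ ≤ 2 * q := by
  obtain ⟨r, rfl⟩ := Nat.exists_eq_add_of_le h
  have := norm_sum_range_sub_le χ (m + 1) r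
  convert this using 3
  · rw [← Finset.Ico_add_one_add_one_eq_Ioc, Finset.sum_Ico_eq_sum_range]
    congr 2; omega
  · push_cast; ring

/-- The discrepancy of the character sum from `M` to `t`, extended by zero. -/
noncomputable def charErr {q : ℕ} [NeZero q] (χ : DirichletCharacter ℂ q) (M : ℕ) (t : ℝ) : ℂ :=
  if (M : ℝ) < t then ∑ k ∈ Ioc M ⌊t⌋₊, χ (k : ZMod q) - charMean χ * ((t - M : ℝ) : ℂ) else 0

lemma norm_charErr_le {q : ℕ} [NeZero q] (χ : DirichletCharacter ℂ q) (M : ℕ) (t : ℝ) :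
    ‖charErr χ M t‖ ≤ 3 * q := by
  have hq1 : (1 : ℝ) ≤ q := by exact_mod_cast Nat.one_le_iff_ne_zero.mpr (NeZero.ne q)
  unfold charErr
  split_ifs with h
  · have ht : 0 ≤ t := (Nat.cast_nonneg M).trans h.le
    have h1 := norm_sum_Ioc_sub_le χ (Nat.le_floor h.le)
    have h2 : ‖charMean χ * ((t - ⌊t⌋₊ : ℝ) : ℂ)‖ ≤ 1 := by
      rw [norm_mul, Complex.norm_real, Real.norm_eq_abs]
      refine mul_le_one₀ (norm_charMean_le χ) (abs_nonneg _) ?_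
      rw [abs_le]
      constructor <;> linarith [Nat.floor_le ht, Nat.lt_floor_add_one t]
    have : ∑ k ∈ Ioc M ⌊t⌋₊, χ (k : ZMod q) - charMean χ * ((t - M : ℝ) : ℂ) =
        (∑ k ∈ Ioc M ⌊t⌋₊, χ (k : ZMod q) - charMean χ * (⌊t⌋₊ - M : ℝ)) -
          charMean χ * ((t - ⌊t⌋₊ : ℝ) : ℂ) := by push_cast; ring
    rw [this]
    linarith [norm_sub_le (∑ k ∈ Ioc M ⌊t⌋₊, χ (k : ZMod q) - charMean χ * (⌊t⌋₊ - M : ℝ))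
      (charMean χ * ((t - ⌊t⌋₊ : ℝ) : ℂ))]
  · simp

lemma measurable_charErr {q : ℕ} [NeZero q] (χ : DirichletCharacter ℂ q) (M : ℕ) :
    Measurable (charErr χ M) := by
  unfold charErr
  refine Measurable.ite measurableSet_Ioi ?_ measurable_const
  refine Measurable.sub ?_ (by fun_prop)
  exact (measurable_of_countable (fun n : ℕ ↦ ∑ k ∈ Ioc M n, χ (k : ZMod q))).comp
    Nat.measurable_floor

/-- `∫_M^∞ E(t) t^{-s-1} dt`, as a Mellin transform. -/
noncomputable def charInt {q : ℕ} [NeZero q] (χ : DirichletCharacter ℂ q) (M : ℕ) (s : ℂ) : ℂ :=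
  mellin (charErr χ M) (-s)

lemma differentiableOn_charInt {q : ℕ} [NeZero q] (χ : DirichletCharacter ℂ q) {M : ℕ}
    (hM : 1 ≤ M) : DifferentiableOn ℂ (charInt χ M) {s | 0 < s.re} := by
  intro s hs
  have hs : 0 < s.re := hs
  have hloc : MeasureTheory.LocallyIntegrableOn (charErr χ M) (Set.Ioi 0) := by
    have : MeasureTheory.LocallyIntegrable (charErr χ M) := by
      have hc : MeasureTheory.LocallyIntegrable (fun _ : ℝ ↦ (3 * q : ℝ)) :=
        MeasureTheory.locallyIntegrable_const _
      refine hc.mono (measurable_charErr χ M).aestronglyMeasurable ?_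
      refine Filter.Eventually.of_forall fun t ↦ ?_
      rw [Real.norm_of_nonneg (by positivity)]
      exact norm_charErr_le χ M t
    exact this.locallyIntegrableOn _
  have htop : (charErr χ M) =O[Filter.atTop] (fun x : ℝ ↦ x ^ (-(0 : ℝ))) := by
    refine Asymptotics.IsBigO.of_bound (3 * q) (Filter.Eventually.of_forall fun t ↦ ?_)
    simpa using norm_charErr_le χ M t
  have hbot : (charErr χ M) =O[nhdsWithin 0 (Set.Ioi 0)] (fun x : ℝ ↦ x ^ (-(-s.re - 1))) := by
    refine Asymptotics.IsBigO.of_bound 1 ?_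
    have : ∀ᶠ t : ℝ in nhdsWithin 0 (Set.Ioi 0), t < 1 :=
      nhdsWithin_le_nhds (Iio_mem_nhds one_pos)
    filter_upwards [this] with t ht
    have : ¬ ((M : ℝ) < t) := by
      have : (1 : ℝ) ≤ M := by exact_mod_cast hM
      linarith
    simp [charErr, this]
  have := mellin_differentiableAt_of_isBigO_rpow (s := -s) hloc htop (by simpa using hs) hbot
    (by simp)
  exact (this.comp s (differentiableAt_id.neg)).differentiableWithinAt

lemma charInt_eq {q : ℕ} [NeZero q] (χ : DirichletCharacter ℂ q) {M : ℕ} (s : ℂ) :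
    charInt χ M s = ∫ t in Set.Ioi (M : ℝ), charErr χ M t * (t : ℂ) ^ (-(s + 1)) := by
  unfold charInt mellin
  have h : Set.Ioi (M : ℝ) ⊆ Set.Ioi 0 := Set.Ioi_subset_Ioi (Nat.cast_nonneg M)
  rw [MeasureTheory.setIntegral_eq_of_subset_of_forall_sdiff_eq_zero measurableSet_Ioi h]
  · refine MeasureTheory.setIntegral_congr_fun measurableSet_Ioi fun t _ ↦ ?_
    simp only [smul_eq_mul]
    rw [mul_comm]; ring_nf
  · intro t ht
    have : ¬ ((M : ℝ) < t) := by simpa using ht.2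
    simp [charErr, this]

lemma norm_charInt_le {q : ℕ} [NeZero q] (χ : DirichletCharacter ℂ q) {M : ℕ} (hM : 1 ≤ M) {s : ℂ}
    (hs : 0 < s.re) : ‖charInt χ M s‖ ≤ 3 * q * ((M : ℝ) ^ (-s.re) / s.re) := by
  have hM0 : (0 : ℝ) < M := by exact_mod_cast hM
  rw [charInt_eq]
  have hInt := integrableOn_Ioi_rpow_of_lt (a := -s.re - 1) (by linarith) hM0
  calc _ ≤ ∫ t in Set.Ioi (M : ℝ), 3 * q * t ^ (-s.re - 1) := by
        refine MeasureTheory.norm_integral_le_of_norm_le (hInt.const_mul _) ?_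
        refine (MeasureTheory.ae_restrict_iff' measurableSet_Ioi).mpr
          (Filter.Eventually.of_forall fun t ht ↦ ?_)
        have ht0 : 0 < t := hM0.trans ht
        rw [norm_mul, Complex.norm_cpow_eq_rpow_re_of_pos ht0]
        have : (-(s + 1)).re = -s.re - 1 := by simp; ring
        rw [this]
        gcongr
        exact norm_charErr_le χ M t
    _ = _ := by
        rw [MeasureTheory.integral_const_mul, integral_Ioi_rpow_of_lt (by linarith) hM0]
        congr 1
        rw [neg_div, ← div_neg]
        congr 1 <;> ring_nf

lemma LFunction_eq_of_one_lt_re {q : ℕ} [NeZero q] (χ : DirichletCharacter ℂ q) {M : ℕ}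
    (hM : 1 ≤ M) {s : ℂ} (hs : 1 < s.re) :
    χ.LFunction s = ∑ n ∈ Icc 1 M, χ (n : ZMod q) * (n : ℂ) ^ (-s) +
      charMean χ * (M : ℂ) ^ (1 - s) / (s - 1) + s * charInt χ M s := by
  have hM0 : (0 : ℝ) < M := by exact_mod_cast hM
  have hs0 : s ≠ 0 := by rintro rfl; norm_num at hs
  have hs1 : s - 1 ≠ 0 := by
    intro h
    rw [sub_eq_zero.mp h] at hs; norm_num at hs
  set f : ℕ → ℂ := fun n ↦ if n ≤ M then 0 else χ (n : ZMod q) with hf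
  set g : ℕ → ℂ := fun n ↦ if n ≤ M then χ (n : ZMod q) else 0 with hg
  have hfs : LSeriesSummable f s := LSeriesSummable_of_bounded_of_one_lt_re (m := 1) (fun n _ ↦ by
    simp only [hf]; split_ifs <;> simp [χ.norm_le_one]) hs
  have hgs : LSeriesSummable g s := LSeriesSummable_of_bounded_of_one_lt_re (m := 1) (fun n _ ↦ by
    simp only [hg]; split_ifs <;> simp [χ.norm_le_one]) hs
  have hsplit : χ.LFunction s = LSeries g s + LSeries f s := by
    rw [χ.LFunction_eq_LSeries hs, ← LSeries_add hgs hfs]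
    congr 1; ext n; simp only [hf, hg, Pi.add_apply]; split_ifs <;> simp
  have hgsum : LSeries g s = ∑ n ∈ Icc 1 M, χ (n : ZMod q) * (n : ℂ) ^ (-s) := by
    rw [LSeries, tsum_eq_sum (s := Icc 1 M)]
    · refine Finset.sum_congr rfl fun n hn ↦ ?_
      rw [mem_Icc] at hn
      rw [LSeries.term_of_ne_zero (by omega)]
      simp only [hg]
      rw [if_pos hn.2, Complex.cpow_neg, div_eq_mul_inv]
    · intro n hn
      rcases Nat.eq_zero_or_pos n with rfl | h0
      · simp
      · rw [LSeries.term_of_ne_zero (by omega)]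
        simp only [hg]
        rw [if_neg (by simp only [mem_Icc] at hn; omega), zero_div]
  have hSf (n : ℕ) : ∑ k ∈ Icc 1 n, f k = ∑ k ∈ Ioc M n, χ (k : ZMod q) := by
    simp only [hf]
    rw [Finset.sum_ite, Finset.sum_const_zero, zero_add]
    refine Finset.sum_congr ?_ fun _ _ ↦ rfl
    ext k; simp only [mem_filter, mem_Icc, mem_Ioc]; omega
  have hfO : (fun n ↦ ∑ k ∈ Icc 1 n, f k) =O[Filter.atTop] fun n : ℕ ↦ (n : ℝ) ^ (1 : ℝ) := by
    refine Asymptotics.IsBigO.of_bound 1 (Filter.Eventually.of_forall fun n ↦ ?_)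
    rw [Real.rpow_one, one_mul, Real.norm_natCast]
    calc _ ≤ ∑ k ∈ Icc 1 n, (1 : ℝ) := norm_sum_le_of_le _ fun k _ ↦ by
            simp only [hf]; split_ifs <;> simp [χ.norm_le_one]
      _ = n := by simp
  have hfL := LSeries_eq_mul_integral f zero_le_one hs hfs hfO
  rw [hsplit, hgsum, hfL, add_assoc]
  congr 1
  have hre : (-(s + 1)).re < -1 := by simp; linarith
  have hI1 : MeasureTheory.IntegrableOn (fun t : ℝ ↦ charErr χ M t * (t : ℂ) ^ (-(s + 1)))
      (Set.Ioi (M : ℝ)) := by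
    have h0 : MeasureTheory.IntegrableOn (fun t : ℝ ↦ (t : ℂ) ^ (-(s + 1))) (Set.Ioi (M : ℝ)) :=
      integrableOn_Ioi_cpow_of_lt hre hM0
    refine MeasureTheory.Integrable.bdd_mul h0 (c := 3 * q)
      (measurable_charErr χ M).aestronglyMeasurable ?_
    exact Filter.Eventually.of_forall fun t ↦ norm_charErr_le χ M t
  have hI2 : MeasureTheory.IntegrableOn (fun t : ℝ ↦ (t : ℂ) ^ (-s)) (Set.Ioi (M : ℝ)) :=
    integrableOn_Ioi_cpow_of_lt (by simpa using hs) hM0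
  have hI3 : MeasureTheory.IntegrableOn (fun t : ℝ ↦ (t : ℂ) ^ (-(s + 1))) (Set.Ioi (M : ℝ)) :=
    integrableOn_Ioi_cpow_of_lt hre hM0
  have key : ∫ t in Set.Ioi (1 : ℝ), (∑ k ∈ Icc 1 ⌊t⌋₊, f k) * (t : ℂ) ^ (-(s + 1)) =
      charInt χ M s + charMean χ * ((∫ t in Set.Ioi (M : ℝ), (t : ℂ) ^ (-s)) -
        M * ∫ t in Set.Ioi (M : ℝ), (t : ℂ) ^ (-(s + 1))) := by
    have hsub : Set.Ioi (M : ℝ) ⊆ Set.Ioi 1 := Set.Ioi_subset_Ioi (by exact_mod_cast hM)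
    have hI4 : MeasureTheory.IntegrableOn (fun t : ℝ ↦ charMean χ *
        ((t : ℂ) ^ (-s) - M * (t : ℂ) ^ (-(s + 1)))) (Set.Ioi (M : ℝ)) :=
      (hI2.sub (hI3.const_mul _)).const_mul _
    rw [charInt_eq, ← MeasureTheory.integral_const_mul, ← MeasureTheory.integral_sub hI2
      (hI3.const_mul _), ← MeasureTheory.integral_const_mul, ← MeasureTheory.integral_add hI1 hI4,
      MeasureTheory.setIntegral_eq_of_subset_of_forall_sdiff_eq_zero measurableSet_Ioi hsub]
    · refine MeasureTheory.setIntegral_congr_fun measurableSet_Ioi fun t ht ↦ ?_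
      have ht' : (M : ℝ) < t := ht
      have ht0 : (t : ℂ) ≠ 0 := by exact_mod_cast (hM0.trans ht').ne'
      have : (t : ℂ) ^ (-s) = t * (t : ℂ) ^ (-(s + 1)) := by
        rw [show -s = 1 + -(s + 1) by ring, Complex.cpow_add _ _ ht0, Complex.cpow_one]
      simp only [hSf, charErr, if_pos ht', this]
      push_cast
      ring
    · intro t ht
      have h1 : ⌊t⌋₊ ≤ M := by
        have : t ≤ M := by simpa using ht.2
        exact Nat.floor_le_of_le this
      simp only [hSf]
      rw [Finset.Ioc_eq_empty (by omega)]; simp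
  rw [key, integral_Ioi_cpow_of_lt (by simpa using hs) hM0, integral_Ioi_cpow_of_lt hre hM0]
  have hM1 : (M : ℂ) ≠ 0 := by exact_mod_cast hM0.ne'
  have e1 : (M : ℂ) ^ (-(s + 1) + 1) = (M : ℂ) ^ (1 - s) / M := by
    rw [show -(s + 1) + 1 = (1 - s) - 1 by ring, Complex.cpow_sub _ _ hM1, Complex.cpow_one]
  simp only [Complex.ofReal_natCast]
  rw [e1, show -s + 1 = -(s - 1) by ring, show -(s + 1) + 1 = - s by ring]
  rw [show -(s - 1) = 1 - s by ring]
  have : 1 - s ≠ 0 := by rw [← neg_sub]; exact neg_ne_zero.mpr hs1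
  rw [mul_add, add_comm (s * charInt χ M s)]
  congr 1
  field_simp
  ring

end SiegelWalfisz

namespace SiegelWalfisz

lemma eqOn_re_pos {F G : ℂ → ℂ} (hF : DifferentiableOn ℂ F {s | 0 < s.re})
    (hG : DifferentiableOn ℂ G {s | 0 < s.re}) (h : ∀ s : ℂ, 1 < s.re → F s = G s) {s : ℂ}
    (hs : 0 < s.re) : F s = G s := by
  have hopen : IsOpen {s : ℂ | 0 < s.re} := isOpen_lt continuous_const Complex.continuous_re
  have hconn : IsPreconnected {s : ℂ | 0 < s.re} := (convex_halfSpace_re_gt 0).isPreconnected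
  refine (hF.analyticOnNhd hopen).eqOn_of_preconnected_of_eventuallyEq (hG.analyticOnNhd hopen)
    hconn (z₀ := 2) (by simp) ?_ hs
  have : {s : ℂ | 1 < s.re} ∈ nhds (2 : ℂ) :=
    (isOpen_lt continuous_const Complex.continuous_re).mem_nhds (by simp)
  filter_upwards [this] with z hz using h z hz

lemma differentiable_charSum {q : ℕ} [NeZero q] (χ : DirichletCharacter ℂ q) (M : ℕ) :
    Differentiable ℂ fun s : ℂ ↦ ∑ n ∈ Icc 1 M, χ (n : ZMod q) * (n : ℂ) ^ (-s) := by
  refine Differentiable.fun_sum fun n hn ↦ ?_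
  have : NeZero n := ⟨by rw [mem_Icc] at hn; omega⟩
  fun_prop

lemma LFunction_eq_of_re_pos {q : ℕ} [NeZero q] (χ : DirichletCharacter ℂ q) {M : ℕ}
    (hM : 1 ≤ M) {s : ℂ} (hs : 0 < s.re) (hs1 : s ≠ 1 ∨ χ ≠ 1) :
    χ.LFunction s = ∑ n ∈ Icc 1 M, χ (n : ZMod q) * (n : ℂ) ^ (-s) +
      charMean χ * (M : ℂ) ^ (1 - s) / (s - 1) + s * charInt χ M s := by
  have hd1 := differentiableOn_charInt χ hM
  have hd2 := (differentiable_charSum χ M).differentiableOn (s := {s | 0 < s.re})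
  have : NeZero M := ⟨by omega⟩
  by_cases hχ : χ = 1
  · have hs1' : s ≠ 1 := hs1.resolve_right (by simpa using hχ)
    subst hχ
    have key := eqOn_re_pos (F := DirichletCharacter.LFunctionTrivChar₁ q)
      (G := fun s ↦ (s - 1) * (∑ n ∈ Icc 1 M, (1 : DirichletCharacter ℂ q) (n : ZMod q) *
        (n : ℂ) ^ (-s) + s * charInt (1 : DirichletCharacter ℂ q) M s) +
        charMean (1 : DirichletCharacter ℂ q) * (M : ℂ) ^ (1 - s))
      (DirichletCharacter.differentiable_LFunctionTrivChar₁ q).differentiableOn ?_ ?_ hs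
    · rw [DirichletCharacter.LFunctionTrivChar₁, Function.update_of_ne hs1'] at key
      have h1 : s - 1 ≠ 0 := sub_ne_zero.mpr hs1'
      refine mul_left_cancel₀ h1 (key.trans ?_)
      field_simp
      ring
    · have hd3 : DifferentiableOn ℂ (fun s : ℂ ↦ charMean (1 : DirichletCharacter ℂ q) *
          (M : ℂ) ^ (1 - s)) {s | 0 < s.re} := by
        have : Differentiable ℂ (fun s : ℂ ↦ charMean (1 : DirichletCharacter ℂ q) *
          (M : ℂ) ^ (1 - s)) := by fun_prop
        exact this.differentiableOn
      exact ((differentiableOn_id.sub_const 1).mul (hd2.add (differentiableOn_id.mul hd1))).add hd3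
    · intro z hz
      have hz1 : z ≠ 1 := by rintro rfl; norm_num at hz
      have h1 : z - 1 ≠ 0 := sub_ne_zero.mpr hz1
      rw [DirichletCharacter.LFunctionTrivChar₁, Function.update_of_ne hz1,
        DirichletCharacter.LFunctionTrivChar, LFunction_eq_of_one_lt_re _ hM hz]
      field_simp
      ring
  · rw [charMean_eq_zero hχ, zero_mul, zero_div, add_zero]
    refine eqOn_re_pos (F := χ.LFunction) (G := fun s ↦ ∑ n ∈ Icc 1 M, χ (n : ZMod q) *
        (n : ℂ) ^ (-s) + s * charInt χ M s)
      (DirichletCharacter.differentiable_LFunction hχ).differentiableOn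
      (hd2.add (differentiableOn_id.mul hd1)) ?_ hs
    intro z hz
    rw [LFunction_eq_of_one_lt_re χ hM hz, charMean_eq_zero hχ]
    simp

/-- The size parameter `q (|t| + 2)` of an `L`-function. -/
noncomputable def cond (q : ℕ) (t : ℝ) : ℝ := q * (|t| + 2)

lemma two_le_cond (q : ℕ) [NeZero q] (t : ℝ) : 2 ≤ cond q t := by
  have hq1 : (1 : ℝ) ≤ q := by exact_mod_cast Nat.one_le_iff_ne_zero.mpr (NeZero.ne q)
  unfold cond
  nlinarith [abs_nonneg t]

theorem norm_LFunction_le {ε : ℝ} (hε : 0 < ε) (hε2 : ε ≤ 1 / 2) {q : ℕ} [NeZero q]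
    (χ : DirichletCharacter ℂ q) {s : ℂ} (hs : 1 - ε ≤ s.re) (hs4 : s.re ≤ 4)
    (hs1 : s ≠ 1 ∨ χ ≠ 1) :
    ‖χ.LFunction s‖ ≤ 2 * (13 + 1 / ε) * cond q s.im ^ (2 * ε) *
      (1 + ‖charMean χ‖ / ‖s - 1‖) := by
  have hq1 : (1 : ℝ) ≤ q := by exact_mod_cast Nat.one_le_iff_ne_zero.mpr (NeZero.ne q)
  have hq0 : 0 < q := Nat.pos_of_ne_zero (NeZero.ne q)
  set t := s.im with ht
  set σ := s.re with hσ
  set D := cond q t with hD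
  have hD2 : 2 ≤ D := two_le_cond q t
  set M : ℕ := q * ⌈|t| + 2⌉₊ with hM
  have hceil : (0 : ℕ) < ⌈|t| + 2⌉₊ := Nat.ceil_pos.mpr (by positivity)
  have hM1 : 1 ≤ M := Nat.mul_pos hq0 hceil
  have hM1' : (1 : ℝ) ≤ M := by exact_mod_cast hM1
  have hM0 : (0 : ℝ) < M := by linarith
  have hDM : D ≤ M := by
    rw [hD, hM, cond]; push_cast
    gcongr; exact Nat.le_ceil _
  have hMD : (M : ℝ) ≤ 2 * D := by
    rw [hD, hM, cond]; push_cast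
    have := (Nat.ceil_lt_add_one (show 0 ≤ |t| + 2 by positivity)).le
    have h2 : |t| + 2 + 1 ≤ 2 * (|t| + 2) := by linarith [abs_nonneg t]
    calc (q : ℝ) * ⌈|t| + 2⌉₊ ≤ q * (2 * (|t| + 2)) := by gcongr; linarith
      _ = _ := by ring
  have hσ0 : 0 < σ := by linarith
  have hMe : 1 ≤ (M : ℝ) ^ ε := Real.one_le_rpow hM1' hε.le
  have hM2e : (M : ℝ) ^ (2 * ε) = (M : ℝ) ^ ε * (M : ℝ) ^ ε := by
    rw [two_mul, Real.rpow_add hM0]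
  rw [LFunction_eq_of_re_pos χ hM1 hσ0 hs1]
  have h1 : ‖∑ n ∈ Icc 1 M, χ (n : ZMod q) * (n : ℂ) ^ (-s)‖ ≤
      (1 + 1 / ε) * (M : ℝ) ^ (2 * ε) := by
    calc _ ≤ ∑ n ∈ Icc 1 M, (M : ℝ) ^ ε * (n : ℝ)⁻¹ := by
          refine norm_sum_le_of_le _ fun n hn ↦ ?_
          rw [mem_Icc] at hn
          have hn1 : (1 : ℝ) ≤ n := by exact_mod_cast hn.1
          have hn0 : (0 : ℝ) < n := by linarith
          rw [norm_mul, Complex.norm_natCast_cpow_of_pos (by omega)]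
          calc _ ≤ 1 * (n : ℝ) ^ (ε - 1) := by
                gcongr
                · exact χ.norm_le_one _
                · simp; linarith
            _ = (n : ℝ) ^ ε * (n : ℝ)⁻¹ := by
                rw [one_mul, Real.rpow_sub hn0, Real.rpow_one, div_eq_mul_inv]
            _ ≤ _ := by
                gcongr
                exact hn.2
      _ = (M : ℝ) ^ ε * (harmonic M : ℝ) := by
          rw [← Finset.mul_sum, harmonic_eq_sum_Icc]; push_cast; rfl
      _ ≤ (M : ℝ) ^ ε * (1 + Real.log M) := by
          gcongr; exact harmonic_le_one_add_log M
      _ ≤ (M : ℝ) ^ ε * (1 + (M : ℝ) ^ ε / ε) := by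
          gcongr; exact Real.log_le_rpow_div hM0.le hε
      _ ≤ (M : ℝ) ^ ε * ((M : ℝ) ^ ε + (M : ℝ) ^ ε / ε) := by gcongr
      _ = _ := by rw [hM2e]; ring
  have h2 : ‖charMean χ * (M : ℂ) ^ (1 - s) / (s - 1)‖ ≤
      (M : ℝ) ^ (2 * ε) * (‖charMean χ‖ / ‖s - 1‖) := by
    rw [norm_div, norm_mul, Complex.norm_natCast_cpow_of_pos (by omega)]
    have : (M : ℝ) ^ (1 - s).re ≤ (M : ℝ) ^ (2 * ε) := by
      refine Real.rpow_le_rpow_of_exponent_le hM1' ?_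
      simp; linarith
    calc _ ≤ ‖charMean χ‖ * (M : ℝ) ^ (2 * ε) / ‖s - 1‖ := by gcongr
      _ = _ := by ring
  have h3 : ‖s * charInt χ M s‖ ≤ 12 * (M : ℝ) ^ (2 * ε) * 1 := by
    have hns : ‖s‖ ≤ 2 * (|t| + 2) := by
      have := Complex.norm_le_abs_re_add_abs_im s
      rw [← hσ, ← ht, abs_of_pos hσ0] at this
      linarith [abs_nonneg t]
    have hσ2 : 1 / σ ≤ 2 := by
      rw [div_le_iff₀ hσ0]; linarith
    calc _ = ‖s‖ * ‖charInt χ M s‖ := norm_mul _ _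
      _ ≤ (2 * (|t| + 2)) * (3 * q * ((M : ℝ) ^ (-σ) / σ)) := by
          gcongr; exact norm_charInt_le χ hM1 hσ0
      _ = 6 * (1 / σ) * D * (M : ℝ) ^ (-σ) := by rw [hD, cond]; ring
      _ ≤ 6 * 2 * M * (M : ℝ) ^ (2 * ε - 1) := by
          gcongr
          linarith
      _ = _ := by
          rw [Real.rpow_sub hM0, Real.rpow_one]; field_simp; norm_num
  have hMfin : (M : ℝ) ^ (2 * ε) ≤ 2 * D ^ (2 * ε) := by
    calc (M : ℝ) ^ (2 * ε) ≤ (2 * D) ^ (2 * ε) := by gcongr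
      _ = 2 ^ (2 * ε) * D ^ (2 * ε) := Real.mul_rpow (by norm_num) (by linarith)
      _ ≤ 2 ^ (1 : ℝ) * D ^ (2 * ε) := by
          gcongr
          · norm_num
          · linarith
      _ = _ := by rw [Real.rpow_one]
  have hκ : 0 ≤ ‖charMean χ‖ / ‖s - 1‖ := by positivity
  have hε1 : 0 < 1 / ε := by positivity
  calc _ ≤ (1 + 1 / ε) * (M : ℝ) ^ (2 * ε) + (M : ℝ) ^ (2 * ε) * (‖charMean χ‖ / ‖s - 1‖) +
        12 * (M : ℝ) ^ (2 * ε) * 1 := norm_add₃_le.trans (by gcongr)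
    _ = (M : ℝ) ^ (2 * ε) * (13 + 1 / ε + 1 * (‖charMean χ‖ / ‖s - 1‖)) := by ring
    _ ≤ (2 * D ^ (2 * ε)) * (13 + 1 / ε + (13 + 1 / ε) * (‖charMean χ‖ / ‖s - 1‖)) := by
        gcongr; linarith
    _ = _ := by ring

end SiegelWalfisz

namespace SiegelWalfisz

lemma cond_pos (q : ℕ) [NeZero q] (t : ℝ) : 0 < cond q t := by linarith [two_le_cond q t]

lemma cond_le_two_mul {q : ℕ} {t u : ℝ} (h : |u| ≤ 2 * |t| + 2) :
    cond q u ≤ 2 * cond q t := by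
  unfold cond
  calc (q : ℝ) * (|u| + 2) ≤ q * (2 * (|t| + 2)) := by gcongr; linarith
    _ = _ := by ring

lemma cond_rpow_le {q : ℕ} [NeZero q] {t u ε : ℝ} (hε : 0 < ε) (hε1 : ε ≤ 1)
    (h : |u| ≤ 2 * |t| + 2) : cond q u ^ ε ≤ 2 * cond q t ^ ε := by
  have h0 := (cond_pos q u).le
  calc cond q u ^ ε ≤ (2 * cond q t) ^ ε := by gcongr; exact cond_le_two_mul h
    _ = 2 ^ ε * cond q t ^ ε := Real.mul_rpow (by norm_num) (cond_pos q t).le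
    _ ≤ 2 ^ (1 : ℝ) * cond q t ^ ε := by
        have := cond_pos q t
        gcongr; norm_num
    _ = _ := by rw [Real.rpow_one]

/-- Uniform upper bound for `L`-functions near the line `Re s = 1`. -/
theorem exists_norm_LFunction_le {ε : ℝ} (hε : 0 < ε) (hε1 : ε ≤ 1) :
    ∃ C : ℝ, 1 ≤ C ∧ ∀ (q : ℕ) [NeZero q] (χ : DirichletCharacter ℂ q) (s : ℂ),
      1 - ε / 2 ≤ s.re → s.re ≤ 4 → (s ≠ 1 ∨ χ ≠ 1) →
      ‖χ.LFunction s‖ ≤ C * cond q s.im ^ ε * (1 + ‖charMean χ‖ / ‖s - 1‖) := by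
  refine ⟨2 * (13 + 1 / (ε / 2)), ?_, fun q _ χ s h1 h2 h3 ↦ ?_⟩
  · have : 0 < 1 / (ε / 2) := by positivity
    linarith
  · convert norm_LFunction_le (half_pos hε) (by linarith) χ h1 h2 h3 using 3
    rw [mul_div_cancel₀ _ two_ne_zero]

theorem exists_disc_bound {ε : ℝ} (hε : 0 < ε) (hε1 : ε ≤ 1) :
    ∃ C : ℝ, 1 ≤ C ∧ ∀ (q : ℕ) [NeZero q] (χ : DirichletCharacter ℂ q) (s : ℂ),
      1 ≤ s.re → s.re ≤ 2 → (χ ≠ 1 ∨ 1 ≤ |s.im|) → ∀ z : ℂ, ‖z - s‖ ≤ ε / 2 →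
      DifferentiableAt ℂ χ.LFunction z ∧ ‖χ.LFunction z‖ ≤ C * cond q s.im ^ ε := by
  obtain ⟨C, hC1, hC⟩ := exists_norm_LFunction_le hε hε1
  refine ⟨C * 2 * 3, by linarith, fun q _ χ s h1 h2 h3 z hz ↦ ?_⟩
  have hre : |z.re - s.re| ≤ ε / 2 := (Complex.abs_re_le_norm (z - s)).trans hz
  have him : |z.im - s.im| ≤ ε / 2 := (Complex.abs_im_le_norm (z - s)).trans hz
  have hre' := abs_le.mp hre
  have him2 : |z.im| ≤ |s.im| + 1 / 2 := by
    have := abs_sub_abs_le_abs_sub z.im s.im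
    linarith
  have him3 : |s.im| ≤ |z.im| + 1 / 2 := by
    have := abs_sub_abs_le_abs_sub s.im z.im
    rw [abs_sub_comm] at this
    linarith
  have hz1 : z ≠ 1 ∨ χ ≠ 1 := by
    rcases h3 with h | h
    · exact Or.inr h
    · left; rintro rfl
      simp at him3; linarith
  refine ⟨DirichletCharacter.differentiableAt_LFunction _ _ hz1, ?_⟩
  refine (hC q χ z (by linarith) (by linarith) hz1).trans ?_
  have hk : 1 + ‖charMean χ‖ / ‖z - 1‖ ≤ 3 := by
    rcases h3 with h | h
    · rw [charMean_eq_zero h]; norm_num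
    · have h4 : 1 / 2 ≤ ‖z - 1‖ := by
        have := Complex.abs_im_le_norm (z - 1)
        simp only [Complex.sub_im, Complex.one_im, sub_zero] at this
        linarith
      have : ‖charMean χ‖ / ‖z - 1‖ ≤ 1 / (1 / 2) := by
        gcongr; exact norm_charMean_le χ
      linarith
  have hc := cond_rpow_le (q := q) (t := s.im) (u := z.im) hε hε1 (by linarith [abs_nonneg s.im])
  have := cond_pos q s.im
  calc _ ≤ C * (2 * cond q s.im ^ ε) * 3 := by gcongr
    _ = _ := by ring

theorem exists_norm_deriv_LFunction_le {ε : ℝ} (hε : 0 < ε) (hε1 : ε ≤ 1) :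
    ∃ C : ℝ, 1 ≤ C ∧ ∀ (q : ℕ) [NeZero q] (χ : DirichletCharacter ℂ q) (s : ℂ),
      1 ≤ s.re → s.re ≤ 2 → (χ ≠ 1 ∨ 1 ≤ |s.im|) →
      ‖deriv χ.LFunction s‖ ≤ C * cond q s.im ^ ε := by
  obtain ⟨C, hC1, hC⟩ := exists_disc_bound hε hε1
  refine ⟨C / (ε / 2), ?_, fun q _ χ s h1 h2 h3 ↦ ?_⟩
  · rw [le_div_iff₀ (by positivity)]; linarith
  · have := Complex.norm_deriv_le_of_forall_mem_sphere_norm_le (f := χ.LFunction) (c := s)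
      (R := ε / 2) (C := C * cond q s.im ^ ε) (by positivity) ?_ ?_
    · refine this.trans_eq (by ring)
    · refine DifferentiableOn.diffContOnCl ?_
      rw [closure_ball _ (by positivity)]
      intro z hz
      exact (hC q χ s h1 h2 h3 z (by simpa [dist_eq_norm] using hz)).1.differentiableWithinAt
    · intro z hz
      exact (hC q χ s h1 h2 h3 z (by rw [mem_sphere_iff_norm] at hz; exact hz.le)).2

/-- The consequence of the `3-4-1` inequality. -/
theorem exists_three_four_one {ε : ℝ} (hε : 0 < ε) (hε1 : ε ≤ 1) :
    ∃ C : ℝ, 1 ≤ C ∧ ∀ (q : ℕ) [NeZero q] (χ : DirichletCharacter ℂ q) (η t T : ℝ), 0 < η → η ≤ 1 →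
      1 ≤ T → ‖charMean (χ ^ 2)‖ ≤ T * ‖(η + 2 * Complex.I * t : ℂ)‖ →
      η ^ 3 ≤ (C * cond q t ^ ε * ‖χ.LFunction (1 + η + Complex.I * t)‖) ^ 4 * T := by
  obtain ⟨C, hC1, hC⟩ := exists_norm_LFunction_le hε hε1
  refine ⟨3 * C, by linarith, fun q _ χ η t T h0 h1 hT hk ↦ ?_⟩
  have hprod := DirichletCharacter.norm_LFunction_product_ge_one χ h0 t
  set D := cond q t ^ ε with hD
  have hD0 : 0 < D := Real.rpow_pos_of_pos (cond_pos q t) _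
  have hA : ‖DirichletCharacter.LFunctionTrivChar q (1 + η)‖ ≤ 2 * C * D / η := by
    have hs : (1 + η : ℂ) ≠ 1 := by
      intro h; simp at h; exact h0.ne' h
    refine (hC q 1 (1 + η) (by simp; linarith) (by simp; linarith) (Or.inl hs)).trans ?_
    have e1 : (1 + η : ℂ).im = 0 := by simp
    have e2 : ‖(1 + η : ℂ) - 1‖ = η := by simp [abs_of_pos h0]
    rw [e1, e2]
    have h3 : cond q 0 ^ ε ≤ D := by
      rw [hD]
      have := (cond_pos q 0).le
      refine Real.rpow_le_rpow this ?_ hε.le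
      unfold cond; rw [abs_zero]; gcongr; exact abs_nonneg t
    have h4 : 1 + ‖charMean (1 : DirichletCharacter ℂ q)‖ / η ≤ 2 / η := by
      have : ‖charMean (1 : DirichletCharacter ℂ q)‖ / η ≤ 1 / η := by
        gcongr; exact norm_charMean_le _
      have : 1 ≤ 1 / η := by rw [le_div_iff₀ h0]; linarith
      have : 2 / η = 1 / η + 1 / η := by ring
      linarith
    calc _ ≤ C * D * (2 / η) := by gcongr
      _ = _ := by ring
  have hB : ‖(χ ^ 2).LFunction (1 + η + 2 * Complex.I * t)‖ ≤ 4 * C * D * T := by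
    have hs : (1 + η + 2 * Complex.I * t : ℂ) ≠ 1 := by
      intro h
      have := congrArg Complex.re h
      simp at this; exact h0.ne' this
    refine (hC q (χ ^ 2) (1 + η + 2 * Complex.I * t) (by simp; linarith) (by simp; linarith)
      (Or.inl hs)).trans ?_
    have e1 : (1 + η + 2 * Complex.I * t : ℂ).im = 2 * t := by simp
    have e2 : (1 + η + 2 * Complex.I * t : ℂ) - 1 = η + 2 * Complex.I * t := by ring
    rw [e1, e2]
    have h3 : cond q (2 * t) ^ ε ≤ 2 * D := cond_rpow_le hε hε1 (by rw [abs_mul]; simp)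
    have hn : 0 < ‖(η + 2 * Complex.I * t : ℂ)‖ := by
      rw [norm_pos_iff, ← e2]; exact sub_ne_zero.mpr hs
    have h4 : ‖charMean (χ ^ 2)‖ / ‖(η + 2 * Complex.I * t : ℂ)‖ ≤ T := by
      rwa [div_le_iff₀ hn]
    calc _ ≤ C * (2 * D) * (T + T) := by gcongr
      _ = _ := by ring
  rw [norm_mul, norm_mul, norm_pow, norm_pow] at hprod
  have e3 : (1 + η + Complex.I * t : ℂ) = 1 + η + Complex.I * t := rfl
  set X := ‖χ.LFunction (1 + η + Complex.I * t)‖ with hX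
  have hX0 : 0 ≤ X := norm_nonneg _
  have hfin : 1 ≤ (2 * C * D / η) ^ 3 * X ^ 4 * (4 * C * D * T) := by
    refine le_trans hprod ?_
    gcongr
  have : (2 * C * D / η) ^ 3 * X ^ 4 * (4 * C * D * T) = 32 * (C * D * X) ^ 4 * T / η ^ 3 := by
    ring
  rw [this, le_div_iff₀ (by positivity), one_mul] at hfin
  have h5 : 0 ≤ (C * D * X) ^ 4 * T := by positivity
  calc η ^ 3 ≤ 32 * (C * D * X) ^ 4 * T := hfin
    _ ≤ (3 * C * D * X) ^ 4 * T := by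
      have : (3 * C * D * X) ^ 4 * T = 81 * ((C * D * X) ^ 4 * T) := by ring
      rw [this]; linarith

theorem exists_trivial_lower_bound {ε : ℝ} (hε : 0 < ε) (hε1 : ε ≤ 1) :
    ∃ C : ℝ, 1 ≤ C ∧ ∀ (q : ℕ) [NeZero q] (χ : DirichletCharacter ℂ q) (η t : ℝ), 0 < η → η ≤ 1 →
      η ≤ C * cond q t ^ ε * ‖χ.LFunction (1 + η + Complex.I * t)‖ := by
  obtain ⟨C, hC1, hC⟩ := exists_three_four_one hε hε1
  refine ⟨C, hC1, fun q _ χ η t h0 h1 ↦ ?_⟩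
  have hT : 1 ≤ 1 / η := by rw [le_div_iff₀ h0]; linarith
  have := hC q χ η t (1 / η) h0 h1 hT ?_
  · have h2 : η ^ 4 ≤ (C * cond q t ^ ε * ‖χ.LFunction (1 + η + Complex.I * t)‖) ^ 4 := by
      have h3 := mul_le_mul_of_nonneg_right this h0.le
      calc η ^ 4 = η ^ 3 * η := by ring
        _ ≤ _ := h3
        _ = _ := by field_simp
    have h5 := cond_pos q t
    exact le_of_pow_le_pow_left₀ (by norm_num) (by positivity) h2
  · refine (norm_charMean_le _).trans ?_
    have : η ≤ ‖(η + 2 * Complex.I * t : ℂ)‖ := by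
      have := Complex.abs_re_le_norm (η + 2 * Complex.I * t : ℂ)
      simp at this
      exact (le_abs_self _).trans this
    rw [one_div, inv_mul_eq_div, le_div_iff₀ h0]; linarith

/-- Lower bound for `L`-functions to the right of `1`, away from the possible pole of `L(s, χ²)`. -/
theorem exists_lower_bound {ε : ℝ} (hε : 0 < ε) (hε1 : ε ≤ 1) :
    ∃ c : ℝ, 0 < c ∧ ∀ (q : ℕ) [NeZero q] (χ : DirichletCharacter ℂ q) (σ t τ : ℝ),
      1 < σ → σ ≤ 2 → (χ ≠ 1 ∨ 1 ≤ |t|) → 0 < τ → τ ≤ 1 → (χ ^ 2 = 1 → τ ^ 4 ≤ |t|) →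
      c * τ ^ 4 * cond q t ^ (-(7 * ε)) ≤ ‖χ.LFunction (σ + Complex.I * t)‖ := by
  obtain ⟨C₁, hC1, hC⟩ := exists_three_four_one hε hε1
  obtain ⟨C₂, hC2, hD⟩ := exists_norm_deriv_LFunction_le hε hε1
  set K := max C₁ C₂ with hK
  have hK1 : 1 ≤ K := hC1.trans (le_max_left _ _)
  have hK0 : 0 < K := by linarith
  refine ⟨1 / (432 * K ^ 7), by positivity, fun q _ χ σ t τ hσ1 hσ2 hgood hτ0 hτ1 hτ ↦ ?_⟩
  set D := cond q t ^ ε with hDdef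
  have hc2 := two_le_cond q t
  have hD1 : 1 ≤ D := Real.one_le_rpow (by linarith) hε.le
  have hD0 : 0 < D := by linarith
  have hDpow : cond q t ^ (-(7 * ε)) = 1 / D ^ 7 := by
    rw [Real.rpow_neg (by linarith), hDdef, ← Real.rpow_natCast, ← Real.rpow_mul (by linarith)]
    rw [one_div]; congr 2; push_cast; ring
  have hbase (y : ℝ) (hy0 : 0 < y) (hy1 : y ≤ 1) :
      y ^ 3 * τ ≤ K * D * ‖χ.LFunction (1 + (y ^ 4 : ℝ) + Complex.I * t)‖ := by
    have h4 := hC q χ (y ^ 4) t (1 / τ ^ 4) (by positivity) (pow_le_one₀ hy0.le hy1) ?_ ?_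
    · set X := ‖χ.LFunction (1 + (y ^ 4 : ℝ) + Complex.I * t)‖
      have h5 : (y ^ 3 * τ) ^ 4 ≤ (K * D * X) ^ 4 := by
        have h6 := mul_le_mul_of_nonneg_right h4 (show 0 ≤ τ ^ 4 by positivity)
        calc (y ^ 3 * τ) ^ 4 = (y ^ 4) ^ 3 * τ ^ 4 := by ring
          _ ≤ (C₁ * D * X) ^ 4 * (1 / τ ^ 4) * τ ^ 4 := h6
          _ = (C₁ * D * X) ^ 4 := by field_simp
          _ ≤ _ := by
            have : 0 ≤ X := norm_nonneg _
            gcongr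
            exact le_max_left _ _
      exact le_of_pow_le_pow_left₀ (by norm_num) (by positivity) h5
    · rw [le_div_iff₀ (by positivity), one_mul]
      exact pow_le_one₀ hτ0.le hτ1
    · by_cases h2 : χ ^ 2 = 1
      · have h7 := Complex.abs_im_le_norm ((y ^ 4 : ℝ) + 2 * Complex.I * t : ℂ)
        have e : ((y ^ 4 : ℝ) + 2 * Complex.I * t : ℂ).im = 2 * t := by
          rw [Complex.add_im, Complex.ofReal_im]; simp
        rw [e, abs_mul, abs_two] at h7
        have := hτ h2
        refine (norm_charMean_le _).trans ?_
        rw [div_mul_eq_mul_div, le_div_iff₀ (by positivity)]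
        linarith [abs_nonneg t]
      · rw [charMean_eq_zero h2]; simp; positivity
  set y := τ / (6 * K ^ 2 * D ^ 2) with hy
  have hy0 : 0 < y := by positivity
  have hy1 : y ≤ 1 := by
    rw [hy, div_le_one (by positivity)]
    have : 1 ≤ K ^ 2 * D ^ 2 := one_le_mul_of_one_le_of_one_le (one_le_pow₀ hK1) (one_le_pow₀ hD1)
    linarith
  suffices h : y ^ 3 * τ / 2 ≤ K * D * ‖χ.LFunction (σ + Complex.I * t)‖ by
    rw [hDpow]
    have h8 : y ^ 3 * τ / 2 = K * D * (1 / (432 * K ^ 7) * τ ^ 4 * (1 / D ^ 7)) := by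
      rw [hy]; field_simp; norm_num
    rw [h8] at h
    exact le_of_mul_le_mul_left h (by positivity)
  rcases le_or_gt (y ^ 4) (σ - 1) with h | h
  · set z := (σ - 1) ^ (1 / 4 : ℝ) with hz
    have hz4 : z ^ 4 = σ - 1 := by
      rw [hz, ← Real.rpow_natCast, ← Real.rpow_mul (by linarith)]; norm_num
    have hz0 : 0 < z := Real.rpow_pos_of_pos (by linarith) _
    have hyz : y ≤ z := le_of_pow_le_pow_left₀ (n := 4) (by norm_num) hz0.le (by rw [hz4]; exact h)
    have hz1 : z ≤ 1 := by
      refine le_of_pow_le_pow_left₀ (n := 4) (by norm_num) zero_le_one ?_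
      rw [hz4]; linarith
    have h9 := hbase z hz0 hz1
    rw [hz4] at h9
    have e : (1 + ((σ - 1 : ℝ) : ℂ) + Complex.I * t : ℂ) = σ + Complex.I * t := by push_cast; ring
    rw [e] at h9
    refine le_trans ?_ h9
    have : y ^ 3 * τ ≤ z ^ 3 * τ := by gcongr
    have : 0 < y ^ 3 * τ := by positivity
    linarith
  · have h9 := hbase y hy0 hy1
    have hdiff : ‖χ.LFunction (1 + (y ^ 4 : ℝ) + Complex.I * t) -
        χ.LFunction (σ + Complex.I * t)‖ ≤ K * D * y ^ 4 := by
      have hy41 : y ^ 4 ≤ 1 := pow_le_one₀ hy0.le hy1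
      have hconv : Convex ℝ ({z : ℂ | 1 ≤ z.re} ∩ {z : ℂ | z.re ≤ 2} ∩ {z : ℂ | z.im = t}) :=
        ((convex_halfSpace_re_ge 1).inter (convex_halfSpace_re_le 2)).inter
          (convex_hyperplane Complex.imLm.isLinear t)
      have := hconv.norm_image_sub_le_of_norm_deriv_le (f := χ.LFunction) (C := K * D)
        (x := σ + Complex.I * t) (y := 1 + (y ^ 4 : ℝ) + Complex.I * t) ?_ ?_ ?_ ?_
      · refine this.trans ?_
        gcongr
        have e : (1 + (y ^ 4 : ℝ) + Complex.I * t : ℂ) - (σ + Complex.I * t) =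
            ((1 + y ^ 4 - σ : ℝ) : ℂ) := by push_cast; ring
        rw [e, Complex.norm_real, Real.norm_eq_abs, abs_of_nonneg (by linarith)]
        linarith
      · rintro z ⟨⟨hz1, hz2⟩, hz3⟩
        refine DirichletCharacter.differentiableAt_LFunction _ _ ?_
        rcases hgood with hg | hg
        · exact Or.inr hg
        · left; rintro rfl
          have : (0 : ℝ) = t := by simpa using hz3
          rw [← this] at hg; norm_num at hg
      · rintro z ⟨⟨hz1, hz2⟩, hz3⟩
        have hz3 : z.im = t := hz3
        have := hD q χ z hz1 hz2 (by rw [hz3]; exact hgood)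
        rw [hz3] at this
        refine this.trans ?_
        gcongr
        exact le_max_right _ _
      · refine ⟨⟨?_, ?_⟩, ?_⟩ <;> simp <;> linarith
      · refine ⟨⟨?_, ?_⟩, ?_⟩
        · simp only [Set.mem_ofPred_eq, Complex.add_re, Complex.ofReal_re]; simp; positivity
        · simp only [Set.mem_ofPred_eq, Complex.add_re, Complex.ofReal_re]; simp; linarith
        · simp only [Set.mem_ofPred_eq, Complex.add_im, Complex.ofReal_im]; simp
    have h10 := norm_sub_norm_le (χ.LFunction (1 + (y ^ 4 : ℝ) + Complex.I * t))
      (χ.LFunction (σ + Complex.I * t))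
    have h11 : K * D * (K * D * y ^ 4) ≤ y ^ 3 * τ / 2 := by
      have : K * D * (K * D * y ^ 4) = y ^ 3 * τ / 6 := by
        rw [show K * D * (K * D * y ^ 4) = y ^ 3 * (K ^ 2 * D ^ 2 * y) by ring, hy]
        field_simp
      rw [this]
      have : 0 < y ^ 3 * τ := by positivity
      linarith
    have h12 : K * D * ‖χ.LFunction (1 + (y ^ 4 : ℝ) + Complex.I * t)‖ ≤
        K * D * (K * D * y ^ 4 + ‖χ.LFunction (σ + Complex.I * t)‖) := by
      gcongr; linarith
    rw [mul_add] at h12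
    linarith

end SiegelWalfisz

namespace SiegelWalfisz

open scoped ComplexOrder

lemma apply_of_sq_eq_one {q : ℕ} {χ : DirichletCharacter ℂ q} (h : χ ^ 2 = 1) (a : ZMod q) :
    χ a = 0 ∨ χ a = 1 ∨ χ a = -1 := by
  by_cases ha : IsUnit a
  · right
    rw [← sq_eq_one_iff, ← MulChar.pow_apply' _ two_ne_zero, h, MulChar.one_apply ha]
  · exact Or.inl (χ.map_nonunit ha)

lemma ofReal_re_apply {q : ℕ} {χ : DirichletCharacter ℂ q} (h : χ ^ 2 = 1) (a : ZMod q) :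
    (((χ a).re : ℝ) : ℂ) = χ a := by
  rcases apply_of_sq_eq_one h a with h | h | h <;> rw [h] <;> simp

/-- If `F' = -F G` and the alternating derivatives of `G` are nonnegative, so are those of `F`. -/
lemma alternating_iteratedDeriv_nonneg {F G : ℂ → ℂ} {c : ℂ} (hF : AnalyticAt ℂ F c)
    (hG : AnalyticAt ℂ G c) (hFG : deriv F =ᶠ[nhds c] -(F * G)) (h0 : 0 ≤ F c)
    (hpos : ∀ m, 0 ≤ (-1) ^ m * iteratedDeriv m G c) (m : ℕ) :
    0 ≤ (-1) ^ m * iteratedDeriv m F c := by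
  induction m using Nat.strong_induction_on with
  | _ m ih =>
    rcases m with _ | m
    · simpa using h0
    · have h1 : iteratedDeriv m (deriv F) c = iteratedDeriv m (-(F * G)) c :=
        hFG.iteratedDeriv_eq m
      rw [iteratedDeriv_succ', h1, iteratedDeriv_neg,
        iteratedDeriv_mul hF.contDiffAt hG.contDiffAt, pow_succ]
      have : (-1 : ℂ) ^ m * -1 * -(∑ i ∈ range (m + 1), (m.choose i : ℂ) * iteratedDeriv i F c *
          iteratedDeriv (m - i) G c) = ∑ i ∈ range (m + 1), (m.choose i : ℂ) *
          ((-1) ^ i * iteratedDeriv i F c) * ((-1) ^ (m - i) * iteratedDeriv (m - i) G c) := by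
        rw [mul_assoc, neg_one_mul, neg_neg, Finset.mul_sum]
        refine Finset.sum_congr rfl fun i hi ↦ ?_
        have : (-1 : ℂ) ^ m = (-1) ^ i * (-1) ^ (m - i) := by
          rw [← pow_add, Nat.add_sub_cancel' (by simpa [Nat.lt_succ_iff] using hi)]
        rw [this]; ring
      rw [this]
      refine Finset.sum_nonneg fun i hi ↦ mul_nonneg (mul_nonneg (by positivity) ?_) (hpos _)
      exact ih i (by simpa using hi)

lemma iteratedDeriv_inv_sub_one (m : ℕ) (s : ℂ) :
    iteratedDeriv m (fun z : ℂ ↦ (z - 1)⁻¹) s = (-1) ^ m * m.factorial * (s - 1) ^ (-1 - m : ℤ) := by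
  have := congrFun (iteratedDeriv_comp_sub_const m (fun z : ℂ ↦ z⁻¹) 1) s
  rw [this]
  simp [iteratedDeriv_eq_iterate]

/-- Estermann's lemma. -/
lemma estermann {H : ℂ → ℂ} (hH : Differentiable ℂ H) {M : ℝ}
    (hM : ∀ s ∈ Metric.sphere (2 : ℂ) (3 / 2), ‖H s‖ ≤ M)
    (hpos : ∀ m, 0 ≤ (-1) ^ m * iteratedDeriv m (fun s ↦ H s / (s - 1)) 2) {β : ℝ}
    (hβ : 9 / 10 ≤ β) (hβ1 : β < 1) (hre : 0 ≤ (H β).re) {m : ℕ} (hm : 1 ≤ m) :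
    (H 2).re ≤ ‖H 1‖ * (2 - β) ^ m / (1 - β) + 16 * M * (11 / 15) ^ m := by
  set lam := H 1 with hlam
  set G := dslope H 1 with hG
  have hGd : Differentiable ℂ G := by
    rw [← differentiableOn_univ]
    exact (Complex.differentiableOn_dslope Filter.univ_mem).mpr hH.differentiableOn
  have hGeq (s : ℂ) (hs : s ≠ 1) : G s = (H s - lam) / (s - 1) := by
    rw [hG, dslope_of_ne _ hs, slope_def_field]
  have hlamM : ‖lam‖ ≤ M := by
    refine Complex.norm_le_of_forall_mem_frontier_norm_le (U := Metric.ball 2 (3 / 2))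
      Metric.isBounded_ball (hH.diffContOnCl) (fun z hz ↦ ?_) (subset_closure ?_)
    · rw [frontier_ball _ (by norm_num)] at hz
      exact hM z hz
    · rw [Metric.mem_ball, dist_eq_norm]; norm_num
  have hM0 : 0 ≤ M := (norm_nonneg _).trans hlamM
  have hGM : ∀ s ∈ Metric.sphere (2 : ℂ) (3 / 2), ‖G s‖ ≤ 4 * M := by
    intro s hs
    have hs2 : ‖s - 2‖ = 3 / 2 := by rwa [mem_sphere_iff_norm] at hs
    have hs1 : 1 / 2 ≤ ‖s - 1‖ := by
      have := norm_sub_norm_le (s - 2) (-1)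
      rw [hs2, norm_neg, norm_one, show s - 2 - -1 = s - 1 by ring] at this
      linarith
    have hne : s ≠ 1 := by rintro rfl; norm_num at hs1
    rw [hGeq s hne, norm_div, div_le_iff₀ (by linarith)]
    calc _ ≤ ‖H s‖ + ‖lam‖ := norm_sub_le _ _
      _ ≤ M + M := add_le_add (hM s hs) hlamM
      _ = 4 * M * (1 / 2) := by ring
      _ ≤ _ := by gcongr
  have hder (i : ℕ) : iteratedDeriv i (fun s ↦ H s / (s - 1)) 2 =
      iteratedDeriv i G 2 + lam * ((-1) ^ i * i.factorial) := by
    have h1 : (fun s ↦ H s / (s - 1)) =ᶠ[nhds 2] G + fun s ↦ lam * (s - 1)⁻¹ := by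
      filter_upwards [isOpen_ne.mem_nhds (show (2 : ℂ) ≠ 1 by norm_num)] with s hs
      have : s - 1 ≠ 0 := sub_ne_zero.mpr hs
      simp only [Pi.add_apply]
      rw [hGeq s hs]; field_simp; ring
    have hinv : ContDiffAt ℂ i (fun s : ℂ ↦ (s - 1)⁻¹) 2 :=
      ContDiffAt.inv (by fun_prop) (by norm_num)
    rw [h1.iteratedDeriv_eq, iteratedDeriv_add hGd.contDiff.contDiffAt
      (contDiffAt_const.mul hinv), iteratedDeriv_const_mul _ hinv, iteratedDeriv_inv_sub_one]
    norm_num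
  set y := 2 - β with hy
  have hy1 : 1 < y := by linarith
  have hsum := Complex.hasSum_taylorSeries_on_ball (f := G) (c := 2) (r := 2) (z := β)
    hGd.differentiableOn (by
      rw [Metric.mem_ball, dist_eq_norm, show ((β : ℂ) - 2) = ((β - 2 : ℝ) : ℂ) by push_cast; ring,
        Complex.norm_real, Real.norm_eq_abs, abs_lt]
      constructor <;> linarith)
  set T : ℕ → ℂ := fun i ↦ (i.factorial : ℂ)⁻¹ • ((β : ℂ) - 2) ^ i • iteratedDeriv i G 2 with hT
  have hfac (i : ℕ) : (i.factorial : ℂ) ≠ 0 := by exact_mod_cast i.factorial_ne_zero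
  have hpow (i : ℕ) : ((β : ℂ) - 2) ^ i = (-1) ^ i * ((y ^ i : ℝ) : ℂ) := by
    rw [hy, Complex.ofReal_pow, ← mul_pow]; congr 1; push_cast; ring
  have hTb (i : ℕ) : ‖T i‖ ≤ 4 * M * (11 / 15) ^ i := by
    have h1 := Complex.norm_iteratedDeriv_le_of_forall_mem_sphere_norm_le i
      (show (0 : ℝ) < 3 / 2 by norm_num) (hGd.diffContOnCl) hGM
    have h2 : ‖(β : ℂ) - 2‖ ≤ 11 / 10 := by
      rw [show ((β : ℂ) - 2) = ((β - 2 : ℝ) : ℂ) by push_cast; ring,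
        Complex.norm_real, Real.norm_eq_abs, abs_le]
      constructor <;> linarith
    rw [hT]
    simp only [smul_eq_mul, norm_mul, norm_inv, norm_pow, Complex.norm_natCast]
    have h3 : (0 : ℝ) < i.factorial := by exact_mod_cast i.factorial_pos
    calc _ ≤ (i.factorial : ℝ)⁻¹ * ((11 / 10) ^ i * (i.factorial * (4 * M) / (3 / 2) ^ i)) := by
          gcongr
      _ = 4 * M * ((11 / 10) ^ i / (3 / 2) ^ i) := by field_simp
      _ = _ := by rw [← div_pow]; norm_num
  have hTre (i : ℕ) : -‖lam‖ * y ^ i ≤ (T i).re := by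
    have h1 := hpos i
    rw [hder] at h1
    have h2 : T i = ((y ^ i / i.factorial : ℝ) : ℂ) * ((-1) ^ i * (iteratedDeriv i G 2 +
        lam * ((-1) ^ i * i.factorial))) - ((y ^ i : ℝ) : ℂ) * lam := by
      have h3 : ((-1 : ℂ) ^ i) * (-1) ^ i = 1 := by rw [← mul_pow]; norm_num
      rw [hT]; simp only [smul_eq_mul]
      rw [hpow, mul_add, show (-1 : ℂ) ^ i * (lam * ((-1) ^ i * i.factorial)) =
        ((-1 : ℂ) ^ i * (-1) ^ i) * lam * i.factorial by ring, h3]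
      push_cast; field_simp [hfac i]; ring
    rw [h2, Complex.sub_re, Complex.re_ofReal_mul, Complex.re_ofReal_mul]
    have h4 := (Complex.le_def.mp h1).1
    rw [Complex.zero_re] at h4
    have h5 : 0 ≤ y ^ i / i.factorial := by positivity
    have h6 := mul_nonneg h5 h4
    have h7 : y ^ i * lam.re ≤ y ^ i * ‖lam‖ := by gcongr; exact Complex.re_le_norm _
    linarith
  have hT0 : (H 2).re - ‖lam‖ ≤ (T 0).re := by
    have : T 0 = H 2 - lam := by
      rw [hT]; simp only [Nat.factorial_zero, iteratedDeriv_zero]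
      rw [hGeq 2 (by norm_num)]; norm_num
    rw [this, Complex.sub_re]
    linarith [Complex.re_le_norm lam]
  have hsplit := hsum.summable.sum_add_tsum_nat_add m
  rw [hsum.tsum_eq] at hsplit
  have htail : ‖∑' i, T (i + m)‖ ≤ 15 * M * (11 / 15) ^ m := by
    have hg := (hasSum_geometric_of_lt_one (r := (11 / 15 : ℝ)) (by norm_num)
      (by norm_num)).mul_left (4 * M * (11 / 15) ^ m)
    refine (tsum_of_norm_bounded hg fun i ↦ ?_).trans_eq (by ring)
    refine (hTb _).trans_eq (by rw [pow_add]; ring)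
  have hGre : (G β).re ≤ ‖lam‖ / (1 - β) := by
    have h1 : H β = G β * ((β - 1 : ℝ) : ℂ) + lam := by
      have hne : (β : ℂ) ≠ 1 := by exact_mod_cast hβ1.ne
      rw [hGeq β hne]
      have : (β : ℂ) - 1 ≠ 0 := sub_ne_zero.mpr hne
      push_cast; field_simp; ring
    rw [h1, Complex.add_re, Complex.re_mul_ofReal] at hre
    rw [le_div_iff₀ (by linarith)]
    linarith [Complex.re_le_norm lam]
  have hhead : (H 2).re - ‖lam‖ * ∑ i ∈ range m, y ^ i ≤ (∑ i ∈ range m, T i).re := by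
    obtain ⟨k, rfl⟩ : ∃ k, m = k + 1 := ⟨m - 1, by omega⟩
    rw [Finset.sum_range_succ', Finset.sum_range_succ', Complex.add_re, Complex.re_sum, mul_add,
      Finset.mul_sum]
    have : ∑ i ∈ range k, -(‖lam‖ * y ^ (i + 1)) ≤ ∑ i ∈ range k, (T (i + 1)).re :=
      Finset.sum_le_sum fun i _ ↦ by linarith [hTre (i + 1)]
    rw [Finset.sum_neg_distrib] at this
    rw [pow_zero, mul_one]
    linarith
  have hgeom : ∑ i ∈ range m, y ^ i = (y ^ m - 1) / (1 - β) := by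
    rw [geom_sum_eq hy1.ne']; congr 1; rw [hy]; ring
  have h1 : (G β).re = (∑ i ∈ range m, T i).re + (∑' i, T (i + m)).re := by
    rw [← Complex.add_re]; exact congrArg Complex.re hsplit.symm
  have h2 := (abs_le.mp ((Complex.abs_re_le_norm _).trans htail)).1
  rw [hgeom] at hhead
  have h3 : ‖lam‖ * y ^ m / (1 - β) = ‖lam‖ * ((y ^ m - 1) / (1 - β)) + ‖lam‖ / (1 - β) := by ring
  have h4 : 0 ≤ M * (11 / 15) ^ m := by positivity
  rw [h3]; linarith

end SiegelWalfisz

namespace SiegelWalfisz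

open scoped ComplexOrder

/-- The entire function `(s - 1) ζ(s)`. -/
noncomputable def zetaOne : ℂ → ℂ := DirichletCharacter.LFunctionTrivChar₁ 1

lemma differentiable_zetaOne : Differentiable ℂ zetaOne :=
  DirichletCharacter.differentiable_LFunctionTrivChar₁ 1

lemma zetaOne_one : zetaOne 1 = 1 := by
  simp [zetaOne, DirichletCharacter.LFunctionTrivChar₁]

lemma zetaOne_of_ne {s : ℂ} (hs : s ≠ 1) : zetaOne s = (s - 1) * riemannZeta s := by
  rw [zetaOne, DirichletCharacter.LFunctionTrivChar₁, Function.update_of_ne hs,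
    DirichletCharacter.LFunctionTrivChar, DirichletCharacter.LFunction_modOne_eq]

lemma exists_LFunction_two_eq {q : ℕ} [NeZero q] {χ : DirichletCharacter ℂ q} (h : χ ^ 2 = 1) :
    ∃ r : ℝ, 1 / 4 ≤ r ∧ χ.LFunction 2 = r := by
  have h2 : (1 : ℝ) < (2 : ℂ).re := by norm_num
  have hs := hasSum_zeta_two
  have hterm (n : ℕ) : LSeries.term (χ ·) 2 n = (((χ n).re * (1 / (n : ℝ) ^ 2) : ℝ) : ℂ) := by
    rcases eq_or_ne n 0 with rfl | hn
    · simp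
    · rw [LSeries.term_of_ne_zero hn]
      push_cast
      rw [ofReal_re_apply h, Complex.cpow_ofNat]; ring
  have hsumm : Summable fun n : ℕ ↦ (χ n).re * (1 / (n : ℝ) ^ 2) := by
    have : LSeriesSummable (χ ·) 2 := ZMod.LSeriesSummable_of_one_lt_re χ h2
    rw [LSeriesSummable, funext hterm] at this
    exact_mod_cast this
  refine ⟨∑' n : ℕ, (χ n).re * (1 / (n : ℝ) ^ 2), ?_, ?_⟩
  · have h3 := hsumm.add hs.summable
    have h4 := h3.le_tsum 1 fun n _ ↦ by
      have h5 : -1 ≤ (χ n).re := by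
        rcases apply_of_sq_eq_one h (n : ZMod q) with h | h | h <;> rw [h] <;> norm_num
      have : (0 : ℝ) ≤ 1 / (n : ℝ) ^ 2 := by positivity
      nlinarith
    rw [hsumm.tsum_add hs.summable, hs.tsum_eq] at h4
    simp at h4
    have := Real.pi_lt_d2
    have := Real.pi_pos
    norm_num at h4 ⊢
    nlinarith
  · rw [DirichletCharacter.LFunction_eq_LSeries _ h2, LSeries, funext hterm, Complex.ofReal_tsum]

/-- `(s - 1) ζ(s) L(s, χ₁) L(s, χ₂) L(s, χ₁ χ₂)`. -/
noncomputable def quadProd {Q : ℕ} [NeZero Q] (χ₁ χ₂ : DirichletCharacter ℂ Q) (s : ℂ) : ℂ :=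
  zetaOne s * (χ₁.LFunction s * (χ₂.LFunction s * (χ₁ * χ₂).LFunction s))

lemma differentiable_quadProd {Q : ℕ} [NeZero Q] {χ₁ χ₂ : DirichletCharacter ℂ Q} (h₁ : χ₁ ≠ 1)
    (h₂ : χ₂ ≠ 1) (h₁₂ : χ₁ * χ₂ ≠ 1) : Differentiable ℂ (quadProd χ₁ χ₂) := by
  have := DirichletCharacter.differentiable_LFunction h₁
  have := DirichletCharacter.differentiable_LFunction h₂
  have := DirichletCharacter.differentiable_LFunction h₁₂
  have := differentiable_zetaOne
  unfold quadProd
  fun_prop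

lemma one_le_re_quadProd_two {Q : ℕ} [NeZero Q] {χ₁ χ₂ : DirichletCharacter ℂ Q}
    (h₁ : χ₁ ^ 2 = 1) (h₂ : χ₂ ^ 2 = 1) :
    1 / 64 ≤ (quadProd χ₁ χ₂ 2).re ∧ 0 ≤ quadProd χ₁ χ₂ 2 := by
  obtain ⟨r₁, hr₁, e₁⟩ := exists_LFunction_two_eq h₁
  obtain ⟨r₂, hr₂, e₂⟩ := exists_LFunction_two_eq h₂
  obtain ⟨r₃, hr₃, e₃⟩ := exists_LFunction_two_eq (χ := χ₁ * χ₂) (by rw [mul_pow, h₁, h₂, one_mul])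
  have hz : zetaOne 2 = ((π ^ 2 / 6 : ℝ) : ℂ) := by
    rw [zetaOne_of_ne (by norm_num), riemannZeta_two]; push_cast; norm_num
  have hpi : (1 : ℝ) ≤ π ^ 2 / 6 := by nlinarith [Real.pi_gt_three]
  have : quadProd χ₁ χ₂ 2 = ((π ^ 2 / 6 * (r₁ * (r₂ * r₃)) : ℝ) : ℂ) := by
    rw [quadProd, hz, e₁, e₂, e₃]; push_cast; ring
  have hr : (1 / 64 : ℝ) ≤ π ^ 2 / 6 * (r₁ * (r₂ * r₃)) := by
    calc (1 / 64 : ℝ) = 1 * (1 / 4 * (1 / 4 * (1 / 4))) := by norm_num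
      _ ≤ _ := by gcongr
  rw [this]
  refine ⟨by rwa [Complex.ofReal_re], ?_⟩
  rw [Complex.zero_le_real]
  linarith

lemma quadProd_alternating {Q : ℕ} [NeZero Q] {χ₁ χ₂ : DirichletCharacter ℂ Q} (h₁ : χ₁ ≠ 1)
    (h₂ : χ₂ ≠ 1) (h₁₂ : χ₁ * χ₂ ≠ 1) (hq₁ : χ₁ ^ 2 = 1) (hq₂ : χ₂ ^ 2 = 1) (m : ℕ) :
    0 ≤ (-1) ^ m * iteratedDeriv m (fun s ↦ quadProd χ₁ χ₂ s / (s - 1)) 2 := by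
  let Λ' : ℕ → ℂ := fun n ↦ (ArithmeticFunction.vonMangoldt n : ℂ)
  let f : ℕ → ℂ := Λ' + ((fun n : ℕ ↦ χ₁ n) * Λ' + ((fun n : ℕ ↦ χ₂ n) * Λ' +
    (fun n : ℕ ↦ (χ₁ * χ₂) n) * Λ'))
  have hΛ {s : ℂ} (hs : 1 < s.re) : LSeriesSummable Λ' s :=
    ArithmeticFunction.LSeriesSummable_vonMangoldt hs
  have hχ (χ : DirichletCharacter ℂ Q) {s : ℂ} (hs : 1 < s.re) :
      LSeriesSummable ((fun n : ℕ ↦ χ n) * Λ') s :=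
    DirichletCharacter.LSeriesSummable_twist_vonMangoldt χ hs
  have hf {s : ℂ} (hs : 1 < s.re) : LSeriesSummable f s :=
    (hΛ hs).add ((hχ _ hs).add ((hχ _ hs).add (hχ _ hs)))
  have hfL {s : ℂ} (hs : 1 < s.re) : LSeries f s = LSeries Λ' s + (LSeries ((fun n : ℕ ↦ χ₁ n) * Λ') s
      + (LSeries ((fun n : ℕ ↦ χ₂ n) * Λ') s + LSeries ((fun n : ℕ ↦ (χ₁ * χ₂) n) * Λ') s)) := by
    rw [LSeries_add (hΛ hs) ((hχ _ hs).add ((hχ _ hs).add (hχ _ hs))),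
      LSeries_add (hχ _ hs) ((hχ _ hs).add (hχ _ hs)), LSeries_add (hχ _ hs) (hχ _ hs)]
  have habs : LSeries.abscissaOfAbsConv f ≤ (3 / 2 : ℝ) :=
    LSeriesSummable.abscissaOfAbsConv_le (s := (3 / 2 : ℝ)) (hf (by norm_num))
  have habs2 : LSeries.abscissaOfAbsConv f < (2 : ℝ) :=
    habs.trans_lt (by exact_mod_cast (by norm_num : (3 / 2 : ℝ) < 2))
  have hpos : 0 ≤ f := by
    intro n
    have : f n = (ArithmeticFunction.vonMangoldt n : ℂ) * ((1 + χ₁ n) * (1 + χ₂ n)) := by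
      simp only [f, Λ', Pi.add_apply, Pi.mul_apply, MulChar.mul_apply]; ring
    rw [this]
    have hnn (χ : DirichletCharacter ℂ Q) (h : χ ^ 2 = 1) : 0 ≤ 1 + χ n := by
      rcases apply_of_sq_eq_one h (n : ZMod Q) with h | h | h <;> rw [h] <;> norm_num
    refine mul_nonneg ?_ (mul_nonneg (hnn _ hq₁) (hnn _ hq₂))
    rw [Complex.zero_le_real]
    exact ArithmeticFunction.vonMangoldt_nonneg
  have hopen : {s : ℂ | 1 < s.re} ∈ nhds (2 : ℂ) :=
    (isOpen_lt continuous_const Complex.continuous_re).mem_nhds (by norm_num)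
  refine alternating_iteratedDeriv_nonneg (G := LSeries f) ?_ ?_ ?_ ?_ ?_ m
  · refine AnalyticAt.div ?_ (by fun_prop) (by norm_num)
    exact (differentiable_quadProd h₁ h₂ h₁₂).analyticAt 2
  · refine LSeries_analyticOnNhd f 2 ?_
    simpa using habs2
  · filter_upwards [hopen] with s hs
    have hs : 1 < s.re := hs
    have hs1 : s ≠ 1 := by rintro rfl; norm_num at hs
    have hev : (fun s ↦ quadProd χ₁ χ₂ s / (s - 1)) =ᶠ[nhds s] fun s ↦ riemannZeta s *
        (χ₁.LFunction s * (χ₂.LFunction s * (χ₁ * χ₂).LFunction s)) := by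
      filter_upwards [isOpen_ne.mem_nhds hs1] with z hz
      have : z - 1 ≠ 0 := sub_ne_zero.mpr hz
      rw [quadProd, zetaOne_of_ne hz]; field_simp
    have hL (χ : DirichletCharacter ℂ Q) : LSeries ((fun n : ℕ ↦ χ n) * Λ') s =
        - logDeriv χ.LFunction s := by
      rw [logDeriv_apply, DirichletCharacter.LFunction_eq_LSeries _ hs,
        DirichletCharacter.deriv_LFunction_eq_deriv_LSeries _ hs, ← neg_div]
      exact DirichletCharacter.LSeries_twist_vonMangoldt_eq χ hs
    have hZ : LSeries Λ' s = - logDeriv riemannZeta s := by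
      rw [logDeriv_apply, ← neg_div]
      exact ArithmeticFunction.LSeries_vonMangoldt_eq_deriv_riemannZeta_div hs
    have hne (χ : DirichletCharacter ℂ Q) : χ.LFunction s ≠ 0 :=
      DirichletCharacter.LFunction_ne_zero_of_one_le_re χ (Or.inr hs1) hs.le
    have hd (χ : DirichletCharacter ℂ Q) : DifferentiableAt ℂ χ.LFunction s :=
      DirichletCharacter.differentiableAt_LFunction χ s (Or.inl hs1)
    have hzne := riemannZeta_ne_zero_of_one_le_re hs.le
    have hlog := logDeriv_mul (f := riemannZeta) (g := fun s ↦ χ₁.LFunction s *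
      (χ₂.LFunction s * (χ₁ * χ₂).LFunction s)) s hzne (mul_ne_zero (hne χ₁) (mul_ne_zero (hne χ₂) (hne (χ₁ * χ₂))))
      (differentiableAt_riemannZeta hs1) ((hd _).mul ((hd _).mul (hd _)))
    rw [logDeriv_mul (f := χ₁.LFunction) (g := fun s ↦ χ₂.LFunction s * (χ₁ * χ₂).LFunction s)
      s (hne χ₁) (mul_ne_zero (hne χ₂) (hne (χ₁ * χ₂))) (hd _) ((hd _).mul (hd _)),
      logDeriv_mul s (hne χ₂) (hne (χ₁ * χ₂)) (hd _) (hd _), logDeriv_apply] at hlog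
    rw [div_eq_iff (mul_ne_zero hzne (mul_ne_zero (hne χ₁) (mul_ne_zero (hne χ₂) (hne _))))] at hlog
    simp only [Pi.neg_apply, Pi.mul_apply]
    rw [hev.deriv_eq, hlog, hev.eq_of_nhds, hfL hs, hL, hL, hL, hZ]
    ring
  · have := (one_le_re_quadProd_two hq₁ hq₂).2
    simpa [show (2 : ℂ) - 1 = 1 by norm_num] using this
  · intro k
    have := LSeries.iteratedDeriv_alternating hpos (x := 2) habs2 k
    simpa using this

end SiegelWalfisz

namespace SiegelWalfisz

theorem exists_quadProd_bound :
    ∃ C : ℝ, 1 ≤ C ∧ ∀ (Q : ℕ) [NeZero Q] (χ₁ χ₂ : DirichletCharacter ℂ Q) (β : ℝ), χ₁ ≠ 1 →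
      χ₂ ≠ 1 → χ₁ * χ₂ ≠ 1 → χ₁ ^ 2 = 1 → χ₂ ^ 2 = 1 → 9 / 10 ≤ β → β < 1 →
      0 ≤ (quadProd χ₁ χ₂ β).re →
      1 - β ≤ C * (Q : ℝ) ^ (10 * (1 - β)) * ‖quadProd χ₁ χ₂ 1‖ := by
  obtain ⟨C, hC1, hC⟩ := exists_norm_LFunction_le one_pos le_rfl
  obtain ⟨K₀, hK₀⟩ := (isCompact_sphere (2 : ℂ) (3 / 2)).exists_bound_of_continuousOn
    differentiable_zetaOne.continuous.continuousOn
  set K := 64 * (max K₀ 1) * C ^ 3 with hK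
  have hm1 : 1 ≤ max K₀ 1 := le_max_right _ _
  have hC3 : 1 ≤ C ^ 3 := one_le_pow₀ hC1
  have hK1 : 1 ≤ K := by
    have := one_le_mul_of_one_le_of_one_le hm1 hC3
    rw [hK, mul_assoc]; linarith
  refine ⟨128 * 8 * (2048 * K), by linarith, fun Q _ χ₁ χ₂ β h₁ h₂ h₁₂ hq₁ hq₂ hβ hβ1 hre ↦ ?_⟩
  have hQ1 : (1 : ℝ) ≤ Q := by exact_mod_cast Nat.one_le_iff_ne_zero.mpr (NeZero.ne Q)
  have hL (χ : DirichletCharacter ℂ Q) (hχ : χ ≠ 1) (s : ℂ)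
      (hs : s ∈ Metric.sphere (2 : ℂ) (3 / 2)) : ‖χ.LFunction s‖ ≤ 4 * C * Q := by
    rw [mem_sphere_iff_norm] at hs
    have hr := abs_le.mp ((Complex.abs_re_le_norm (s - 2)).trans hs.le)
    have hi := (Complex.abs_im_le_norm (s - 2)).trans hs.le
    simp only [Complex.sub_re, Complex.sub_im, Complex.re_ofNat, Complex.im_ofNat, sub_zero]
      at hr hi
    have := hC Q χ s (by linarith [hr.1]) (by linarith [hr.2]) (Or.inr hχ)
    rw [charMean_eq_zero hχ] at this
    simp only [norm_zero, zero_div, add_zero, mul_one, Real.rpow_one] at this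
    refine this.trans ?_
    have : cond Q s.im ≤ 4 * Q := by
      rw [cond, mul_comm 4]; gcongr; linarith
    calc C * cond Q s.im ≤ C * (4 * Q) := by gcongr
      _ = _ := by ring
  set M := K * (Q : ℝ) ^ 3 with hM
  have hHM : ∀ s ∈ Metric.sphere (2 : ℂ) (3 / 2), ‖quadProd χ₁ χ₂ s‖ ≤ M := by
    intro s hs
    rw [quadProd, norm_mul, norm_mul, norm_mul]
    calc _ ≤ max K₀ 1 * ((4 * C * Q) * ((4 * C * Q) * (4 * C * Q))) := by
          gcongr
          · exact (hK₀ s hs).trans (le_max_left _ _)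
          · exact hL _ h₁ s hs
          · exact hL _ h₂ s hs
          · exact hL _ h₁₂ s hs
      _ = M := by rw [hM, hK]; ring
  set X := 2048 * K * (Q : ℝ) ^ 3 with hX
  have hX1 : 1 ≤ X := by
    have := one_le_mul_of_one_le_of_one_le hK1 (one_le_pow₀ hQ1 (n := 3))
    rw [hX, mul_assoc]; linarith
  have hX0 : 0 < X := by linarith
  set m := ⌈10 / 3 * Real.log X⌉₊ + 1 with hm
  have hest := estermann (differentiable_quadProd h₁ h₂ h₁₂) hHM
    (quadProd_alternating h₁ h₂ h₁₂ hq₁ hq₂) hβ hβ1 hre (m := m) (by omega)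
  have hlog : 0 ≤ Real.log X := Real.log_nonneg hX1
  have hm_lo : 10 / 3 * Real.log X ≤ m := by
    rw [hm]; push_cast; linarith [Nat.le_ceil (10 / 3 * Real.log X)]
  have hm_hi : (m : ℝ) ≤ 10 / 3 * Real.log X + 2 := by
    rw [hm]; push_cast
    linarith [(Nat.ceil_lt_add_one (show 0 ≤ 10 / 3 * Real.log X by positivity)).le]
  have htail : 16 * M * (11 / 15 : ℝ) ^ m ≤ 1 / 128 := by
    have h1 : (11 / 15 : ℝ) ≤ Real.exp (-(3 / 10)) := by
      rw [Real.exp_neg, ← one_div, le_div_iff₀ (Real.exp_pos _)]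
      have h2 : Real.exp (3 / 10) ≤ 15 / 11 := by
        refine le_of_pow_le_pow_left₀ (n := 10) (by norm_num) (by norm_num) ?_
        rw [← Real.exp_nat_mul, show ((10 : ℕ) : ℝ) * (3 / 10) = ((3 : ℕ) : ℝ) * 1 by norm_num,
          Real.exp_nat_mul]
        calc Real.exp 1 ^ 3 ≤ 2.7182818286 ^ 3 := by gcongr; exact Real.exp_one_lt_d9.le
          _ ≤ _ := by norm_num
      linarith
    have h3 : (11 / 15 : ℝ) ^ m ≤ 1 / X := by
      calc (11 / 15 : ℝ) ^ m ≤ Real.exp (-(3 / 10)) ^ m := by gcongr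
        _ = Real.exp (-(3 / 10 * m)) := by rw [← Real.exp_nat_mul]; congr 1; ring
        _ ≤ Real.exp (-Real.log X) := by gcongr; linarith
        _ = _ := by rw [Real.exp_neg, Real.exp_log hX0, one_div]
    calc 16 * M * (11 / 15 : ℝ) ^ m ≤ 16 * M * (1 / X) := by gcongr
      _ = 1 / 128 := by rw [hM, hX]; field_simp; norm_num
  have hym : (2 - β) ^ m ≤ 8 * (2048 * K) * (Q : ℝ) ^ (10 * (1 - β)) := by
    calc (2 - β) ^ m ≤ Real.exp (1 - β) ^ m := by
          gcongr
          · linarith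
          · linarith [Real.add_one_le_exp (1 - β)]
      _ = Real.exp (m * (1 - β)) := (Real.exp_nat_mul _ _).symm
      _ ≤ Real.exp ((10 / 3 * Real.log X + 2) * (1 - β)) := by
          gcongr
      _ = X ^ (10 / 3 * (1 - β)) * Real.exp (2 * (1 - β)) := by
          rw [Real.rpow_def_of_pos hX0, ← Real.exp_add]; congr 1; ring
      _ ≤ ((2048 * K) ^ (1 : ℝ) * (Q : ℝ) ^ (10 * (1 - β))) * 8 := by
          gcongr
          · rw [hX, Real.mul_rpow (by positivity) (by positivity)]
            gcongr
            · linarith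
            · linarith
            · rw [← Real.rpow_natCast, ← Real.rpow_mul (by positivity)]
              apply le_of_eq; congr 1; push_cast; ring
          · calc Real.exp (2 * (1 - β)) ≤ Real.exp 1 := by gcongr; linarith
              _ ≤ 8 := by linarith [Real.exp_one_lt_d9]
      _ = _ := by rw [Real.rpow_one]; ring
  have h64 := (one_le_re_quadProd_two hq₁ hq₂).1
  have h5 : 1 / 128 ≤ ‖quadProd χ₁ χ₂ 1‖ * (2 - β) ^ m / (1 - β) := by linarith
  rw [le_div_iff₀ (by linarith)] at h5
  have h6 : ‖quadProd χ₁ χ₂ 1‖ * (2 - β) ^ m ≤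
      ‖quadProd χ₁ χ₂ 1‖ * (8 * (2048 * K) * (Q : ℝ) ^ (10 * (1 - β))) := by gcongr
  linarith

lemma exists_four_pow_primeFactors_le {ε : ℝ} (hε : 0 < ε) :
    ∃ C : ℝ, 1 ≤ C ∧ ∀ n : ℕ, n ≠ 0 → (4 : ℝ) ^ #n.primeFactors ≤ C * (n : ℝ) ^ ε := by
  set P := ⌈(4 : ℝ) ^ (1 / ε)⌉₊ with hP
  refine ⟨4 ^ P, one_le_pow₀ (by norm_num), fun n hn ↦ ?_⟩
  have h1 : (4 : ℝ) ^ #n.primeFactors = ∏ p ∈ n.primeFactors, 4 := by simp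
  have h2 : ∀ p ∈ n.primeFactors, (4 : ℝ) ≤ (if p < P then 4 else 1) * (p : ℝ) ^ ε := by
    intro p hp
    have hp1 : (1 : ℝ) ≤ p := by exact_mod_cast (Nat.prime_of_mem_primeFactors hp).one_le
    split_ifs with h
    · have := Real.one_le_rpow hp1 hε.le
      linarith
    · rw [one_mul]
      have h3 : (4 : ℝ) ^ (1 / ε) ≤ p := (Nat.le_ceil _).trans (by exact_mod_cast not_lt.mp h)
      calc (4 : ℝ) = ((4 : ℝ) ^ (1 / ε)) ^ ε := by
            rw [← Real.rpow_mul (by norm_num), one_div_mul_cancel hε.ne', Real.rpow_one]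
        _ ≤ _ := by gcongr
  rw [h1]
  refine (Finset.prod_le_prod (fun _ _ ↦ by norm_num) h2).trans ?_
  rw [Finset.prod_mul_distrib, Finset.prod_ite, Finset.prod_const, Finset.prod_const_one, mul_one]
  gcongr
  · norm_num
  · refine (Finset.card_le_card (t := range P) fun p hp ↦ ?_).trans_eq (card_range P)
    simp at hp ⊢; exact hp.2
  · rw [Real.finsetProd_rpow _ _ (fun _ _ ↦ by positivity)]
    gcongr
    rw [← Nat.cast_prod]
    exact_mod_cast Nat.le_of_dvd (Nat.pos_of_ne_zero hn) (Nat.prod_primeFactors_dvd n)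

lemma norm_eulerFactor {q : ℕ} (χ : DirichletCharacter ℂ q) {p : ℕ} (hp : p.Prime) :
    ‖1 - χ p * (p : ℂ) ^ (-1 : ℂ)‖ ≤ 2 ∧ 1 / 2 ≤ ‖1 - χ p * (p : ℂ) ^ (-1 : ℂ)‖ := by
  have h : ‖χ p * (p : ℂ) ^ (-1 : ℂ)‖ ≤ 1 / 2 := by
    rw [Complex.cpow_neg_one, norm_mul, norm_inv, Complex.norm_natCast]
    have hp2 : (2 : ℝ) ≤ p := by exact_mod_cast hp.two_le
    calc _ ≤ 1 * (2 : ℝ)⁻¹ := by gcongr; exact χ.norm_le_one _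
      _ = _ := by norm_num
  have h1 := norm_sub_le (1 : ℂ) (χ p * (p : ℂ) ^ (-1 : ℂ))
  have h2 := norm_sub_norm_le (1 : ℂ) (χ p * (p : ℂ) ^ (-1 : ℂ))
  rw [norm_one] at h1 h2
  constructor <;> linarith

lemma norm_LFunction_changeLevel_one {q Q : ℕ} [NeZero q] [NeZero Q] (h : q ∣ Q)
    {χ : DirichletCharacter ℂ q} (hχ : χ ≠ 1) :
    ‖(χ.changeLevel h).LFunction 1‖ ≤ 2 ^ #Q.primeFactors * ‖χ.LFunction 1‖ ∧
    ‖χ.LFunction 1‖ ≤ 2 ^ #Q.primeFactors * ‖(χ.changeLevel h).LFunction 1‖ := by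
  rw [DirichletCharacter.LFunction_changeLevel h χ (Or.inl hχ), norm_mul, norm_prod]
  have h1 : ∏ p ∈ Q.primeFactors, ‖1 - χ p * (p : ℂ) ^ (-1 : ℂ)‖ ≤ 2 ^ #Q.primeFactors := by
    rw [← Finset.prod_const]
    exact Finset.prod_le_prod (fun _ _ ↦ norm_nonneg _) fun p hp ↦
      (norm_eulerFactor χ (Nat.prime_of_mem_primeFactors hp)).1
  have h2 : (1 / 2) ^ #Q.primeFactors ≤ ∏ p ∈ Q.primeFactors, ‖1 - χ p * (p : ℂ) ^ (-1 : ℂ)‖ := by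
    rw [← Finset.prod_const]
    exact Finset.prod_le_prod (fun _ _ ↦ by norm_num) fun p hp ↦
      (norm_eulerFactor χ (Nat.prime_of_mem_primeFactors hp)).2
  constructor
  · rw [mul_comm]; gcongr
  · calc ‖χ.LFunction 1‖ = 2 ^ #Q.primeFactors * (‖χ.LFunction 1‖ * (1 / 2) ^ #Q.primeFactors) := by
          rw [mul_comm ‖_‖, ← mul_assoc, ← mul_pow]; norm_num
      _ ≤ _ := by gcongr

end SiegelWalfisz

namespace SiegelWalfisz

lemma im_LFunction_eq_zero {q : ℕ} [NeZero q] {χ : DirichletCharacter ℂ q} (h : χ ≠ 1)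
    (h2 : χ ^ 2 = 1) {β : ℝ} (hβ : 0 < β) : (χ.LFunction β).im = 0 := by
  have hbound (M : ℕ) (hM : 1 ≤ M) : |(χ.LFunction β).im| ≤ 3 * q * (M : ℝ) ^ (-β) := by
    rw [LFunction_eq_of_re_pos χ hM (s := β) (by simpa using hβ) (Or.inr h), charMean_eq_zero h,
      zero_mul, zero_div, add_zero, Complex.add_im, Complex.im_sum]
    have h0 : ∀ n ∈ Icc 1 M, (χ (n : ZMod q) * (n : ℂ) ^ (-(β : ℂ))).im = 0 := by
      intro n _
      rw [← ofReal_re_apply h2, Complex.im_ofReal_mul,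
        ← Complex.ofReal_natCast, ← Complex.ofReal_neg, ← Complex.ofReal_cpow (by positivity),
        Complex.ofReal_im, mul_zero]
    rw [Finset.sum_eq_zero h0, zero_add]
    have hc := norm_charInt_le χ hM (s := β) (by simpa using hβ)
    rw [Complex.ofReal_re] at hc
    refine (Complex.abs_im_le_norm _).trans ?_
    rw [norm_mul, Complex.norm_real, Real.norm_of_nonneg hβ.le]
    calc β * ‖charInt χ M β‖ ≤ β * (3 * q * ((M : ℝ) ^ (-β) / β)) := by gcongr
      _ = _ := by field_simp
  have hlim : Filter.Tendsto (fun M : ℕ ↦ 3 * (q : ℝ) * (M : ℝ) ^ (-β)) Filter.atTop (nhds 0) := by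
    have := ((tendsto_rpow_neg_atTop hβ).comp tendsto_natCast_atTop_atTop).const_mul (3 * (q : ℝ))
    simpa using this
  have := ge_of_tendsto hlim (Filter.eventually_atTop.mpr ⟨1, hbound⟩)
  exact abs_eq_zero.mp (le_antisymm this (abs_nonneg _))

lemma re_LFunction_pos {q : ℕ} [NeZero q] {χ : DirichletCharacter ℂ q} (h : χ ≠ 1)
    (h2 : χ ^ 2 = 1) {β : ℝ} (hβ : 0 < β) (hβ1 : β ≤ 1)
    (hz : ∀ u : ℝ, β ≤ u → u < 1 → χ.LFunction u ≠ 0) : 0 < (χ.LFunction β).re := by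
  have hne (u : ℝ) (hu : β ≤ u) : (χ.LFunction u).re ≠ 0 := by
    intro h0
    have h3 : χ.LFunction u = 0 := Complex.ext h0 (im_LFunction_eq_zero h h2 (hβ.trans_le hu))
    rcases lt_or_ge u 1 with h1 | h1
    · exact hz u hu h1 h3
    · exact DirichletCharacter.LFunction_ne_zero_of_one_le_re χ (Or.inl h) (by simpa using h1) h3
  obtain ⟨r, hr, hr2⟩ := exists_LFunction_two_eq h2
  by_contra! hneg
  have hcont : ContinuousOn (fun u : ℝ ↦ (χ.LFunction u).re) (Set.Icc β 2) :=
    (Complex.continuous_re.comp ((DirichletCharacter.differentiable_LFunction h).continuous.comp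
      Complex.continuous_ofReal)).continuousOn
  have h0 : (0 : ℝ) ∈ Set.Icc (χ.LFunction β).re (χ.LFunction (2 : ℝ)).re := by
    refine ⟨hneg, ?_⟩
    rw [Complex.ofReal_ofNat, hr2, Complex.ofReal_re]; linarith
  obtain ⟨u, hu, hu0⟩ := intermediate_value_Icc (by linarith) hcont h0
  exact hne u hu.1 hu0

/-- **Siegel's theorem** on the size of `L(1, χ)` for quadratic `χ`. -/
theorem siegel {ε : ℝ} (hε : 0 < ε) (hε1 : ε ≤ 1) :
    ∃ c : ℝ, 0 < c ∧ ∀ (q : ℕ) [NeZero q] (χ : DirichletCharacter ℂ q), χ ≠ 1 → χ ^ 2 = 1 →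
      c * (q : ℝ) ^ (-ε) ≤ ‖χ.LFunction 1‖ := by
  obtain ⟨δ₀, hδ₀, hδ⟩ : ∃ δ₀ > 0, ∀ β : ℝ, 1 - δ₀ < β → β < 1 → 0 < (zetaOne β).re := by
    have hc : ContinuousAt (fun u : ℝ ↦ (zetaOne u).re) 1 :=
      (Complex.continuous_re.comp (differentiable_zetaOne.continuous.comp
        Complex.continuous_ofReal)).continuousAt
    have : ∀ᶠ u : ℝ in nhds 1, 0 < (zetaOne u).re := by
      refine hc.eventually (lt_mem_nhds ?_)
      simp [zetaOne_one]
    obtain ⟨δ₀, hδ₀, h⟩ := Metric.eventually_nhds_iff.mp this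
    refine ⟨δ₀, hδ₀, fun β h1 h2 ↦ h ?_⟩
    rw [Real.dist_eq, abs_sub_comm, abs_of_pos (by linarith)]; linarith
  set δ := min δ₀ (ε / 40) with hδdef
  have hδpos : 0 < δ := lt_min hδ₀ (by positivity)
  have hδε : δ ≤ ε / 40 := min_le_right _ _
  have hδδ : δ ≤ δ₀ := min_le_left _ _
  by_cases hex : ∃ (q : ℕ) (_ : NeZero q) (χ : DirichletCharacter ℂ q), χ ≠ 1 ∧ χ ^ 2 = 1
  swap
  · push Not at hex
    exact ⟨1, one_pos, fun q _ χ h1 h2 ↦ absurd h2 (hex q inferInstance χ h1)⟩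
  obtain ⟨q₁, _, χ₁, h₁, hq₁, β, hβ, hβ1, hsign⟩ : ∃ (q₁ : ℕ) (_ : NeZero q₁)
      (χ₁ : DirichletCharacter ℂ q₁), χ₁ ≠ 1 ∧ χ₁ ^ 2 = 1 ∧ ∃ β : ℝ, 1 - δ < β ∧ β < 1 ∧
      ∀ (Q : ℕ) [NeZero Q] (hQ : q₁ ∣ Q) (χ₂ : DirichletCharacter ℂ Q), χ₂ ≠ 1 → χ₂ ^ 2 = 1 →
        χ₁.changeLevel hQ * χ₂ ≠ 1 → 0 ≤ (quadProd (χ₁.changeLevel hQ) χ₂ β).re := by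
    by_cases hzero : ∃ (q₁ : ℕ) (_ : NeZero q₁) (χ₁ : DirichletCharacter ℂ q₁), χ₁ ≠ 1 ∧
        χ₁ ^ 2 = 1 ∧ ∃ β : ℝ, 1 - δ < β ∧ β < 1 ∧ χ₁.LFunction β = 0
    · obtain ⟨q₁, i, χ₁, h₁, hq₁, β, hβ, hβ1, hz⟩ := hzero
      refine ⟨q₁, i, χ₁, h₁, hq₁, β, hβ, hβ1, fun Q _ hQ χ₂ _ _ _ ↦ ?_⟩
      rw [quadProd, DirichletCharacter.LFunction_changeLevel hQ χ₁ (Or.inl h₁), hz]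
      simp
    · obtain ⟨q₁, i, χ₁, h₁, hq₁⟩ := hex
      refine ⟨q₁, i, χ₁, h₁, hq₁, 1 - δ / 2, by linarith, by linarith, fun Q _ hQ χ₂ h₂ hq₂ h₁₂ ↦ ?_⟩
      push Not at hzero
      have hreal (χ : DirichletCharacter ℂ Q) (h : χ ≠ 1) (h2 : χ ^ 2 = 1) :
          ∃ r : ℝ, 0 < r ∧ χ.LFunction (1 - δ / 2 : ℝ) = r :=
        ⟨_, re_LFunction_pos (β := 1 - δ / 2) h h2 (by linarith) (by linarith) fun u hu hu1 ↦
          hzero Q inferInstance χ h h2 u (by linarith) hu1,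
          Complex.ext (Complex.ofReal_re _).symm
            ((im_LFunction_eq_zero h h2 (by linarith)).trans (Complex.ofReal_im _).symm)⟩
      have hsq : (χ₁.changeLevel hQ) ^ 2 = 1 := by rw [← map_pow, hq₁, map_one]
      obtain ⟨r₁, hr₁, e₁⟩ := hreal (χ₁.changeLevel hQ)
        (fun h ↦ h₁ ((DirichletCharacter.changeLevel_eq_one_iff hQ).mp h)) hsq
      obtain ⟨r₂, hr₂, e₂⟩ := hreal χ₂ h₂ hq₂
      obtain ⟨r₃, hr₃, e₃⟩ := hreal _ h₁₂ (by rw [mul_pow, hsq, hq₂, one_mul])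
      rw [quadProd, e₁, e₂, e₃, ← Complex.ofReal_mul, ← Complex.ofReal_mul, Complex.re_mul_ofReal]
      have := hδ (1 - δ / 2) (by linarith) (by linarith)
      positivity
  obtain ⟨C₁, hC₁, hB₁⟩ := exists_quadProd_bound
  obtain ⟨C₂, hC₂, hB₂⟩ := exists_four_pow_primeFactors_le (show 0 < ε / 4 by positivity)
  obtain ⟨C₃, hC₃, hB₃⟩ := exists_norm_LFunction_le (show 0 < ε / 8 by positivity) (by linarith)
  have hL₁ : 0 < ‖χ₁.LFunction 1‖ := norm_pos_iff.mpr
    (DirichletCharacter.LFunction_ne_zero_of_one_le_re χ₁ (Or.inl h₁) (by simp))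
  set c₀ := min (‖χ₁.LFunction 1‖ / C₂) ((1 - β) / (4 * C₁ * C₂ * C₃ ^ 2)) with hc₀
  have hc₀pos : 0 < c₀ := lt_min (by positivity) (div_pos (by linarith) (by positivity))
  have hq1pos : (0 : ℝ) < q₁ := by exact_mod_cast Nat.pos_of_ne_zero (NeZero.ne q₁)
  refine ⟨c₀ / (q₁ : ℝ) ^ ε, by positivity, fun q₂ _ χ₂ h₂ hq₂ ↦ ?_⟩
  have hq2pos : (0 : ℝ) < q₂ := by exact_mod_cast Nat.pos_of_ne_zero (NeZero.ne q₂)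
  set Q := q₁ * q₂ with hQ
  have hQ1 : (1 : ℝ) ≤ Q := by exact_mod_cast Nat.one_le_iff_ne_zero.mpr (NeZero.ne Q)
  have hd₁ : q₁ ∣ Q := dvd_mul_right _ _
  have hd₂ : q₂ ∣ Q := dvd_mul_left _ _
  suffices hmain : c₀ ≤ (Q : ℝ) ^ ε * ‖χ₂.LFunction 1‖ by
    rw [Real.rpow_neg hq2pos.le, div_mul_eq_mul_div, ← div_eq_mul_inv, div_div,
      div_le_iff₀ (by positivity)]
    rw [hQ] at hmain; push_cast at hmain
    rw [Real.mul_rpow hq1pos.le hq2pos.le] at hmain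
    linarith
  have h4 := hB₂ Q (NeZero.ne Q)
  have h24 : (2 : ℝ) ^ #Q.primeFactors ≤ 4 ^ #Q.primeFactors := by gcongr; norm_num
  obtain ⟨-, hcl₁⟩ := norm_LFunction_changeLevel_one hd₁ h₁
  obtain ⟨hcl₂, -⟩ := norm_LFunction_changeLevel_one hd₂ h₂
  set ψ₁ := χ₁.changeLevel hd₁ with hψ₁
  set ψ₂ := χ₂.changeLevel hd₂ with hψ₂
  have hne₁ : ψ₁ ≠ 1 := fun h ↦ h₁ ((DirichletCharacter.changeLevel_eq_one_iff hd₁).mp h)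
  have hne₂ : ψ₂ ≠ 1 := fun h ↦ h₂ ((DirichletCharacter.changeLevel_eq_one_iff hd₂).mp h)
  have hsq₁ : ψ₁ ^ 2 = 1 := by rw [hψ₁, ← map_pow, hq₁, map_one]
  have hsq₂ : ψ₂ ^ 2 = 1 := by rw [hψ₂, ← map_pow, hq₂, map_one]
  have hX := norm_nonneg (χ₂.LFunction 1)
  by_cases h₁₂ : ψ₁ * ψ₂ = 1
  · have heq : ψ₁ = ψ₂ := by
      have : ψ₁ * ψ₂ = ψ₁ * ψ₁ := by rw [h₁₂, ← sq, hsq₁]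
      exact (mul_left_cancel this).symm
    rw [heq] at hcl₁
    refine (min_le_left _ _).trans ?_
    rw [div_le_iff₀ (by positivity)]
    calc ‖χ₁.LFunction 1‖ ≤ 2 ^ #Q.primeFactors * (2 ^ #Q.primeFactors * ‖χ₂.LFunction 1‖) :=
          hcl₁.trans (by gcongr)
      _ = 4 ^ #Q.primeFactors * ‖χ₂.LFunction 1‖ := by rw [← mul_assoc, ← mul_pow]; norm_num
      _ ≤ C₂ * (Q : ℝ) ^ (ε / 4) * ‖χ₂.LFunction 1‖ := by gcongr
      _ ≤ C₂ * (Q : ℝ) ^ ε * ‖χ₂.LFunction 1‖ := by gcongr; linarith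
      _ = _ := by ring
  · refine (min_le_right _ _).trans ?_
    rw [div_le_iff₀ (by positivity)]
    have hb := hB₁ Q ψ₁ ψ₂ β hne₁ hne₂ h₁₂ hsq₁ hsq₂ (by linarith) hβ1
      (hsign Q hd₁ ψ₂ hne₂ hsq₂ h₁₂)
    have hup (χ : DirichletCharacter ℂ Q) (h : χ ≠ 1) :
        ‖χ.LFunction 1‖ ≤ 2 * C₃ * (Q : ℝ) ^ (ε / 8) := by
      have := hB₃ Q χ 1 (by simp; positivity) (by simp) (Or.inr h)
      rw [charMean_eq_zero h] at this
      simp only [norm_zero, zero_div, add_zero, mul_one, Complex.one_im] at this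
      refine this.trans ?_
      calc C₃ * cond Q 0 ^ (ε / 8) = C₃ * ((2 : ℝ) ^ (ε / 8) * (Q : ℝ) ^ (ε / 8)) := by
            rw [cond, abs_zero, zero_add, mul_comm (Q : ℝ), Real.mul_rpow (by norm_num) (by linarith)]
        _ ≤ C₃ * ((2 : ℝ) ^ (1 : ℝ) * (Q : ℝ) ^ (ε / 8)) := by
            gcongr
            · norm_num
            · linarith
        _ = _ := by rw [Real.rpow_one]; ring
    rw [quadProd, zetaOne_one, one_mul, norm_mul, norm_mul] at hb
    calc 1 - β ≤ C₁ * (Q : ℝ) ^ (10 * (1 - β)) * ((2 * C₃ * (Q : ℝ) ^ (ε / 8)) *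
          ((C₂ * (Q : ℝ) ^ (ε / 4) * ‖χ₂.LFunction 1‖) * (2 * C₃ * (Q : ℝ) ^ (ε / 8)))) := by
          refine hb.trans ?_
          gcongr
          · exact hup _ hne₁
          · refine hcl₂.trans ?_
            gcongr
            exact h24.trans h4
          · exact hup _ h₁₂
      _ = (Q : ℝ) ^ (10 * (1 - β) + ε / 8 + ε / 4 + ε / 8) * ‖χ₂.LFunction 1‖ *
          (4 * C₁ * C₂ * C₃ ^ 2) := by
          rw [Real.rpow_add (by linarith), Real.rpow_add (by linarith), Real.rpow_add (by linarith)]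
          ring
      _ ≤ (Q : ℝ) ^ ε * ‖χ₂.LFunction 1‖ * (4 * C₁ * C₂ * C₃ ^ 2) := by
          gcongr
          linarith

end SiegelWalfisz

namespace SiegelWalfisz

/-- Lower bound for `L`-functions on `1 < Re s ≤ 2`, uniform in the modulus (ineffective). -/
theorem exists_cond_rpow_le_norm_LFunction {ε : ℝ} (hε : 0 < ε) (hε1 : ε ≤ 1) :
    ∃ c : ℝ, 0 < c ∧ ∀ (q : ℕ) [NeZero q] (χ : DirichletCharacter ℂ q) (σ t : ℝ),
      1 < σ → σ ≤ 2 → (χ ≠ 1 ∨ 1 ≤ |t|) →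
      c * cond q t ^ (-ε) ≤ ‖χ.LFunction (σ + Complex.I * t)‖ := by
  set e := ε / 9 with he
  have he0 : 0 < e := by positivity
  have he1 : e ≤ 1 := by linarith
  obtain ⟨c₁, hc₁, h₁⟩ := exists_lower_bound he0 he1
  obtain ⟨c₂', hc₂', h₂'⟩ := siegel he0 he1
  obtain ⟨C₃, hC₃, h₃⟩ := exists_norm_deriv_LFunction_le he0 he1
  obtain ⟨C₄, hC₄, h₄⟩ := exists_trivial_lower_bound he0 he1
  set c₂ := min c₂' 1 with hc₂def
  have hc₂ : 0 < c₂ := lt_min hc₂' one_pos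
  have hc₂1 : c₂ ≤ 1 := min_le_right _ _
  set d := c₂ / (4 * C₃) with hd
  have hd0 : 0 < d := by positivity
  have hd1 : d ≤ 1 := by rw [hd, div_le_one (by positivity)]; linarith
  refine ⟨min c₁ (min (c₂ / 2) (min (d / (2 * C₄)) (c₁ * (d / 2)))), by positivity,
    fun q _ χ σ t hσ1 hσ2 hgood ↦ ?_⟩
  set D := cond q t with hD
  have hD2 : 2 ≤ D := two_le_cond q t
  have hD1 : 1 ≤ D := by linarith
  have hD0 : 0 < D := by linarith
  set X := ‖χ.LFunction (σ + Complex.I * t)‖ with hX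
  by_cases hcase : χ ^ 2 = 1 → 1 ≤ |t|
  · have := h₁ q χ σ t 1 hσ1 hσ2 hgood one_pos le_rfl (by simpa using hcase)
    rw [one_pow, mul_one] at this
    refine le_trans ?_ this
    gcongr
    · exact min_le_left _ _
    · linarith
  push Not at hcase
  obtain ⟨hsq, ht⟩ := hcase
  have hχ : χ ≠ 1 := hgood.resolve_right (not_le.mpr ht)
  set s : ℂ := σ + Complex.I * t with hs
  have hre : s.re = σ := by simp [hs]
  have him : s.im = t := by simp [hs]
  rcases le_or_gt ‖s - 1‖ (d * D ^ (-(2 * e))) with hnear | hfar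
  · have hS : c₂ * D ^ (-e) ≤ ‖χ.LFunction 1‖ := by
      refine le_trans ?_ (h₂' q χ hχ hsq)
      have hq0 : (0 : ℝ) < q := by exact_mod_cast Nat.pos_of_ne_zero (NeZero.ne q)
      have hqD : (q : ℝ) ≤ D := by
        rw [hD, cond]; nlinarith [abs_nonneg t]
      exact mul_le_mul (min_le_left _ _) (Real.rpow_le_rpow_of_nonpos hq0 hqD (by linarith))
        (by positivity) hc₂'.le
    have hconv : Convex ℝ ({z : ℂ | 1 ≤ z.re} ∩ {z : ℂ | z.re ≤ 2} ∩
        ({z : ℂ | -1 ≤ z.im} ∩ {z : ℂ | z.im ≤ 1})) :=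
      ((convex_halfSpace_re_ge 1).inter (convex_halfSpace_re_le 2)).inter
        ((convex_halfSpace_im_ge _).inter (convex_halfSpace_im_le _))
    have hts := abs_lt.mp ht
    have hdiff := hconv.norm_image_sub_le_of_norm_deriv_le (f := χ.LFunction)
      (C := C₃ * (2 * D ^ e)) (x := s) (y := 1)
      (fun z _ ↦ DirichletCharacter.differentiableAt_LFunction _ _ (Or.inr hχ)) ?_ ?_ ?_
    · have h5 : ‖χ.LFunction 1 - χ.LFunction s‖ ≤ c₂ / 2 * D ^ (-e) := by
        refine hdiff.trans ?_
        rw [norm_sub_rev 1 s]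
        calc _ ≤ C₃ * (2 * D ^ e) * (d * D ^ (-(2 * e))) := by gcongr
          _ = (2 * C₃ * d) * (D ^ e * D ^ (-(2 * e))) := by ring
          _ = c₂ / 2 * D ^ (-e) := by
            rw [← Real.rpow_add hD0, hd]
            congr 1
            · field_simp; norm_num
            · congr 1; ring
      have h6 := norm_sub_norm_le (χ.LFunction 1) (χ.LFunction s)
      have h7 : c₂ / 2 * D ^ (-e) ≤ X := by linarith
      refine le_trans ?_ h7
      gcongr
      · exact (min_le_right _ _).trans (min_le_left _ _)
      · linarith
    · rintro z ⟨⟨hz1, hz2⟩, hz3, hz4⟩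
      refine (h₃ q χ z hz1 hz2 (Or.inl hχ)).trans ?_
      gcongr
      refine cond_rpow_le he0 he1 ?_
      have : |z.im| ≤ 1 := abs_le.mpr ⟨hz3, hz4⟩
      linarith [abs_nonneg t]
    · refine ⟨⟨?_, ?_⟩, ?_, ?_⟩ <;> simp only [Set.mem_ofPred_eq, hre, him] <;> linarith
    · refine ⟨⟨?_, ?_⟩, ?_, ?_⟩ <;> norm_num
  · set b := d * D ^ (-(2 * e)) with hb
    have hb0 : 0 < b := by positivity
    have hb1 : b ≤ 1 := by
      have : D ^ (-(2 * e)) ≤ 1 := Real.rpow_le_one_of_one_le_of_nonpos hD1 (by linarith)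
      calc b ≤ 1 * 1 := by rw [hb]; gcongr
        _ = 1 := one_mul 1
    have hsum : b / 2 ≤ σ - 1 ∨ b / 2 ≤ |t| := by
      by_contra! h
      have := Complex.norm_le_abs_re_add_abs_im (s - 1)
      simp only [Complex.sub_re, Complex.sub_im, Complex.one_re, Complex.one_im, sub_zero, hre,
        him] at this
      rw [abs_of_pos (by linarith)] at this
      linarith
    rcases hsum with h | h
    · have h5 := h₄ q χ (σ - 1) t (by linarith) (by linarith)
      have hee : (1 + ((σ - 1 : ℝ) : ℂ) + Complex.I * t : ℂ) = s := by
        rw [hs]; push_cast; ring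
      rw [hee] at h5
      have h6 : d / (2 * C₄) * D ^ (-(3 * e)) ≤ X := by
        have h7 : b / 2 ≤ C₄ * D ^ e * X := h.trans h5
        have h8 : b / 2 = C₄ * D ^ e * (d / (2 * C₄) * D ^ (-(3 * e))) := by
          have : D ^ e * D ^ (-(3 * e)) = D ^ (-(2 * e)) := by
            rw [← Real.rpow_add hD0]; congr 1; ring
          rw [hb, ← this]; field_simp
        rw [h8] at h7
        exact le_of_mul_le_mul_left h7 (by positivity)
      refine le_trans ?_ h6
      gcongr
      · exact ((min_le_right _ _).trans (min_le_right _ _)).trans (min_le_left _ _)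
      · linarith
    · have hτ : ((b / 2) ^ (1 / 4 : ℝ)) ^ 4 = b / 2 := by
        rw [← Real.rpow_natCast, ← Real.rpow_mul (by positivity)]; norm_num
      have h5 := h₁ q χ σ t ((b / 2) ^ (1 / 4 : ℝ)) hσ1 hσ2 hgood (by positivity)
        (Real.rpow_le_one (by positivity) (by linarith) (by norm_num)) (fun _ ↦ by rw [hτ]; exact h)
      rw [hτ] at h5
      refine le_trans ?_ h5
      have h6 : c₁ * (b / 2) * cond q t ^ (-(7 * e)) = c₁ * (d / 2) * D ^ (-(9 * e)) := by
        have : D ^ (-(9 * e)) = D ^ (-(2 * e)) * D ^ (-(7 * e)) := by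
          rw [← Real.rpow_add hD0]; congr 1; ring
        rw [this, hb]; ring
      rw [h6]
      gcongr
      · exact ((min_le_right _ _).trans (min_le_right _ _)).trans (min_le_right _ _)
      · linarith

/-- Cauchy estimates for the logarithmic derivative. -/
lemma norm_iteratedDeriv_logDeriv_le {f : ℂ → ℂ} {s : ℂ} {r U l : ℝ} (hr : 0 < r) (hl : 0 < l)
    (hd : ∀ z, ‖z - s‖ ≤ r → DifferentiableAt ℂ f z) (hU : ∀ z, ‖z - s‖ ≤ r → ‖f z‖ ≤ U)
    (hfl : l ≤ ‖f s‖) (k : ℕ) :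
    ‖iteratedDeriv k (logDeriv f) s‖ ≤ k.factorial * (4 * U / (r * l)) ^ (k + 1) := by
  have hlU : l ≤ U := hfl.trans (hU s (by simpa using hr.le))
  have hU0 : 0 < U := hl.trans_le hlU
  set ρ := r * l / (4 * U) with hρ
  have hρ0 : 0 < ρ := by positivity
  have hρr : ρ ≤ r / 4 := by
    rw [hρ, div_le_div_iff₀ (by positivity) (by norm_num)]; nlinarith
  have hderiv (z : ℂ) (hz : ‖z - s‖ ≤ r / 2) : ‖deriv f z‖ ≤ U / (r / 2) := by
    have hsub (w : ℂ) (hw : ‖w - z‖ ≤ r / 2) : ‖w - s‖ ≤ r := by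
      have := norm_add_le (w - z) (z - s)
      rw [sub_add_sub_cancel] at this; linarith
    refine Complex.norm_deriv_le_of_forall_mem_sphere_norm_le (by positivity) ?_ fun w hw ↦ ?_
    · refine DifferentiableOn.diffContOnCl ?_
      rw [closure_ball _ (by positivity)]
      intro w hw
      exact (hd w (hsub w (by simpa [dist_eq_norm] using hw))).differentiableWithinAt
    · exact hU w (hsub w (by rw [mem_sphere_iff_norm] at hw; exact hw.le))
  have hlow (z : ℂ) (hz : ‖z - s‖ ≤ ρ) : l / 2 ≤ ‖f z‖ := by
    have h1 := (convex_closedBall s ρ).norm_image_sub_le_of_norm_deriv_le (f := f)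
      (C := U / (r / 2)) (x := z) (y := s)
      (fun w hw ↦ hd w (by rw [mem_closedBall_iff_norm] at hw; linarith))
      (fun w hw ↦ hderiv w (by rw [mem_closedBall_iff_norm] at hw; linarith))
      (by rwa [mem_closedBall_iff_norm]) (Metric.mem_closedBall_self hρ0.le)
    rw [norm_sub_rev s z] at h1
    have h2 : U / (r / 2) * ‖z - s‖ ≤ l / 2 := by
      calc _ ≤ U / (r / 2) * ρ := by gcongr
        _ = l / 2 := by rw [hρ]; field_simp; norm_num
    have h3 := norm_sub_norm_le (f s) (f z)
    linarith
  have hcauchy := Complex.norm_iteratedDeriv_le_of_forall_mem_sphere_norm_le (f := logDeriv f)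
    (c := s) (R := ρ) (C := 1 / ρ) k hρ0 ?_ ?_
  · refine hcauchy.trans_eq ?_
    have : 4 * U / (r * l) = 1 / ρ := by rw [hρ, one_div_div]
    rw [this, one_div, pow_succ, inv_pow]; field_simp
  · refine DifferentiableOn.diffContOnCl ?_
    rw [closure_ball _ hρ0.ne']
    intro w hw
    rw [mem_closedBall_iff_norm] at hw
    have hopen : DifferentiableOn ℂ f (Metric.ball s r) := fun v hv ↦
      (hd v (by rw [mem_ball_iff_norm] at hv; exact hv.le)).differentiableWithinAt
    have hmem : Metric.ball s r ∈ nhds w :=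
      Metric.isOpen_ball.mem_nhds (by rw [mem_ball_iff_norm]; linarith)
    have han := hopen.analyticAt hmem
    have hne : f w ≠ 0 := by
      rw [← norm_pos_iff]; linarith [hlow w hw]
    exact (han.deriv.div han hne).differentiableAt.differentiableWithinAt
  · intro z hz
    rw [mem_sphere_iff_norm] at hz
    have h1 := hlow z hz.le
    have h2 := hderiv z (by linarith)
    rw [logDeriv_apply, norm_div]
    calc _ ≤ U / (r / 2) / (l / 2) := by gcongr
      _ = 1 / ρ := by rw [hρ]; field_simp; norm_num

/-- Bounds for the derivatives of `L'/L` on `1 < Re s ≤ 2`. -/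
theorem exists_norm_iteratedDeriv_logDeriv_LFunction_le (k : ℕ) {ε : ℝ} (hε : 0 < ε) (hε1 : ε ≤ 1) :
    ∃ C : ℝ, 0 < C ∧ ∀ (q : ℕ) [NeZero q] (χ : DirichletCharacter ℂ q) (σ t : ℝ),
      1 < σ → σ ≤ 2 → (χ ≠ 1 ∨ 1 ≤ |t|) →
      ‖iteratedDeriv k (logDeriv χ.LFunction) (σ + Complex.I * t)‖ ≤ C * cond q t ^ ε := by
  set e := ε / (2 * (k + 1)) with he
  have he0 : 0 < e := by positivity
  have he1 : e ≤ 1 := by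
    rw [he, div_le_one (by positivity)]
    have : (0 : ℝ) ≤ k := by positivity
    linarith
  obtain ⟨C₁, hC₁, h₁⟩ := exists_disc_bound he0 he1
  obtain ⟨c₂, hc₂, h₂⟩ := exists_cond_rpow_le_norm_LFunction he0 he1
  refine ⟨k.factorial * (4 * C₁ / (e / 2 * c₂)) ^ (k + 1), by positivity,
    fun q _ χ σ t hσ1 hσ2 hg ↦ ?_⟩
  set D := cond q t with hD
  have hD0 : 0 < D := cond_pos q t
  have hre : (σ + Complex.I * t : ℂ).re = σ := by simp
  have him : (σ + Complex.I * t : ℂ).im = t := by simp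
  have h1 := h₁ q χ (σ + Complex.I * t) (by rw [hre]; exact hσ1.le) (by rw [hre]; exact hσ2)
    (by rw [him]; exact hg)
  rw [him] at h1
  have := norm_iteratedDeriv_logDeriv_le (half_pos he0) (by positivity) (fun z hz ↦ (h1 z hz).1)
    (fun z hz ↦ (h1 z hz).2) (h₂ q χ σ t hσ1 hσ2 hg) k
  refine this.trans_eq ?_
  have h5 : 4 * (C₁ * D ^ e) / (e / 2 * (c₂ * D ^ (-e))) = 4 * C₁ / (e / 2 * c₂) * D ^ (2 * e) := by
    have : D ^ (2 * e) = D ^ e * D ^ e := by rw [← Real.rpow_add hD0]; congr 1; ring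
    rw [Real.rpow_neg hD0.le, this]; field_simp
  rw [h5, mul_pow, mul_assoc]
  congr 2
  rw [← Real.rpow_natCast, ← Real.rpow_mul hD0.le]
  congr 1
  rw [he]; push_cast; field_simp

end SiegelWalfisz

namespace SiegelWalfisz

open ArithmeticFunction (vonMangoldt)

lemma norm_LSeries_logMul_eq {f : ℕ → ℂ} {F : ℂ → ℂ}
    (hf : ∀ s : ℂ, 1 < s.re → LSeriesSummable f s) (hF : ∀ s : ℂ, 1 < s.re → LSeries f s = F s)
    (k : ℕ) {s : ℂ} (hs : 1 < s.re) :
    ‖LSeries (LSeries.logMul^[k] f) s‖ = ‖iteratedDeriv k F s‖ := by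
  have hab : LSeries.abscissaOfAbsConv f ≤ ((1 : ℝ) : EReal) :=
    LSeries.abscissaOfAbsConv_le_of_forall_lt_LSeriesSummable fun y hy ↦ hf y (by simpa using hy)
  have hev : LSeries f =ᶠ[nhds s] F := by
    filter_upwards [(isOpen_lt continuous_const Complex.continuous_re).mem_nhds hs] with z hz
    exact hF z hz
  rw [← hev.iteratedDeriv_eq k, LSeries_iteratedDeriv k (hab.trans_lt (by exact_mod_cast hs))]
  simp

/-- Bounds for the derivatives of `L'/L` as a Dirichlet series. -/
theorem exists_norm_LSeries_twist_vonMangoldt_le (k : ℕ) {ε : ℝ} (hε : 0 < ε) (hε1 : ε ≤ 1) :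
    ∃ C : ℝ, 0 < C ∧ ∀ (q : ℕ) [NeZero q] (χ : DirichletCharacter ℂ q) (σ t : ℝ),
      1 < σ → σ ≤ 2 → χ ≠ 1 →
      ‖LSeries (LSeries.logMul^[k] ((fun n : ℕ ↦ χ n) * fun n : ℕ ↦ (vonMangoldt n : ℂ)))
        (σ + Complex.I * t)‖ ≤ C * cond q t ^ ε := by
  obtain ⟨C, hC, h⟩ := exists_norm_iteratedDeriv_logDeriv_LFunction_le k hε hε1
  refine ⟨C, hC, fun q _ χ σ t hσ1 hσ2 hχ ↦ ?_⟩
  rw [norm_LSeries_logMul_eq (F := -logDeriv χ.LFunction)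
    (fun s hs ↦ DirichletCharacter.LSeriesSummable_twist_vonMangoldt χ hs) (fun s hs ↦ ?_) k
    (by simpa using hσ1)]
  · rw [iteratedDeriv_neg, norm_neg]
    exact h q χ σ t hσ1 hσ2 (Or.inl hχ)
  · rw [DirichletCharacter.LSeries_twist_vonMangoldt_eq χ hs, Pi.neg_apply, logDeriv_apply,
      DirichletCharacter.deriv_LFunction_eq_deriv_LSeries χ hs,
      DirichletCharacter.LFunction_eq_LSeries χ hs, neg_div]

lemma zetaOne_ne_zero {s : ℂ} (hs : 1 ≤ s.re) : zetaOne s ≠ 0 := by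
  rcases eq_or_ne s 1 with rfl | h
  · rw [zetaOne_one]; exact one_ne_zero
  · rw [zetaOne_of_ne h]
    exact mul_ne_zero (sub_ne_zero.mpr h) (riemannZeta_ne_zero_of_one_le_re hs)

lemma analyticAt_logDeriv_zetaOne_add {s : ℂ} (hs : 1 ≤ s.re) :
    AnalyticAt ℂ (logDeriv zetaOne + dslope zetaOne 1) s := by
  have h1 : AnalyticAt ℂ zetaOne s := differentiable_zetaOne.analyticAt s
  refine (h1.deriv.div h1 (zetaOne_ne_zero hs)).add ?_
  have : DifferentiableOn ℂ (dslope zetaOne 1) Set.univ :=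
    (Complex.differentiableOn_dslope Filter.univ_mem).mpr differentiable_zetaOne.differentiableOn
  exact this.analyticAt Filter.univ_mem

lemma logDeriv_zetaOne_add_eq {s : ℂ} (hs : 1 ≤ s.re) (h1 : s ≠ 1) :
    (logDeriv zetaOne + dslope zetaOne 1) s = (logDeriv riemannZeta + riemannZeta) s := by
  have hev : zetaOne =ᶠ[nhds s] fun z ↦ (z - 1) * riemannZeta z := by
    filter_upwards [isOpen_ne.mem_nhds h1] with z hz using zetaOne_of_ne hz
  have hz := riemannZeta_ne_zero_of_one_le_re hs
  have hs1 := sub_ne_zero.mpr h1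
  have hd : deriv zetaOne s = riemannZeta s + (s - 1) * deriv riemannZeta s := by
    rw [hev.deriv_eq]
    have : HasDerivAt (fun z : ℂ ↦ (z - 1) * riemannZeta z)
        (1 * riemannZeta s + (s - 1) * deriv riemannZeta s) s :=
      ((hasDerivAt_id s).sub_const 1).mul (differentiableAt_riemannZeta h1).hasDerivAt
    rw [this.deriv, one_mul]
  rw [Pi.add_apply, Pi.add_apply, logDeriv_apply, logDeriv_apply, dslope_of_ne _ h1, slope_def_field,
    hd, zetaOne_one, zetaOne_of_ne h1]
  field_simp
  ring

/-- Bounds for the derivatives of `ζ'/ζ + ζ` as a Dirichlet series. -/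
theorem exists_norm_LSeries_vonMangoldt_sub_one_le (k : ℕ) {ε : ℝ} (hε : 0 < ε) (hε1 : ε ≤ 1) :
    ∃ C : ℝ, 0 < C ∧ ∀ σ t : ℝ, 1 < σ → σ ≤ 2 →
      ‖LSeries (LSeries.logMul^[k] ((fun n : ℕ ↦ (vonMangoldt n : ℂ)) - 1))
        (σ + Complex.I * t)‖ ≤ C * cond 1 t ^ ε := by
  obtain ⟨C, hC, h⟩ := exists_norm_iteratedDeriv_logDeriv_LFunction_le k hε hε1
  obtain ⟨C₁, hC₁, h₁⟩ := exists_disc_bound hε hε1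
  have hcomp : IsCompact (Set.Icc (1 : ℝ) 2 ×ℂ Set.Icc (-1 : ℝ) 1) :=
    isCompact_Icc.reProdIm isCompact_Icc
  obtain ⟨C₂, hC₂⟩ := hcomp.exists_bound_of_continuousOn
    (f := iteratedDeriv k (logDeriv zetaOne + dslope zetaOne 1)) (fun s hs ↦ by
      have han : AnalyticOnNhd ℂ (logDeriv zetaOne + dslope zetaOne 1) {s : ℂ | 1 ≤ s.re} :=
        fun z hz ↦ analyticAt_logDeriv_zetaOne_add hz
      rw [iteratedDeriv_eq_iterate]
      exact (han.iterated_deriv k s hs.1.1).continuousAt.continuousWithinAt)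
  refine ⟨C + k.factorial * C₁ / (ε / 2) ^ k + |C₂|, by positivity, fun σ t hσ1 hσ2 ↦ ?_⟩
  set s : ℂ := σ + Complex.I * t with hs
  have hre : s.re = σ := by simp [hs]
  have him : s.im = t := by simp [hs]
  have hD1 : 1 ≤ cond 1 t ^ ε := Real.one_le_rpow (by linarith [two_le_cond 1 t]) hε.le
  have hne {z : ℂ} (hz : 1 < z.re) : z ≠ 1 := by rintro rfl; simp at hz
  rw [norm_LSeries_logMul_eq (F := -(logDeriv zetaOne + dslope zetaOne 1))
    (fun s hs ↦ (ArithmeticFunction.LSeriesSummable_vonMangoldt hs).sub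
      (LSeriesSummable_one_iff.mpr hs)) (fun s hs ↦ ?_) k
    (by rw [hre]; exact hσ1), iteratedDeriv_neg, norm_neg]
  · rcases le_or_gt |t| 1 with ht | ht
    · have := hC₂ s ⟨by rw [Set.mem_preimage, hre]; exact ⟨hσ1.le, hσ2⟩,
        by rw [Set.mem_preimage, him]; exact abs_le.mp ht⟩
      calc _ ≤ |C₂| * 1 := by rw [mul_one]; exact this.trans (le_abs_self _)
        _ ≤ (C + k.factorial * C₁ / (ε / 2) ^ k + |C₂|) * cond 1 t ^ ε := by
          gcongr
          have : 0 < C + k.factorial * C₁ / (ε / 2) ^ k := by positivity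
          linarith
    · have hev : logDeriv zetaOne + dslope zetaOne 1 =ᶠ[nhds s]
          logDeriv riemannZeta + riemannZeta := by
        filter_upwards [(isOpen_lt continuous_const Complex.continuous_re).mem_nhds
          (show (1 : ℝ) < s.re by rw [hre]; exact hσ1)] with z hz
        exact logDeriv_zetaOne_add_eq (le_of_lt hz) (hne hz)
      have hs1 : s ≠ 1 := hne (by rw [hre]; exact hσ1)
      have hdiff : ∀ z ∈ ({1}ᶜ : Set ℂ), AnalyticAt ℂ riemannZeta z := by
        have hd : DifferentiableOn ℂ riemannZeta {1}ᶜ := fun z hz ↦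
          (differentiableAt_riemannZeta hz).differentiableWithinAt
        exact fun z hz ↦ hd.analyticAt (isOpen_compl_singleton.mem_nhds hz)
      have han := hdiff s hs1
      have hld : AnalyticAt ℂ (logDeriv riemannZeta) s :=
        han.deriv.div han (riemannZeta_ne_zero_of_one_le_re (by rw [hre]; exact hσ1.le))
      rw [hev.iteratedDeriv_eq, iteratedDeriv_add hld.contDiffAt han.contDiffAt]
      have h1 := h 1 1 σ t hσ1 hσ2 (Or.inr ht.le)
      have h2 := h₁ 1 1 s (by rw [hre]; exact hσ1.le) (by rw [hre]; exact hσ2)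
        (by rw [him]; exact Or.inr ht.le)
      rw [DirichletCharacter.LFunction_modOne_eq] at h1 h2
      have h3 := Complex.norm_iteratedDeriv_le_of_forall_mem_sphere_norm_le (f := riemannZeta)
        (c := s) (R := ε / 2) (C := C₁ * cond 1 t ^ ε) k (by positivity) ?_ ?_
      · refine (norm_add_le _ _).trans ?_
        have h4 : k.factorial * (C₁ * cond 1 t ^ ε) / (ε / 2) ^ k =
          (k.factorial * C₁ / (ε / 2) ^ k) * cond 1 t ^ ε := by ring
        rw [h4] at h3
        have h5 : 0 ≤ |C₂| * cond 1 t ^ ε := by positivity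
        have : (C + k.factorial * C₁ / (ε / 2) ^ k + |C₂|) * cond 1 t ^ ε =
          C * cond 1 t ^ ε + (k.factorial * C₁ / (ε / 2) ^ k) * cond 1 t ^ ε
            + |C₂| * cond 1 t ^ ε := by ring
        rw [this]
        linarith
      · refine DifferentiableOn.diffContOnCl ?_
        rw [closure_ball _ (by positivity)]
        intro z hz
        exact (h2 z (by simpa [dist_eq_norm] using hz)).1.differentiableWithinAt
      · intro z hz
        rw [← him]
        exact (h2 z (by rw [mem_sphere_iff_norm] at hz; exact hz.le)).2
  · rw [LSeries_sub (ArithmeticFunction.LSeriesSummable_vonMangoldt hs)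
      (LSeriesSummable_one_iff.mpr hs), LSeries_one_eq_riemannZeta hs,
      ArithmeticFunction.LSeries_vonMangoldt_eq_deriv_riemannZeta_div hs, Pi.neg_apply,
      logDeriv_zetaOne_add_eq hs.le (hne hs), Pi.add_apply, logDeriv_apply]
    ring

end SiegelWalfisz

namespace SiegelWalfisz

section Riesz

open MeasureTheory

/-- The Mellin transform of `u ↦ max (1 - u) 0`. -/
noncomputable def rieszTransform (s : ℂ) : ℂ := 1 / s - 1 / (s + 1)

noncomputable def rieszKernel (u : ℝ) : ℂ :=
  (Set.Ioc (0 : ℝ) 1).indicator (fun _ ↦ (1 : ℂ)) u -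
    (Set.Ioc (0 : ℝ) 1).indicator (fun t : ℝ ↦ (t : ℂ) ^ (1 : ℂ)) u

lemma rieszKernel_eq {u : ℝ} (hu : 0 < u) : rieszKernel u = ((max (1 - u) 0 : ℝ) : ℂ) := by
  rw [rieszKernel]
  rcases le_or_gt u 1 with h | h
  · rw [Set.indicator_of_mem (Set.mem_Ioc.mpr ⟨hu, h⟩), Set.indicator_of_mem
      (Set.mem_Ioc.mpr ⟨hu, h⟩), max_eq_left (by linarith)]
    simp
  · rw [Set.indicator_of_notMem (fun h' ↦ by linarith [h'.2]), Set.indicator_of_notMem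
      (fun h' ↦ by linarith [h'.2]), max_eq_right (by linarith)]
    simp

lemma hasMellin_rieszKernel {s : ℂ} (hs : 0 < s.re) :
    HasMellin rieszKernel s (rieszTransform s) := by
  have h1 := hasMellin_one_Ioc hs
  have h2 := hasMellin_cpow_Ioc 1 (s := s) (by simp; linarith)
  have := hasMellin_sub h1.1 h2.1
  rwa [h1.2, h2.2] at this

lemma norm_rieszTransform_le {σ : ℝ} (hσ : 1 ≤ σ) (y : ℝ) :
    ‖rieszTransform (σ + y * Complex.I)‖ ≤ (1 + y ^ 2)⁻¹ := by
  set s : ℂ := σ + y * Complex.I with hs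
  have hre : s.re = σ := by simp [hs]
  have him : s.im = y := by simp [hs]
  have h0 : s ≠ 0 := by intro h; rw [h] at hre; simp at hre; linarith
  have h1 : s + 1 ≠ 0 := by
    intro h; have := congrArg Complex.re h; simp [hre] at this; linarith
  have h2 : √(1 + y ^ 2) ≤ ‖s‖ := by
    rw [Complex.norm_eq_sqrt_sq_add_sq, hre, him]
    apply Real.sqrt_le_sqrt; nlinarith
  have h3 : √(1 + y ^ 2) ≤ ‖s + 1‖ := by
    rw [Complex.norm_eq_sqrt_sq_add_sq, Complex.add_re, Complex.add_im, hre, him]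
    apply Real.sqrt_le_sqrt; rw [Complex.one_re, Complex.one_im, add_zero]; nlinarith
  have h4 : rieszTransform s = (s * (s + 1))⁻¹ := by
    rw [rieszTransform]; field_simp; ring
  rw [h4, norm_inv, norm_mul]
  have h5 : 0 < √(1 + y ^ 2) := Real.sqrt_pos.mpr (by positivity)
  calc _ ≤ (√(1 + y ^ 2) * √(1 + y ^ 2))⁻¹ := by gcongr
    _ = _ := by rw [Real.mul_self_sqrt (by positivity)]

lemma continuous_rieszTransform {σ : ℝ} (hσ : 1 ≤ σ) :
    Continuous fun y : ℝ ↦ rieszTransform (σ + y * Complex.I) := by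
  unfold rieszTransform
  refine (continuous_const.div (by fun_prop) fun y h ↦ ?_).sub
    (continuous_const.div (by fun_prop) fun y h ↦ ?_)
  · have := congrArg Complex.re h; simp at this; linarith
  · have := congrArg Complex.re h; simp at this; linarith

lemma integrable_rieszTransform {σ : ℝ} (hσ : 1 ≤ σ) :
    Integrable fun y : ℝ ↦ rieszTransform (σ + y * Complex.I) :=
  integrable_inv_one_add_sq.mono' (continuous_rieszTransform hσ).aestronglyMeasurable
    (Filter.Eventually.of_forall (norm_rieszTransform_le hσ))

lemma mellinInv_rieszTransform {σ u : ℝ} (hσ : 1 ≤ σ) (hu : 0 < u) :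
    mellinInv σ rieszTransform u = ((max (1 - u) 0 : ℝ) : ℂ) := by
  have hm (y : ℝ) : mellin rieszKernel (σ + y * Complex.I) = rieszTransform (σ + y * Complex.I) :=
    (hasMellin_rieszKernel (by simp; linarith)).2
  have h := mellinInv_mellin_eq σ rieszKernel hu
    (hasMellin_rieszKernel (by simp; linarith)).1 ?_ ?_
  · rw [← rieszKernel_eq hu, ← h]
    simp only [mellinInv, hm]
  · unfold Complex.VerticalIntegrable
    simp only [hm]
    exact integrable_rieszTransform hσ
  · have hev : rieszKernel =ᶠ[nhds u] fun u ↦ ((max (1 - u) 0 : ℝ) : ℂ) := by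
      filter_upwards [lt_mem_nhds hu] with v hv using rieszKernel_eq hv
    exact ContinuousAt.congr (by fun_prop) hev.symm

lemma continuous_natCast_cpow_vertical {n : ℕ} (hn : n ≠ 0) (σ : ℝ) :
    Continuous fun y : ℝ ↦ (n : ℂ) ^ (σ + y * Complex.I : ℂ) :=
  Continuous.const_cpow (by fun_prop) (Or.inl (by exact_mod_cast hn))

lemma norm_term_vertical (b : ℕ → ℂ) (σ y : ℝ) (n : ℕ) :
    ‖LSeries.term b (σ + y * Complex.I) n‖ = ‖LSeries.term b σ n‖ := by
  simp [LSeries.norm_term_eq]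

/-- Riesz means of a Dirichlet series as a Mellin integral. -/
lemma sum_riesz_eq {b : ℕ → ℂ} {x σ : ℝ} (hx : 0 < x) (hσ : 1 ≤ σ) (hb : LSeriesSummable b σ) :
    ∑ n ∈ Icc 1 ⌊x⌋₊, b n * ((1 - n / x : ℝ) : ℂ) = (1 / (2 * π)) •
      ∫ y : ℝ, (x : ℂ) ^ (σ + y * Complex.I : ℂ) * LSeries b (σ + y * Complex.I) *
        rieszTransform (σ + y * Complex.I) := by
  set F : ℕ → ℝ → ℂ := fun n y ↦ (x : ℂ) ^ (σ + y * Complex.I : ℂ) *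
    LSeries.term b (σ + y * Complex.I) n * rieszTransform (σ + y * Complex.I) with hF
  have hxnorm (y : ℝ) : ‖(x : ℂ) ^ (σ + y * Complex.I : ℂ)‖ = x ^ σ := by
    rw [Complex.norm_cpow_eq_rpow_re_of_pos hx]; simp
  have hnorm (n : ℕ) (y : ℝ) : ‖F n y‖ =
      x ^ σ * ‖LSeries.term b σ n‖ * ‖rieszTransform (σ + y * Complex.I)‖ := by
    simp only [hF]
    rw [norm_mul, norm_mul, hxnorm, norm_term_vertical]
  have hxcont : Continuous fun y : ℝ ↦ (x : ℂ) ^ (σ + y * Complex.I : ℂ) :=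
    Continuous.const_cpow (by fun_prop) (Or.inl (by exact_mod_cast hx.ne'))
  have hInt (n : ℕ) : Integrable (F n) := by
    refine Integrable.mono' ((integrable_rieszTransform hσ).norm.const_mul
      (x ^ σ * ‖LSeries.term b σ n‖)) ?_ (Filter.Eventually.of_forall fun y ↦ (hnorm n y).le)
    refine Continuous.aestronglyMeasurable ?_
    refine (hxcont.mul ?_).mul (continuous_rieszTransform hσ)
    rcases eq_or_ne n 0 with rfl | hn
    · simpa using continuous_const
    · simp only [LSeries.term_of_ne_zero hn]
      refine continuous_const.div (continuous_natCast_cpow_vertical hn σ) fun y h ↦ ?_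
      rw [Complex.cpow_eq_zero_iff] at h
      exact hn (by exact_mod_cast h.1)
  have hsum : HasSum (fun n ↦ ∫ y, F n y) (∫ y, ∑' n, F n y) := by
    refine hasSum_integral_of_summable_integral_norm hInt ?_
    simp only [hnorm, integral_const_mul]
    exact (hb.norm.mul_left (x ^ σ)).mul_right _
  have hval (n : ℕ) (hn : n ≠ 0) :
      (1 / (2 * π)) • ∫ y, F n y = b n * ((max (1 - n / x) 0 : ℝ) : ℂ) := by
    have hn0 : (0 : ℝ) < n := by exact_mod_cast Nat.pos_of_ne_zero hn
    rw [← mellinInv_rieszTransform hσ (div_pos hn0 hx), mellinInv, mul_smul_comm,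
      ← integral_const_mul]
    congr 2
    ext y
    simp only [hF, smul_eq_mul]
    rw [LSeries.term_of_ne_zero hn]
    have : ((n / x : ℝ) : ℂ) ^ (-(σ + y * Complex.I) : ℂ) =
        (x : ℂ) ^ (σ + y * Complex.I : ℂ) / (n : ℂ) ^ (σ + y * Complex.I : ℂ) := by
      rw [div_eq_mul_inv, Complex.ofReal_mul, Complex.mul_cpow_ofReal_nonneg hn0.le
        (by positivity), Complex.ofReal_inv, Complex.inv_cpow, Complex.cpow_neg, Complex.cpow_neg,
        inv_inv]
      · push_cast; ring
      · rw [Complex.arg_ofReal_of_nonneg hx.le]; exact pi_ne_zero.symm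
    rw [this]; ring
  have hsum2 : HasSum (fun n ↦ (1 / (2 * π)) • ∫ y, F n y)
      (∑ n ∈ Icc 1 ⌊x⌋₊, (1 / (2 * π)) • ∫ y, F n y) := by
    refine hasSum_sum_of_ne_finset_zero fun n hn ↦ ?_
    rcases eq_or_ne n 0 with rfl | hn0
    · simp [hF]
    · rw [hval n hn0]
      have : x < n := by
        rw [← Nat.floor_lt hx.le]
        by_contra! h
        exact hn (mem_Icc.mpr ⟨Nat.one_le_iff_ne_zero.mpr hn0, h⟩)
      rw [max_eq_right]
      · simp
      · rw [sub_nonpos, one_le_div hx]; exact this.le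
  have hfin := (hsum.const_smul (1 / (2 * π))).unique hsum2
  have htsum (y : ℝ) : ∑' n, F n y = (x : ℂ) ^ (σ + y * Complex.I : ℂ) *
      LSeries b (σ + y * Complex.I) * rieszTransform (σ + y * Complex.I) := by
    simp only [hF]
    rw [tsum_mul_right, tsum_mul_left, LSeries]
  simp only [htsum] at hfin
  rw [hfin]
  refine sum_congr rfl fun n hn ↦ ?_
  rw [mem_Icc] at hn
  rw [hval n (by lia), max_eq_left]
  rw [sub_nonneg, div_le_one hx]
  exact (Nat.le_floor_iff hx.le).mp hn.2

lemma exists_norm_sum_riesz_le : ∃ M : ℝ, 0 < M ∧ ∀ (b : ℕ → ℂ) (x σ K : ℝ), 0 < x → 1 ≤ σ →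
    LSeriesSummable b σ →
    (∀ y : ℝ, ‖LSeries b (σ + Complex.I * y)‖ ≤ K * (|y| + 2) ^ (1 / 2 : ℝ)) →
    ‖∑ n ∈ Icc 1 ⌊x⌋₊, b n * ((1 - n / x : ℝ) : ℂ)‖ ≤ M * K * x ^ σ := by
  set J := ∫ y : ℝ, (1 + ‖y‖ ^ 2) ^ (-(3 / 2 : ℝ) / 2) with hJ
  have hJi : Integrable fun y : ℝ ↦ (1 + ‖y‖ ^ 2) ^ (-(3 / 2 : ℝ) / 2) :=
    integrable_rpow_neg_one_add_norm_sq (by norm_num)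
  have hJ0 : 0 ≤ J := integral_nonneg fun y ↦ by positivity
  refine ⟨3 * J + 1, by positivity, fun b x σ K hx hσ hb hK ↦ ?_⟩
  have hK0 : 0 ≤ K := by
    have := (norm_nonneg _).trans (hK 0)
    exact nonneg_of_mul_nonneg_left this (by positivity)
  rw [sum_riesz_eq hx hσ hb, norm_smul, Real.norm_of_nonneg (by positivity)]
  have hbound (y : ℝ) : ‖(x : ℂ) ^ (σ + y * Complex.I : ℂ) * LSeries b (σ + y * Complex.I) *
        rieszTransform (σ + y * Complex.I)‖ ≤
        x ^ σ * K * 3 * (1 + ‖y‖ ^ 2) ^ (-(3 / 2 : ℝ) / 2) := by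
    have h1 := hK y
    rw [mul_comm Complex.I] at h1
    have h2 := norm_rieszTransform_le hσ y
    have h3 : (|y| + 2) ^ (1 / 2 : ℝ) ≤ 3 * (1 + ‖y‖ ^ 2) ^ (1 / 4 : ℝ) := by
      have : (3 : ℝ) * (1 + ‖y‖ ^ 2) ^ (1 / 4 : ℝ) = (9 ^ 2 * (1 + ‖y‖ ^ 2)) ^ (1 / 4 : ℝ) := by
        rw [Real.mul_rpow (by positivity) (by positivity)]
        congr 1
        rw [← Real.rpow_natCast, ← Real.rpow_mul (by norm_num)]
        rw [show (9 : ℝ) = 3 ^ (2 : ℝ) by norm_num, ← Real.rpow_mul (by norm_num)]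
        norm_num
      rw [this]
      have h4 : (|y| + 2) ^ (1 / 2 : ℝ) = ((|y| + 2) ^ 2) ^ (1 / 4 : ℝ) := by
        rw [← Real.rpow_natCast, ← Real.rpow_mul (by positivity)]; norm_num
      rw [h4]
      refine Real.rpow_le_rpow (by positivity) ?_ (by norm_num)
      rw [Real.norm_eq_abs]
      nlinarith [abs_nonneg y, sq_nonneg (|y| - 1)]
    have h5 : (1 + ‖y‖ ^ 2) ^ (1 / 4 : ℝ) * (1 + y ^ 2)⁻¹ = (1 + ‖y‖ ^ 2) ^ (-(3 / 2 : ℝ) / 2) := by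
      rw [Real.norm_eq_abs, sq_abs, ← Real.rpow_neg_one, ← Real.rpow_add (by positivity)]
      norm_num
    rw [norm_mul, norm_mul, Complex.norm_cpow_eq_rpow_re_of_pos hx]
    have hre : (σ + y * Complex.I : ℂ).re = σ := by simp
    rw [hre]
    calc _ ≤ x ^ σ * (K * (3 * (1 + ‖y‖ ^ 2) ^ (1 / 4 : ℝ))) * (1 + y ^ 2)⁻¹ := by
          gcongr
          exact h1.trans (by gcongr)
      _ = _ := by rw [← h5]; ring
  have := norm_integral_le_of_norm_le (hJi.const_mul (x ^ σ * K * 3))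
    (Filter.Eventually.of_forall hbound)
  rw [integral_const_mul, ← hJ] at this
  have hpi : 1 / (2 * π) ≤ 1 := by
    rw [div_le_one (by positivity)]; linarith [pi_gt_three]
  have hKx : 0 ≤ K * x ^ σ := by positivity
  calc _ ≤ 1 * (x ^ σ * K * 3 * J) := by gcongr
    _ ≤ _ := by nlinarith

end Riesz

end SiegelWalfisz

namespace SiegelWalfisz

lemma logMul_iterate_apply (f : ℕ → ℂ) (k n : ℕ) :
    LSeries.logMul^[k] f n = ((Real.log n ^ k : ℝ) : ℂ) * f n := by
  induction k with
  | zero => simp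
  | succ k ih =>
    rw [Function.iterate_succ_apply', LSeries.logMul, ih, ← Complex.natCast_log]
    push_cast; ring

lemma norm_logMul_iterate (f : ℕ → ℂ) (k n : ℕ) :
    ‖LSeries.logMul^[k] f n‖ = Real.log n ^ k * ‖f n‖ := by
  rw [logMul_iterate_apply, norm_mul, Complex.norm_real, Real.norm_of_nonneg]
  exact pow_nonneg (Real.log_natCast_nonneg n) k

/-- Removing the smoothing from a Riesz mean. -/
lemma norm_sum_le_of_riesz {b : ℕ → ℂ} {x h T W : ℝ} (hx : 0 < x) (hh : 0 < h)
    (h₁ : x * ‖∑ n ∈ Icc 1 ⌊x⌋₊, b n * ((1 - n / x : ℝ) : ℂ)‖ ≤ T)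
    (h₂ : (x + h) * ‖∑ n ∈ Icc 1 ⌊x + h⌋₊, b n * ((1 - n / (x + h) : ℝ) : ℂ)‖ ≤ T)
    (hW0 : 0 ≤ W)
    (hW : ∀ n : ℕ, 1 ≤ n → (n : ℝ) ≤ x + h → ‖b n‖ ≤ W) :
    ‖∑ n ∈ Icc 1 ⌊x⌋₊, b n‖ ≤ 2 * T / h + (h + 1) * W := by
  have hxh : 0 < x + h := by positivity
  have hscale (y : ℝ) (hy : 0 < y) : (y : ℂ) * ∑ n ∈ Icc 1 ⌊y⌋₊, b n * ((1 - n / y : ℝ) : ℂ) =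
      ∑ n ∈ Icc 1 ⌊y⌋₊, b n * (y - n) := by
    rw [mul_sum]
    refine sum_congr rfl fun n _ ↦ ?_
    have : (y : ℂ) ≠ 0 := by exact_mod_cast hy.ne'
    push_cast; field_simp
  have hfl : ⌊x⌋₊ ≤ ⌊x + h⌋₊ := Nat.floor_mono (by linarith)
  have hsplit : ∑ n ∈ Icc 1 ⌊x + h⌋₊, b n * (((x + h : ℝ) : ℂ) - n) =
      ∑ n ∈ Icc 1 ⌊x⌋₊, b n * (((x + h : ℝ) : ℂ) - n) +
        ∑ n ∈ Ioc ⌊x⌋₊ ⌊x + h⌋₊, b n * (((x + h : ℝ) : ℂ) - n) := by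
    have e (m : ℕ) : Icc 1 m = Ioc 0 m := rfl
    rw [e, e, ← sum_Ioc_consecutive _ (Nat.zero_le _) hfl]
  have hid : (h : ℂ) * ∑ n ∈ Icc 1 ⌊x⌋₊, b n =
      ∑ n ∈ Icc 1 ⌊x + h⌋₊, b n * (((x + h : ℝ) : ℂ) - n) - ∑ n ∈ Icc 1 ⌊x⌋₊, b n * (x - n) -
        ∑ n ∈ Ioc ⌊x⌋₊ ⌊x + h⌋₊, b n * (((x + h : ℝ) : ℂ) - n) := by
    rw [hsplit, add_sub_right_comm, add_sub_cancel_right, ← sum_sub_distrib, mul_sum]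
    refine sum_congr rfl fun n _ ↦ ?_
    push_cast; ring
  have htail : ‖∑ n ∈ Ioc ⌊x⌋₊ ⌊x + h⌋₊, b n * (((x + h : ℝ) : ℂ) - n)‖ ≤ (h + 1) * (W * h) := by
    have hterm (n : ℕ) (hn : n ∈ Ioc ⌊x⌋₊ ⌊x + h⌋₊) :
        ‖b n * (((x + h : ℝ) : ℂ) - n)‖ ≤ W * h := by
      rw [mem_Ioc] at hn
      have hn1 : x < n := (Nat.floor_lt hx.le).mp hn.1
      have hn2 : (n : ℝ) ≤ x + h := (Nat.le_floor_iff hxh.le).mp hn.2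
      rw [norm_mul]
      have : ‖((x + h : ℝ) : ℂ) - n‖ ≤ h := by
        rw [← Complex.ofReal_natCast, ← Complex.ofReal_sub, Complex.norm_real,
          Real.norm_of_nonneg (by linarith)]
        linarith
      exact mul_le_mul (hW n (by lia) hn2) this (norm_nonneg _) hW0
    refine (norm_sum_le_of_le _ hterm).trans ?_
    rw [sum_const, Nat.card_Ioc, nsmul_eq_mul, Nat.cast_sub hfl]
    have h3 := Nat.floor_le hxh.le
    have h4 := Nat.lt_floor_add_one x
    gcongr
    linarith
  have hnorm := congrArg norm hid
  rw [norm_mul, Complex.norm_real, Real.norm_of_nonneg hh.le, ← hscale x hx,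
    ← hscale (x + h) hxh] at hnorm
  have h5 := norm_sub_le (((x + h : ℝ) : ℂ) * ∑ n ∈ Icc 1 ⌊x + h⌋₊, b n *
      ((1 - n / (x + h) : ℝ) : ℂ) - (x : ℂ) * ∑ n ∈ Icc 1 ⌊x⌋₊, b n * ((1 - n / x : ℝ) : ℂ))
    (∑ n ∈ Ioc ⌊x⌋₊ ⌊x + h⌋₊, b n * (((x + h : ℝ) : ℂ) - n))
  have h6 := norm_sub_le (((x + h : ℝ) : ℂ) * ∑ n ∈ Icc 1 ⌊x + h⌋₊, b n *
      ((1 - n / (x + h) : ℝ) : ℂ)) ((x : ℂ) * ∑ n ∈ Icc 1 ⌊x⌋₊, b n * ((1 - n / x : ℝ) : ℂ))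
  rw [norm_mul, norm_mul, Complex.norm_real, Complex.norm_real, Real.norm_of_nonneg hx.le,
    Real.norm_of_nonneg hxh.le] at h6
  have h7 : h * ‖∑ n ∈ Icc 1 ⌊x⌋₊, b n‖ ≤ h * (2 * T / h + (h + 1) * W) := by
    rw [mul_add, mul_div_cancel₀ _ hh.ne']
    linarith
  exact le_of_mul_le_mul_left h7 hh

lemma norm_sum_Ioc_mul_le {b : ℕ → ℂ} {g : ℕ → ℝ} {m N : ℕ} {T : ℝ} (hmN : m < N)
    (hg : ∀ n, m < n → g (n + 1) ≤ g n) (hg0 : 0 ≤ g N)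
    (hT : ∀ n, m < n → n ≤ N → ‖∑ i ∈ Ioc m n, b i‖ ≤ T) :
    ‖∑ n ∈ Ioc m N, (g n : ℂ) * b n‖ ≤ T * g (m + 1) := by
  have key : ∀ n, m + 1 ≤ n → n ≤ N →
      ‖∑ i ∈ Ioc m n, (g i : ℂ) * b i - g n * ∑ i ∈ Ioc m n, b i‖ ≤ T * (g (m + 1) - g n) := by
    intro n hn
    induction n, hn using Nat.le_induction with
    | base => intro _; simp
    | succ n hn ih =>
      intro hnN
      have h1 := ih (by lia)
      have h2 := hT n (by lia) (by lia)
      have h3 := hg n (by lia)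
      rw [sum_Ioc_succ_top (by lia), sum_Ioc_succ_top (by lia)]
      have : ∑ i ∈ Ioc m n, (g i : ℂ) * b i + g (n + 1) * b (n + 1) -
          g (n + 1) * (∑ i ∈ Ioc m n, b i + b (n + 1)) =
          (∑ i ∈ Ioc m n, (g i : ℂ) * b i - g n * ∑ i ∈ Ioc m n, b i) +
            ((g n - g (n + 1) : ℝ) : ℂ) * ∑ i ∈ Ioc m n, b i := by
        push_cast; ring
      rw [this]
      refine (norm_add_le _ _).trans ?_
      rw [norm_mul, Complex.norm_real, Real.norm_of_nonneg (by linarith)]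
      nlinarith [mul_le_mul_of_nonneg_left h2 (sub_nonneg.mpr h3)]
  have h1 := key N hmN le_rfl
  have h2 := hT N hmN le_rfl
  have h3 := norm_add_le (∑ i ∈ Ioc m N, (g i : ℂ) * b i - g N * ∑ i ∈ Ioc m N, b i)
    (g N * ∑ i ∈ Ioc m N, b i)
  rw [sub_add_cancel, norm_mul, Complex.norm_real, Real.norm_of_nonneg hg0] at h3
  nlinarith [mul_le_mul_of_nonneg_left h2 hg0]

lemma log_add_one_pow_le (j : ℕ) {y : ℝ} (hy : 1 ≤ y) :
    (Real.log y + 1) ^ j ≤ 3 * j.factorial * y := by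
  have h0 := Real.log_nonneg hy
  have h1 := Real.pow_div_factorial_le_exp (Real.log y + 1) (by linarith) j
  rw [div_le_iff₀ (by positivity), Real.exp_add, Real.exp_log (by linarith)] at h1
  refine h1.trans ?_
  have : Real.exp 1 ≤ 3 := Real.exp_one_lt_three.le
  calc _ ≤ y * 3 * j.factorial := by gcongr
    _ = _ := by ring

/-- Sums of `a n * (log n) ^ (2 * j)` for a sequence whose Dirichlet series has bounded
derivatives. -/
lemma exists_norm_sum_logMul_le (j : ℕ) : ∃ C : ℝ, 0 < C ∧ ∀ (a : ℕ → ℂ) (K : ℝ), 1 ≤ K →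
    (∀ n : ℕ, 1 ≤ n → ‖a n‖ ≤ Real.log n + 1) → (∀ s : ℂ, 1 < s.re → LSeriesSummable a s) →
    (∀ σ t : ℝ, 1 < σ → σ ≤ 2 → ‖LSeries (LSeries.logMul^[2 * j] a) (σ + Complex.I * t)‖ ≤
      K * (|t| + 2) ^ (1 / 2 : ℝ)) →
    ∀ y : ℝ, 1 ≤ y → ‖∑ n ∈ Icc 1 ⌊y⌋₊, LSeries.logMul^[2 * j] a n‖ ≤
      C * K * y * (Real.log y + 1) ^ (j + 1) := by
  obtain ⟨M, hM, hMb⟩ := exists_norm_sum_riesz_le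
  refine ⟨48 * M + (1 + 3 * j.factorial) * 2 ^ (2 * j + 1), by positivity,
    fun a K hK1 ha hsum hK y hy ↦ ?_⟩
  have hy0 : 0 < y := by linarith
  set b := LSeries.logMul^[2 * j] a with hb
  set L := Real.log y + 1 with hL
  have hL1 : 1 ≤ L := by rw [hL]; linarith [Real.log_nonneg hy]
  have hL0 : 0 < L := by linarith
  set σ := 1 + 1 / L with hσ
  have hσ1 : 1 < σ := by rw [hσ]; linarith [one_div_pos.mpr hL0]
  have hσ2 : σ ≤ 2 := by
    have : 1 / L ≤ 1 := by rw [div_le_one hL0]; exact hL1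
    linarith
  have hbs : LSeriesSummable b σ := by
    refine LSeriesSummable_of_abscissaOfAbsConv_lt_re ?_
    rw [hb, LSeries.absicssaOfAbsConv_logPowMul]
    have : LSeries.abscissaOfAbsConv a ≤ ((1 : ℝ) : EReal) :=
      LSeries.abscissaOfAbsConv_le_of_forall_lt_LSeriesSummable fun u hu ↦ hsum u (by simpa using hu)
    exact this.trans_lt (by rw [Complex.ofReal_re]; exact_mod_cast hσ1)
  have hyσ : y ^ σ ≤ 3 * y := by
    rw [hσ, Real.rpow_add hy0, Real.rpow_one, mul_comm]
    gcongr
    rw [Real.rpow_def_of_pos hy0]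
    refine le_trans (Real.exp_le_exp.mpr ?_) Real.exp_one_lt_three.le
    rw [mul_one_div, div_le_one hL0]
    linarith
  have hriesz (z : ℝ) (hz : 0 < z) (hzy : z ≤ 2 * y) :
      z * ‖∑ n ∈ Icc 1 ⌊z⌋₊, b n * ((1 - n / z : ℝ) : ℂ)‖ ≤ 24 * M * K * y ^ 2 := by
    have h1 := hMb b z σ K hz hσ1.le hbs (fun t ↦ hK σ t hσ1 hσ2)
    have h2 : z ^ σ ≤ 12 * y := by
      calc z ^ σ ≤ (2 * y) ^ σ := by gcongr
        _ = 2 ^ σ * y ^ σ := Real.mul_rpow (by norm_num) hy0.le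
        _ ≤ 2 ^ (2 : ℝ) * (3 * y) := by
          gcongr
          norm_num
        _ = 12 * y := by norm_num; ring
    calc _ ≤ (2 * y) * (M * K * (12 * y)) := by gcongr; exact h1.trans (by gcongr)
      _ = _ := by ring
  have hLj : 1 ≤ L ^ j := one_le_pow₀ hL1
  set h := y / L ^ j with hh
  have hh0 : 0 < h := by positivity
  have hhy : h ≤ y := div_le_self hy0.le hLj
  have hW (n : ℕ) (hn : 1 ≤ n) (hny : (n : ℝ) ≤ y + h) : ‖b n‖ ≤ (2 * L) ^ (2 * j + 1) := by
    rw [hb, norm_logMul_iterate]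
    have hn0 : (1 : ℝ) ≤ n := by exact_mod_cast hn
    have h0 := Real.log_nonneg hn0
    have h1 : Real.log n + 1 ≤ 2 * L := by
      have : Real.log n ≤ Real.log (2 * y) := Real.log_le_log (by linarith) (by linarith)
      rw [Real.log_mul (by norm_num) hy0.ne'] at this
      have h2 : Real.log 2 < 1 := Real.log_two_lt_d9.trans (by norm_num)
      linarith
    have h2 := ha n hn
    calc _ ≤ (2 * L) ^ (2 * j) * (2 * L) := by
          gcongr <;> linarith
      _ = _ := by ring
  have hfin := norm_sum_le_of_riesz hy0 hh0 (hriesz y hy0 (by linarith))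
    (hriesz (y + h) (by positivity) (by linarith)) (by positivity) hW
  refine hfin.trans ?_
  have e1 : 2 * (24 * M * K * y ^ 2) / h = 48 * M * K * y * L ^ j := by
    rw [hh]; field_simp; ring
  have h1 : 1 ≤ 3 * j.factorial * h := by
    rw [hh, mul_div_assoc', le_div_iff₀ (by positivity), one_mul]
    exact log_add_one_pow_le j hy
  have e2 : h * (2 * L) ^ (2 * j + 1) = 2 ^ (2 * j + 1) * y * L ^ (j + 1) := by
    rw [hh, mul_pow, show 2 * j + 1 = j + (j + 1) by ring, pow_add L]; field_simp
  rw [e1]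
  have h2 : L ^ j ≤ L ^ (j + 1) := pow_le_pow_right₀ hL1 (by lia)
  calc 48 * M * K * y * L ^ j + (h + 1) * (2 * L) ^ (2 * j + 1)
      ≤ 48 * M * K * y * L ^ (j + 1) + (h + 3 * j.factorial * h) * (2 * L) ^ (2 * j + 1) := by
        gcongr
    _ = 48 * M * K * y * L ^ (j + 1) +
        (1 + 3 * j.factorial) * (h * (2 * L) ^ (2 * j + 1)) * 1 := by ring
    _ ≤ 48 * M * K * y * L ^ (j + 1) +
        (1 + 3 * j.factorial) * (h * (2 * L) ^ (2 * j + 1)) * K := by gcongr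
    _ = _ := by rw [e2]; ring

/-- A Tauberian theorem with logarithmic savings. -/
theorem exists_norm_sum_le_div_log_pow (j : ℕ) : ∃ C : ℝ, 0 < C ∧ ∀ (a : ℕ → ℂ) (K : ℝ), 1 ≤ K →
    (∀ n : ℕ, 1 ≤ n → ‖a n‖ ≤ Real.log n + 1) → (∀ s : ℂ, 1 < s.re → LSeriesSummable a s) →
    (∀ σ t : ℝ, 1 < σ → σ ≤ 2 → ‖LSeries (LSeries.logMul^[2 * (j + 1)] a) (σ + Complex.I * t)‖ ≤
      K * (|t| + 2) ^ (1 / 2 : ℝ)) →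
    ∀ x : ℝ, 3 ≤ x → ‖∑ n ∈ Icc 1 ⌊x⌋₊, a n‖ ≤ C * K * x / Real.log x ^ j := by
  obtain ⟨C, hC, hCb⟩ := exists_norm_sum_logMul_le (j + 1)
  refine ⟨2 * C * 2 ^ (j + 2) * 4 ^ (j + 1) + 2 ^ (j + 1) * (3 * (j + 1).factorial), by positivity,
    fun a K hK1 ha hsum hK x hx ↦ ?_⟩
  have hS := hCb a K hK1 ha hsum hK
  set b := LSeries.logMul^[2 * (j + 1)] a with hb
  have hx0 : 0 < x := by linarith
  set l := Real.log x with hl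
  have hl1 : 1 ≤ l := by
    rw [hl, Real.le_log_iff_exp_le hx0]
    exact Real.exp_one_lt_three.le.trans hx
  have hl0 : 0 < l := by linarith
  set m := ⌊√x⌋₊ with hm
  have hsx1 : 1 ≤ √x := Real.one_le_sqrt.mpr (by linarith)
  have hsqx : √x * √x = x := Real.mul_self_sqrt hx0.le
  have hm1 : 1 ≤ m := (Nat.one_le_floor_iff _).mpr hsx1
  have hmx : m < ⌊x⌋₊ := by
    rw [Nat.lt_iff_add_one_le, Nat.le_floor_iff hx0.le]
    have := Nat.floor_le (by linarith : 0 ≤ √x)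
    push_cast
    have h2 : 1.6 ≤ √x := Real.le_sqrt_of_sq_le (by norm_num; linarith)
    nlinarith
  have hlogsq : Real.log (√x) = l / 2 := Real.log_sqrt hx0.le
  have hsplit : ∑ n ∈ Icc 1 ⌊x⌋₊, a n = ∑ n ∈ Icc 1 m, a n + ∑ n ∈ Ioc m ⌊x⌋₊, a n := by
    have e (m : ℕ) : Icc 1 m = Ioc 0 m := rfl
    rw [e, e, ← sum_Ioc_consecutive _ (Nat.zero_le _) hmx.le]
  have hsmall : ‖∑ n ∈ Icc 1 m, a n‖ ≤ 2 ^ (j + 1) * (3 * (j + 1).factorial) * x / l ^ j := by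
    have h1 : ‖∑ n ∈ Icc 1 m, a n‖ ≤ ∑ n ∈ Icc 1 m, (l + 1) := by
      refine norm_sum_le_of_le _ fun n hn ↦ ?_
      rw [mem_Icc] at hn
      refine (ha n hn.1).trans ?_
      gcongr
      exact Real.log_le_log (by exact_mod_cast hn.1)
        ((Nat.le_floor_iff hx0.le).mp (hn.2.trans hmx.le))
    rw [sum_const, Nat.card_Icc, nsmul_eq_mul, Nat.add_sub_cancel] at h1
    have h2 : (m : ℝ) ≤ √x := Nat.floor_le (by linarith)
    have h3 := log_add_one_pow_le (j + 1) hsx1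
    rw [hlogsq] at h3
    rw [le_div_iff₀ (by positivity)]
    calc _ ≤ √x * (l + 1) * l ^ j := by gcongr; exact h1.trans (by gcongr)
      _ ≤ √x * (l + 1) * (l + 1) ^ j := by gcongr; linarith
      _ = √x * (l + 1) ^ (j + 1) := by ring
      _ ≤ √x * (2 * (l / 2 + 1)) ^ (j + 1) := by gcongr; linarith
      _ = √x * (2 ^ (j + 1) * (l / 2 + 1) ^ (j + 1)) := by rw [mul_pow]
      _ ≤ √x * (2 ^ (j + 1) * (3 * (j + 1).factorial * √x)) := by gcongr
      _ = 2 ^ (j + 1) * (3 * (j + 1).factorial) * (√x * √x) := by ring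
      _ = _ := by rw [hsqx]
  have hlarge : ‖∑ n ∈ Ioc m ⌊x⌋₊, a n‖ ≤ 2 * C * 2 ^ (j + 2) * 4 ^ (j + 1) * K * x / l ^ j := by
    set g : ℕ → ℝ := fun n ↦ (Real.log n ^ (2 * (j + 1)))⁻¹ with hg
    have hlogpos (n : ℕ) (hn : m < n) : 0 < Real.log n :=
      Real.log_pos (by exact_mod_cast (by lia : 1 < n))
    have heq : ∑ n ∈ Ioc m ⌊x⌋₊, a n = ∑ n ∈ Ioc m ⌊x⌋₊, (g n : ℂ) * b n := by
      refine sum_congr rfl fun n hn ↦ ?_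
      rw [mem_Ioc] at hn
      have := (pow_pos (hlogpos n hn.1) (2 * (j + 1))).ne'
      rw [hb, logMul_iterate_apply, ← mul_assoc, ← Complex.ofReal_mul, inv_mul_cancel₀ this]
      simp
    set T := 2 * (C * K * x * (l + 1) ^ (j + 2)) with hT
    have hSn (n : ℕ) (hn : 1 ≤ n) (hnx : n ≤ ⌊x⌋₊) :
        ‖∑ i ∈ Icc 1 n, b i‖ ≤ C * K * x * (l + 1) ^ (j + 2) := by
      have h1 := hS n (by exact_mod_cast hn)
      rw [Nat.floor_natCast] at h1
      have h2 : (n : ℝ) ≤ x := (Nat.le_floor_iff hx0.le).mp hnx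
      have hn1 : (1 : ℝ) ≤ n := by exact_mod_cast hn
      have h3 : Real.log n ≤ l := Real.log_le_log (by linarith) h2
      have h4 := Real.log_nonneg hn1
      refine h1.trans ?_
      gcongr
    rw [heq]
    have h1 := norm_sum_Ioc_mul_le (b := b) (g := g) (T := T) hmx (fun n hn ↦ ?_) ?_ ?_
    · refine h1.trans ?_
      have h2 : g (m + 1) ≤ 4 ^ (j + 1) / (l ^ (j + 2) * l ^ j) := by
        have h3 : l / 2 ≤ Real.log ((m + 1 : ℕ) : ℝ) := by
          rw [← hlogsq]
          refine Real.log_le_log (by linarith) ?_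
          push_cast
          exact (Nat.lt_floor_add_one _).le
        have h4 : 4 ^ (j + 1) / (l ^ (j + 2) * l ^ j) = ((l / 2) ^ (2 * (j + 1)))⁻¹ := by
          rw [div_pow, pow_mul 2, ← pow_add, inv_div]; norm_num; congr 1; ring
        rw [h4]
        simp only [hg]
        gcongr
      calc T * g (m + 1) ≤ 2 * (C * K * x * (2 * l) ^ (j + 2)) *
            (4 ^ (j + 1) / (l ^ (j + 2) * l ^ j)) := by
            rw [hT]; gcongr; linarith
        _ = _ := by rw [mul_pow]; field_simp
    · simp only [hg]
      have := hlogpos n hn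
      gcongr
      · exact_mod_cast (by lia : 0 < n)
      · exact_mod_cast n.le_succ
    · exact inv_nonneg.mpr (pow_nonneg (Real.log_natCast_nonneg _) _)
    · intro n hmn hnx
      have h2 : ∑ i ∈ Ioc m n, b i = ∑ i ∈ Icc 1 n, b i - ∑ i ∈ Icc 1 m, b i := by
        have e (m : ℕ) : Icc 1 m = Ioc 0 m := rfl
        rw [e, e, ← sum_Ioc_consecutive _ (Nat.zero_le m) hmn.le]; ring
      rw [h2]
      refine (norm_sub_le _ _).trans ?_
      linarith [hSn n (by lia) hnx, hSn m hm1 hmx.le]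
  rw [hsplit]
  refine (norm_add_le _ _).trans ((add_le_add hsmall hlarge).trans ?_)
  rw [← add_div]
  gcongr
  have : 0 ≤ 2 ^ (j + 1) * (3 * (j + 1).factorial) * x * (K - 1) := by
    have : 0 ≤ K - 1 := by linarith
    positivity
  nlinarith

end SiegelWalfisz

namespace SiegelWalfisz

open ArithmeticFunction (vonMangoldt)
open ArithmeticFunction.vonMangoldt (residueClass)

/-- Cancellation in sums of `χ n * Λ n` for a nontrivial character. -/
theorem exists_norm_sum_char_le (j : ℕ) : ∃ C : ℝ, 0 < C ∧ ∀ (q : ℕ) [NeZero q]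
    (χ : DirichletCharacter ℂ q), χ ≠ 1 → ∀ x : ℝ, 3 ≤ x →
      ‖∑ n ∈ Icc 1 ⌊x⌋₊, χ n * (vonMangoldt n : ℂ)‖ ≤ C * q * x / Real.log x ^ j := by
  obtain ⟨C₁, hC₁, h₁⟩ := exists_norm_LSeries_twist_vonMangoldt_le (2 * (j + 1))
    (ε := 1 / 2) (by norm_num) (by norm_num)
  obtain ⟨C₂, hC₂, h₂⟩ := exists_norm_sum_le_div_log_pow j
  refine ⟨C₂ * (C₁ + 1), by positivity, fun q _ χ hχ x hx ↦ ?_⟩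
  have hq1 : (1 : ℝ) ≤ q := by exact_mod_cast NeZero.one_le
  have := h₂ ((fun n : ℕ ↦ χ n) * fun n : ℕ ↦ (vonMangoldt n : ℂ)) ((C₁ + 1) * q)
    (by nlinarith) (fun n hn ↦ ?_)
    (fun s hs ↦ DirichletCharacter.LSeriesSummable_twist_vonMangoldt χ hs)
    (fun σ t hσ1 hσ2 ↦ ?_) x hx
  · simpa only [Pi.mul_apply, mul_assoc] using this
  · rw [Pi.mul_apply, norm_mul, Complex.norm_real, Real.norm_of_nonneg
      ArithmeticFunction.vonMangoldt_nonneg]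
    have h1 := DirichletCharacter.norm_le_one χ n
    have h2 : vonMangoldt n ≤ Real.log n := ArithmeticFunction.vonMangoldt_le_log
    have h3 : 0 ≤ vonMangoldt n := ArithmeticFunction.vonMangoldt_nonneg
    nlinarith
  · refine (h₁ q χ σ t hσ1 hσ2 hχ).trans ?_
    rw [cond, Real.mul_rpow (by positivity) (by positivity), ← mul_assoc]
    gcongr
    · linarith
    · calc (q : ℝ) ^ (1 / 2 : ℝ) ≤ (q : ℝ) ^ (1 : ℝ) :=
          Real.rpow_le_rpow_of_exponent_le hq1 (by norm_num)
        _ = q := Real.rpow_one _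

/-- The prime number theorem with an error term saving powers of the logarithm. -/
theorem exists_abs_sum_vonMangoldt_sub_le (j : ℕ) : ∃ C : ℝ, 0 < C ∧ ∀ x : ℝ, 3 ≤ x →
    |∑ n ∈ Icc 1 ⌊x⌋₊, vonMangoldt n - ⌊x⌋₊| ≤ C * x / Real.log x ^ j := by
  obtain ⟨C₁, hC₁, h₁⟩ := exists_norm_LSeries_vonMangoldt_sub_one_le (2 * (j + 1))
    (ε := 1 / 2) (by norm_num) (by norm_num)
  obtain ⟨C₂, hC₂, h₂⟩ := exists_norm_sum_le_div_log_pow j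
  refine ⟨C₂ * (C₁ + 1), by positivity, fun x hx ↦ ?_⟩
  have := h₂ ((fun n : ℕ ↦ (vonMangoldt n : ℂ)) - 1) (C₁ + 1) (by linarith)
    (fun n hn ↦ ?_) (fun s hs ↦ (ArithmeticFunction.LSeriesSummable_vonMangoldt hs).sub
      (LSeriesSummable_one_iff.mpr hs)) (fun σ t hσ1 hσ2 ↦ ?_) x hx
  · refine le_trans (le_of_eq ?_) this
    rw [← Real.norm_eq_abs, ← Complex.norm_real (∑ n ∈ Icc 1 ⌊x⌋₊, vonMangoldt n - ⌊x⌋₊ : ℝ)]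
    simp
  · refine (norm_sub_le _ _).trans ?_
    rw [Complex.norm_real, Real.norm_of_nonneg ArithmeticFunction.vonMangoldt_nonneg]
    have : vonMangoldt n ≤ Real.log n := ArithmeticFunction.vonMangoldt_le_log
    simpa using this
  · refine (h₁ σ t hσ1 hσ2).trans ?_
    rw [cond, Nat.cast_one, one_mul]
    gcongr
    linarith

/-- Prime powers sharing a factor with `m` contribute little. -/
lemma sum_vonMangoldt_not_coprime_le {m N : ℕ} (hm : m ≠ 0) :
    ∑ n ∈ (Icc 1 N).filter (fun n ↦ ¬ n.Coprime m), vonMangoldt n ≤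
      m * (2 * (Real.log N + 1) ^ 2) := by
  set S := ((Icc 1 N).filter (fun n ↦ ¬ n.Coprime m)).filter IsPrimePow with hS
  have h1 : ∑ n ∈ (Icc 1 N).filter (fun n ↦ ¬ n.Coprime m), vonMangoldt n =
      ∑ n ∈ S, vonMangoldt n := by
    refine (sum_filter_of_ne fun n _ hn ↦ ?_).symm
    exact ArithmeticFunction.vonMangoldt_ne_zero_iff.mp hn
  have hlog0 : 0 ≤ Real.log N := Real.log_natCast_nonneg N
  have h2 : ∑ n ∈ S, vonMangoldt n ≤ S.card * Real.log N := by
    rw [← nsmul_eq_mul]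
    refine sum_le_card_nsmul _ _ _ fun n hn ↦ ?_
    rw [hS, mem_filter, mem_filter, mem_Icc] at hn
    refine (ArithmeticFunction.vonMangoldt_le_log).trans ?_
    exact Real.log_le_log (by exact_mod_cast hn.1.1.1) (by exact_mod_cast hn.1.1.2)
  have h3 : S.card ≤ m * (Nat.log 2 N + 1) := by
    have : S ⊆ (Icc 1 m ×ˢ range (Nat.log 2 N + 1)).image fun pk ↦ pk.1 ^ pk.2 := by
      intro n hn
      rw [hS, mem_filter, mem_filter, mem_Icc] at hn
      obtain ⟨⟨⟨hn1, hnN⟩, hcop⟩, hpp⟩ := hn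
      obtain ⟨p, k, hp, hk, rfl⟩ := (isPrimePow_nat_iff n).mp hpp
      rw [mem_image]
      refine ⟨(p, k), ?_, rfl⟩
      have hpm : p ∣ m := by
        by_contra h
        exact hcop (Nat.Coprime.pow_left k ((Nat.Prime.coprime_iff_not_dvd hp).mpr h))
      rw [mem_product, mem_Icc, mem_range]
      refine ⟨⟨hp.one_le, Nat.le_of_dvd (Nat.pos_of_ne_zero hm) hpm⟩, Nat.lt_succ_of_le ?_⟩
      refine Nat.le_log_of_pow_le (by norm_num) ((Nat.pow_le_pow_left hp.two_le k).trans hnN)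
    calc S.card ≤ _ := card_le_card this
      _ ≤ _ := card_image_le
      _ = _ := by simp
  have h4 : (Nat.log 2 N : ℝ) ≤ 2 * Real.log N := by
    rcases Nat.eq_zero_or_pos N with rfl | hN
    · simp
    have h5 : (2 : ℝ) ^ Nat.log 2 N ≤ N := by exact_mod_cast Nat.pow_log_le_self 2 hN.ne'
    have h6 := Real.log_le_log (by positivity) h5
    rw [Real.log_pow] at h6
    have h7 : 1 / 2 ≤ Real.log 2 := by linarith [Real.log_two_gt_d9]
    have h8 : (0 : ℝ) ≤ Nat.log 2 N := by positivity
    nlinarith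
  have h3' : (S.card : ℝ) ≤ m * (Nat.log 2 N + 1) := by exact_mod_cast h3
  rw [h1]
  calc _ ≤ (S.card : ℝ) * Real.log N := h2
    _ ≤ m * (Nat.log 2 N + 1) * (Real.log N + 1) := by gcongr; linarith
    _ ≤ m * (2 * Real.log N + 2) * (Real.log N + 1) := by gcongr; linarith
    _ = _ := by ring

lemma exists_log_rpow_le (c : ℝ) : ∃ C : ℝ, 0 < C ∧ ∀ x : ℝ, 3 ≤ x → Real.log x ^ c ≤ C * √x := by
  refine ⟨2 ^ ⌈c⌉₊ * (3 * (⌈c⌉₊).factorial), by positivity, fun x hx ↦ ?_⟩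
  have hl1 : 1 ≤ Real.log x := by
    rw [Real.le_log_iff_exp_le (by linarith)]
    exact Real.exp_one_lt_three.le.trans hx
  have h1 := log_add_one_pow_le ⌈c⌉₊ (Real.one_le_sqrt.mpr (by linarith : 1 ≤ x))
  rw [Real.log_sqrt (by linarith)] at h1
  calc Real.log x ^ c ≤ Real.log x ^ (⌈c⌉₊ : ℝ) :=
        Real.rpow_le_rpow_of_exponent_le hl1 (Nat.le_ceil c)
    _ = Real.log x ^ ⌈c⌉₊ := Real.rpow_natCast _ _
    _ ≤ (2 * (Real.log x / 2 + 1)) ^ ⌈c⌉₊ := by gcongr; linarith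
    _ = 2 ^ ⌈c⌉₊ * (Real.log x / 2 + 1) ^ ⌈c⌉₊ := mul_pow _ _ _
    _ ≤ 2 ^ ⌈c⌉₊ * (3 * (⌈c⌉₊).factorial * √x) := by gcongr
    _ = _ := by ring

/-- Orthogonality of characters. -/
lemma abs_sum_residueClass_sub_le {q : ℕ} [NeZero q] {a : ZMod q} (ha : IsUnit a) {N : ℕ} {T : ℝ}
    (hT : ∀ χ : DirichletCharacter ℂ q, χ ≠ 1 → ‖∑ n ∈ Icc 1 N, χ n * (vonMangoldt n : ℂ)‖ ≤ T)
    (hT0 : 0 ≤ T) :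
    |∑ n ∈ Icc 1 N, residueClass a n - (∑ n ∈ Icc 1 N, vonMangoldt n) / q.totient| ≤
      T + q * (2 * (Real.log N + 1) ^ 2) := by
  classical
  have hφ : (0 : ℝ) < q.totient := by exact_mod_cast Nat.totient_pos.mpr (NeZero.pos q)
  have hφ1 : (1 : ℝ) ≤ q.totient := by exact_mod_cast Nat.totient_pos.mpr (NeZero.pos q)
  have hinv : IsUnit a⁻¹ := by
    rw [isUnit_iff_exists_inv]
    exact ⟨a, ZMod.inv_mul_of_unit a ha⟩
  set S : DirichletCharacter ℂ q → ℂ := fun χ ↦ ∑ n ∈ Icc 1 N, χ n * (vonMangoldt n : ℂ) with hS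
  have h1 : ((∑ n ∈ Icc 1 N, residueClass a n : ℝ) : ℂ) =
      (q.totient : ℂ)⁻¹ * ∑ χ : DirichletCharacter ℂ q, χ a⁻¹ * S χ := by
    push_cast
    simp only [ArithmeticFunction.vonMangoldt.residueClass_apply ha, hS, mul_sum]
    rw [sum_comm]
    simp only [mul_assoc]
  have h2 : S 1 = ((∑ n ∈ (Icc 1 N).filter (fun n ↦ n.Coprime q), vonMangoldt n : ℝ) : ℂ) := by
    rw [sum_filter]; push_cast
    refine sum_congr rfl fun n _ ↦ ?_
    split_ifs with h
    · rw [MulChar.one_apply ((ZMod.isUnit_iff_coprime n q).mpr h), one_mul]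
    · rw [MulChar.map_nonunit _ (fun h' ↦ h ((ZMod.isUnit_iff_coprime n q).mp h')), zero_mul,
        Complex.ofReal_zero]
  have h3 : ∑ n ∈ Icc 1 N, vonMangoldt n =
      ∑ n ∈ (Icc 1 N).filter (fun n ↦ n.Coprime q), vonMangoldt n +
        ∑ n ∈ (Icc 1 N).filter (fun n ↦ ¬ n.Coprime q), vonMangoldt n :=
    (sum_filter_add_sum_filter_not _ _ _).symm
  have h4 := sum_vonMangoldt_not_coprime_le (m := q) (N := N) (NeZero.ne q)
  have h40 : 0 ≤ ∑ n ∈ (Icc 1 N).filter (fun n ↦ ¬ n.Coprime q), vonMangoldt n :=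
    sum_nonneg fun _ _ ↦ ArithmeticFunction.vonMangoldt_nonneg
  set P := ∑ n ∈ (Icc 1 N).filter (fun n ↦ n.Coprime q), vonMangoldt n with hP
  set Q := ∑ n ∈ (Icc 1 N).filter (fun n ↦ ¬ n.Coprime q), vonMangoldt n with hQ
  have h5 : |∑ n ∈ Icc 1 N, residueClass a n - P / q.totient| ≤ T := by
    rw [← Real.norm_eq_abs, ← Complex.norm_real]
    have : ((∑ n ∈ Icc 1 N, residueClass a n - P / q.totient : ℝ) : ℂ) =
        (q.totient : ℂ)⁻¹ * ∑ χ ∈ (univ : Finset (DirichletCharacter ℂ q)).erase 1,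
          χ a⁻¹ * S χ := by
      rw [Complex.ofReal_sub, h1, ← add_sum_erase _ _ (mem_univ (1 : DirichletCharacter ℂ q)),
        MulChar.one_apply hinv, one_mul, h2]
      push_cast; ring
    rw [this, norm_mul, norm_inv, Complex.norm_natCast, inv_mul_le_iff₀ hφ]
    have hcard : (univ : Finset (DirichletCharacter ℂ q)).card = q.totient := by
      rw [card_univ, ← Nat.card_eq_fintype_card,
        DirichletCharacter.card_eq_totient_of_hasEnoughRootsOfUnity ℂ q]
    rw [← hcard, ← nsmul_eq_mul]
    refine (norm_sum_le_of_le (n := fun _ ↦ T) _ fun χ hχ ↦ ?_).trans ?_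
    · rw [norm_mul]
      calc _ ≤ 1 * T := by
            gcongr
            · exact DirichletCharacter.norm_le_one χ _
            · exact hT χ (ne_of_mem_erase hχ)
        _ = T := one_mul T
    · rw [sum_const]
      exact nsmul_le_nsmul_left hT0 (card_le_card (erase_subset _ _))
  have h6 : ∑ n ∈ Icc 1 N, residueClass a n - (∑ n ∈ Icc 1 N, vonMangoldt n) / q.totient =
      (∑ n ∈ Icc 1 N, residueClass a n - P / q.totient) - Q / q.totient := by
    rw [h3]; ring
  rw [h6]
  refine (abs_sub _ _).trans (add_le_add h5 ?_)
  rw [abs_of_nonneg (by positivity)]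
  exact (div_le_self h40 hφ1).trans h4

/-- The Siegel–Walfisz theorem. -/
theorem siegel_walfisz {A : ℝ} (hA : 0 ≤ A) (B : ℝ) :
    ∃ C : ℝ, 0 < C ∧ ∀ x : ℝ, 3 ≤ x → ∀ (q : ℕ) [NeZero q], (q : ℝ) ≤ 2 * Real.log x ^ A →
      ∀ a : ZMod q, IsUnit a → ∀ y : ℝ, 0 ≤ y → y ≤ x →
        |∑ n ∈ Icc 1 ⌊y⌋₊, residueClass a n - y / q.totient| ≤ C * (x / Real.log x ^ B) := by
  set j := ⌈A + B⌉₊ with hj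
  obtain ⟨C₁, hC₁, h₁⟩ := exists_norm_sum_char_le j
  obtain ⟨C₂, hC₂, h₂⟩ := exists_abs_sum_vonMangoldt_sub_le j
  obtain ⟨C₃, hC₃, h₃⟩ := exists_log_rpow_le (A + B + 2)
  refine ⟨2 ^ (j + 1) * C₁ + 2 ^ j * C₂ + 20 * C₃, by positivity,
    fun x hx q _ hq a ha y hy0 hyx ↦ ?_⟩
  have hx0 : 0 < x := by linarith
  set l := Real.log x with hl
  have hl1 : 1 ≤ l := by
    rw [hl, Real.le_log_iff_exp_le hx0]
    exact Real.exp_one_lt_three.le.trans hx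
  have hl0 : 0 < l := by linarith
  have hlB : 0 < l ^ B := by positivity
  have hφ1 : (1 : ℝ) ≤ q.totient := by exact_mod_cast Nat.totient_pos.mpr (NeZero.pos q)
  have hsx1 : 1 ≤ √x := Real.one_le_sqrt.mpr (by linarith)
  have hsqx : √x * √x = x := Real.mul_self_sqrt hx0.le
  have hsmall : √x * l ^ (A + 2) ≤ C₃ * (x / l ^ B) := by
    rw [mul_div_assoc', le_div_iff₀ hlB]
    calc √x * l ^ (A + 2) * l ^ B = √x * l ^ (A + B + 2) := by
          rw [mul_assoc, ← Real.rpow_add hl0]; congr 2; ring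
      _ ≤ √x * (C₃ * √x) := by gcongr; exact h₃ x hx
      _ = C₃ * (√x * √x) := by ring
      _ = C₃ * x := by rw [hsqx]
  have hlA2 : 1 ≤ l ^ (A + 2) := Real.one_le_rpow hl1 (by linarith)
  have hll : l ≤ l ^ (A + 2) := by
    calc l = l ^ (1 : ℝ) := (Real.rpow_one l).symm
      _ ≤ _ := Real.rpow_le_rpow_of_exponent_le hl1 (by linarith)
  have hlogfl : Real.log ⌊y⌋₊ ≤ l := by
    rcases Nat.eq_zero_or_pos ⌊y⌋₊ with h | h
    · rw [h]; simp; linarith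
    · exact Real.log_le_log (by exact_mod_cast h) ((Nat.floor_le hy0).trans hyx)
  have hX : 0 ≤ x / l ^ B := by positivity
  rcases le_or_gt y (3 * √x) with hys | hys
  · have h1 : 0 ≤ ∑ n ∈ Icc 1 ⌊y⌋₊, residueClass a n :=
      sum_nonneg fun n _ ↦ ArithmeticFunction.vonMangoldt.residueClass_nonneg a n
    have h2 : ∑ n ∈ Icc 1 ⌊y⌋₊, residueClass a n ≤ 3 * √x * l := by
      have : ∀ n ∈ Icc 1 ⌊y⌋₊, residueClass a n ≤ l := fun n hn ↦ by
        rw [mem_Icc] at hn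
        refine (ArithmeticFunction.vonMangoldt.residueClass_le a n).trans
          (ArithmeticFunction.vonMangoldt_le_log.trans (le_trans ?_ hlogfl))
        exact Real.log_le_log (by exact_mod_cast hn.1) (by exact_mod_cast hn.2)
      refine (sum_le_card_nsmul _ _ _ this).trans ?_
      rw [Nat.card_Icc, Nat.add_sub_cancel, nsmul_eq_mul]
      gcongr
      exact (Nat.floor_le hy0).trans hys
    have h4 : 0 ≤ y / q.totient := by positivity
    have h5 : y / q.totient ≤ 3 * √x * l := by
      calc y / q.totient ≤ y := div_le_self hy0 hφ1
        _ ≤ 3 * √x * 1 := by linarith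
        _ ≤ _ := by gcongr
    have h6 : 3 * √x * l ≤ 3 * (C₃ * (x / l ^ B)) := by
      have : √x * l ≤ √x * l ^ (A + 2) := by gcongr
      linarith
    have h7 : (0 : ℝ) ≤ (2 ^ (j + 1) * C₁ + 2 ^ j * C₂ + 17 * C₃) * (x / l ^ B) := by positivity
    rw [abs_le]
    constructor <;> nlinarith
  · have hy3 : 3 ≤ y := by linarith
    have hlogy : l / 2 ≤ Real.log y := by
      rw [← Real.log_sqrt hx0.le]
      exact Real.log_le_log (by linarith) (by linarith)
    have hpow : x / Real.log y ^ j ≤ 2 ^ j * (x / l ^ (A + B)) := by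
      have h1 : l ^ (A + B) ≤ l ^ j := by
        rw [← Real.rpow_natCast]
        exact Real.rpow_le_rpow_of_exponent_le hl1 (Nat.le_ceil _)
      calc x / Real.log y ^ j ≤ x / (l / 2) ^ j := by gcongr
        _ = 2 ^ j * (x / l ^ j) := by rw [div_pow]; field_simp
        _ ≤ _ := by gcongr
    have hAB : x / l ^ (A + B) = x / l ^ B / l ^ A := by
      rw [Real.rpow_add hl0]; field_simp
    have hlA : 1 ≤ l ^ A := Real.one_le_rpow hl1 hA
    have hAB' : x / l ^ (A + B) ≤ x / l ^ B := by
      rw [hAB]; exact div_le_self hX hlA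
    have h1 := abs_sum_residueClass_sub_le ha (N := ⌊y⌋₊) (T := 2 ^ (j + 1) * C₁ * (x / l ^ B))
      (fun χ hχ ↦ (h₁ q χ hχ y hy3).trans ?_) (by positivity)
    · have h2 : |∑ n ∈ Icc 1 ⌊y⌋₊, vonMangoldt n - ⌊y⌋₊| ≤ 2 ^ j * C₂ * (x / l ^ B) := by
        refine (h₂ y hy3).trans ?_
        have h0 : 0 ≤ Real.log y := by linarith
        calc C₂ * y / Real.log y ^ j ≤ C₂ * (x / Real.log y ^ j) := by
              rw [mul_div_assoc]; gcongr
          _ ≤ C₂ * (2 ^ j * (x / l ^ B)) := by gcongr; exact hpow.trans (by gcongr)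
          _ = _ := by ring
      have h3 : (q : ℝ) * (2 * (Real.log ⌊y⌋₊ + 1) ^ 2) ≤ 16 * C₃ * (x / l ^ B) := by
        have h0 : 0 ≤ Real.log ⌊y⌋₊ := Real.log_natCast_nonneg _
        calc (q : ℝ) * (2 * (Real.log ⌊y⌋₊ + 1) ^ 2) ≤ 2 * l ^ A * (2 * (l + l) ^ 2) := by
              gcongr
          _ = 16 * (1 * l ^ (A + 2)) := by
            rw [Real.rpow_add hl0, Real.rpow_two]; ring
          _ ≤ 16 * (√x * l ^ (A + 2)) := by gcongr
          _ ≤ _ := by linarith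
      have h4 : |(⌊y⌋₊ : ℝ) - y| ≤ C₃ * (x / l ^ B) := by
        have h5 := Nat.floor_le hy0
        have h6 := Nat.lt_floor_add_one y
        have h7 : 1 ≤ √x * l ^ (A + 2) := by nlinarith
        rw [abs_le]; constructor <;> linarith
      have h5 : |(∑ n ∈ Icc 1 ⌊y⌋₊, vonMangoldt n - y) / q.totient| ≤
          2 ^ j * C₂ * (x / l ^ B) + C₃ * (x / l ^ B) := by
        rw [abs_div, abs_of_pos (by linarith : (0 : ℝ) < q.totient)]
        refine (div_le_self (abs_nonneg _) hφ1).trans ?_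
        have := abs_add_le (∑ n ∈ Icc 1 ⌊y⌋₊, vonMangoldt n - ⌊y⌋₊) (⌊y⌋₊ - y)
        rw [sub_add_sub_cancel] at this
        linarith
      have h6 := abs_add_le (∑ n ∈ Icc 1 ⌊y⌋₊, residueClass a n -
        (∑ n ∈ Icc 1 ⌊y⌋₊, vonMangoldt n) / q.totient)
        ((∑ n ∈ Icc 1 ⌊y⌋₊, vonMangoldt n - y) / q.totient)
      have h7 : ∑ n ∈ Icc 1 ⌊y⌋₊, residueClass a n -
        (∑ n ∈ Icc 1 ⌊y⌋₊, vonMangoldt n) / q.totient +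
        (∑ n ∈ Icc 1 ⌊y⌋₊, vonMangoldt n - y) / q.totient =
        ∑ n ∈ Icc 1 ⌊y⌋₊, residueClass a n - y / q.totient := by ring
      rw [h7] at h6
      have h8 : 0 ≤ C₃ * (x / l ^ B) := by positivity
      linarith
    · have h0 : 0 ≤ Real.log y := by linarith
      calc C₁ * q * y / Real.log y ^ j ≤ C₁ * q * (x / Real.log y ^ j) := by
            rw [mul_div_assoc]; gcongr
        _ ≤ C₁ * (2 * l ^ A) * (2 ^ j * (x / l ^ B / l ^ A)) := by
            rw [← hAB]; gcongr
        _ = _ := by field_simp; ring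

end SiegelWalfisz

namespace SiegelWalfisz

/-- Sums over progressions to large moduli are sums over progressions to the complementary
moduli. -/
lemma sum_large_moduli_eq {Q₀ Q₁ X M : ℕ} {a : ℤ} (ha : |a| ≤ Q₀) (hQ : Q₀ ≤ Q₁)
    (hM : X - a < (M + 1) * (Q₀ + 1)) (f : ℕ → ℝ) :
    ∑ q ∈ Ioc Q₀ Q₁, ∑ n ∈ (Icc 1 X).filter (fun n : ℕ ↦ a < (n : ℤ) ∧ (q : ℤ) ∣ (n : ℤ) - a), f n =
      ∑ m ∈ Icc 1 M, ∑ n ∈ (Ioc (a + m * Q₀).toNat (min (X : ℤ) (a + m * Q₁)).toNat).filter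
        (fun n : ℕ ↦ (m : ℤ) ∣ (n : ℤ) - a), f n := by
  rw [sum_sigma', sum_sigma']
  have ha' := abs_le.1 ha
  refine sum_bij' (fun z _ ↦ ⟨((z.2 - a) / z.1).toNat, z.2⟩)
    (fun z _ ↦ ⟨((z.2 - a) / z.1).toNat, z.2⟩) ?_ ?_ ?_ ?_ ?_
  · rintro ⟨q, n⟩ h
    simp only [mem_sigma, mem_Ioc, mem_filter, mem_Icc] at h ⊢
    obtain ⟨⟨h1, h2⟩, ⟨h3, h4⟩, h5, k, hk⟩ := h
    have hq : (0 : ℤ) < q := by lia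
    have hk0 : 0 < k := by
      by_contra! h
      nlinarith
    rw [hk, Int.mul_ediv_cancel_left _ hq.ne']
    have hkM : k < M + 1 := by
      by_contra! h
      have : ((M : ℤ) + 1) * (Q₀ + 1) ≤ k * q := by gcongr; lia
      nlinarith
    have h6 : k * (Q₀ + 1) ≤ k * q := by gcongr; lia
    have h7 : k * q ≤ k * Q₁ := by gcongr
    rw [Int.toNat_of_nonneg hk0.le]
    have h8 : Q₀ ≤ k * Q₀ := by nlinarith
    have h9 : k * q = q * k := mul_comm _ _
    refine ⟨by lia, ⟨?_, ?_⟩, Dvd.intro_left _ rfl⟩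
    · rw [Int.toNat_lt (by lia)]
      lia
    · rw [Int.le_toNat (by lia)]
      lia
  · rintro ⟨m, n⟩ h
    simp only [mem_sigma, mem_Ioc, mem_filter, mem_Icc] at h ⊢
    obtain ⟨⟨h1, h2⟩, ⟨h3, h4⟩, k, hk⟩ := h
    have hm : (0 : ℤ) < m := by lia
    have h8 : (Q₀ : ℤ) ≤ m * Q₀ := by nlinarith
    have h10 : (m : ℤ) * Q₀ ≤ m * Q₁ := by gcongr
    rw [Int.toNat_lt (by lia)] at h3
    rw [Int.le_toNat (by lia)] at h4
    have h5 : Q₀ < k := by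
      by_contra! h
      have : m * k ≤ m * Q₀ := by gcongr
      lia
    have h6 : k ≤ Q₁ := by
      by_contra! h
      have : (m : ℤ) * Q₁ < m * k := by gcongr
      lia
    rw [hk, Int.mul_ediv_cancel_left _ hm.ne', Int.toNat_of_nonneg (by lia)]
    refine ⟨by lia, ⟨by lia, by lia⟩, by lia, Dvd.intro_left _ rfl⟩
  · rintro ⟨q, n⟩ h
    simp only [mem_sigma, mem_Ioc, mem_filter, mem_Icc] at h
    obtain ⟨⟨h1, h2⟩, ⟨h3, h4⟩, h5, k, hk⟩ := h
    have hq : (0 : ℤ) < q := by lia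
    have hk0 : 0 < k := by
      by_contra! h
      nlinarith
    simp only [hk, Int.mul_ediv_cancel_left _ hq.ne', Int.toNat_of_nonneg hk0.le,
      Int.mul_ediv_cancel _ hk0.ne', Int.toNat_natCast]
  · rintro ⟨m, n⟩ h
    simp only [mem_sigma, mem_Ioc, mem_filter, mem_Icc] at h
    obtain ⟨⟨h1, h2⟩, ⟨h3, h4⟩, k, hk⟩ := h
    have hm : (0 : ℤ) < m := by lia
    have h8 : (Q₀ : ℤ) ≤ m * Q₀ := by nlinarith
    rw [Int.toNat_lt (by lia)] at h3
    have hk0 : 0 < k := by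
      by_contra! h
      nlinarith
    simp only [hk, Int.mul_ediv_cancel_left _ hm.ne', Int.toNat_of_nonneg hk0.le,
      Int.mul_ediv_cancel _ hk0.ne', Int.toNat_natCast]
  · intros; rfl

lemma abs_card_progression_sub_le {l u d m : ℕ} (hlu : l ≤ u) (hd : d ≠ 0) (hm : m ≠ 0) (a : ℤ) :
    |(#((Ioc l u).filter fun n : ℕ ↦ ((m : ℤ) ∣ (n : ℤ) - a) ∧ d ∣ n) : ℝ) -
      if (d.gcd m : ℤ) ∣ a then ((u : ℝ) - l) / (d.lcm m : ℕ) else 0| ≤ 1 := by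
  split_ifs with h
  · obtain ⟨k, hk⟩ := h
    have hL : 0 < d.lcm m := Nat.lcm_pos (by lia) (by lia)
    have hbez := Nat.gcd_eq_gcd_ab d m
    set v : ℕ := ((d * (d.gcdA m * k)) % (d.lcm m : ℤ)).toNat with hv
    have hv' : (v : ℤ) ≡ d * (d.gcdA m * k) [ZMOD (d.lcm m : ℕ)] := by
      rw [hv, Int.toNat_of_nonneg (Int.emod_nonneg _ (by lia))]
      exact Int.mod_modEq _ _
    have hvd : (d : ℤ) ∣ v := by
      have := (hv'.of_dvd (m := d) (by exact_mod_cast Nat.dvd_lcm_left d m)).dvd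
      exact (dvd_sub_right (Dvd.intro _ rfl)).1 this
    have hvm : (m : ℤ) ∣ v - a := by
      have := (hv'.of_dvd (m := m) (by exact_mod_cast Nat.dvd_lcm_right d m)).dvd
      have h2 : (v : ℤ) - a = -(d * (d.gcdA m * k) - v) - m * (d.gcdB m * k) := by
        rw [hk, hbez]; ring
      rw [h2]
      exact dvd_sub (dvd_neg.2 this) (Dvd.intro _ rfl)
    have heq : ((Ioc l u).filter fun n : ℕ ↦ ((m : ℤ) ∣ (n : ℤ) - a) ∧ d ∣ n) =
        {n ∈ Ioc l u | n ≡ v [MOD d.lcm m]} := by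
      refine filter_congr fun n _ ↦ ?_
      rw [← Int.natCast_modEq_iff, Int.modEq_comm, Int.modEq_iff_dvd]
      push_cast
      rw [← Int.natCast_dvd_natCast (n := n)]
      constructor
      · rintro ⟨h1, h2⟩
        have h3 := dvd_sub h1 hvm
        rw [sub_sub_sub_cancel_right] at h3
        simpa [Int.lcm] using Int.coe_lcm_dvd (dvd_sub h2 hvd) h3
      · intro h1
        have h3 : (d : ℤ) ∣ n - v := (Int.natCast_dvd_natCast.2 (Nat.dvd_lcm_left d m)).trans h1
        have h4 : (m : ℤ) ∣ n - v := (Int.natCast_dvd_natCast.2 (Nat.dvd_lcm_right d m)).trans h1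
        exact ⟨by simpa using dvd_add h4 hvm, by simpa using dvd_add h3 hvd⟩
    have hL' : (0 : ℝ) < d.lcm m := by exact_mod_cast hL
    have h1 := Nat.Ioc_filter_modEq_card l u hL v
    have h2 : (l - v : ℚ) / d.lcm m ≤ (u - v) / d.lcm m := by gcongr
    rw [heq]
    rw [max_eq_left (by have := Int.floor_mono h2; lia)] at h1
    have h3 := Int.floor_le ((l - v : ℚ) / d.lcm m)
    have h4 := Int.lt_floor_add_one ((l - v : ℚ) / d.lcm m)
    have h5 := Int.floor_le ((u - v : ℚ) / d.lcm m)
    have h6 := Int.lt_floor_add_one ((u - v : ℚ) / d.lcm m)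
    have h7 : ((#{n ∈ Ioc l u | n ≡ v [MOD d.lcm m]} : ℕ) : ℚ) =
      ⌊(u - v : ℚ) / d.lcm m⌋ - ⌊(l - v : ℚ) / d.lcm m⌋ := by exact_mod_cast h1
    have h8 : |((#{n ∈ Ioc l u | n ≡ v [MOD d.lcm m]} : ℕ) : ℚ) - (u - l) / d.lcm m| ≤ 1 := by
      rw [h7, abs_le]
      have : (u - l : ℚ) / d.lcm m = (u - v : ℚ) / d.lcm m - (l - v : ℚ) / d.lcm m := by ring
      rw [this]
      constructor <;> linarith
    have h9 := (Rat.cast_le (K := ℝ)).2 h8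
    push_cast at h9
    exact h9
  · rw [filter_false_of_mem]
    · simp
    rintro n _ ⟨h1, h2⟩
    refine h ?_
    have h3 : (d.gcd m : ℤ) ∣ n - a :=
      dvd_trans (Int.natCast_dvd_natCast.2 (Nat.gcd_dvd_right d m)) h1
    have h4 : (d.gcd m : ℤ) ∣ n := dvd_trans
      (Int.natCast_dvd_natCast.2 (Nat.gcd_dvd_left d m)) (Int.natCast_dvd_natCast.2 h2)
    exact (dvd_sub_right h4).1 h3

end SiegelWalfisz

namespace SiegelWalfisz

open ArithmeticFunction (moebius)

lemma totient_eq_prod_of_squarefree {n : ℕ} (hn : Squarefree n) :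
    (n.totient : ℝ) = ∏ p ∈ n.primeFactors, ((p : ℝ) - 1) := by
  have h := Nat.totient_mul_prod_primeFactors n
  rw [Nat.prod_primeFactors_of_squarefree hn, mul_comm n] at h
  rw [Nat.eq_of_mul_eq_mul_right hn.ne_zero.bot_lt h, Nat.cast_prod]
  exact prod_congr rfl fun p hp ↦ by
    rw [Nat.cast_sub (Nat.prime_of_mem_primeFactors hp).one_le, Nat.cast_one]

lemma moebius_mul_totient {n : ℕ} (hn : Squarefree n) :
    (moebius n : ℝ) * n.totient = ∑ d ∈ n.divisors, (moebius d : ℝ) * d := by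
  have h := ArithmeticFunction.IsMultiplicative.prodPrimeFactors_one_sub_of_squarefree
    (R := ℝ) (↑ArithmeticFunction.id)
    (ArithmeticFunction.isMultiplicative_id.natCast) hn
  simp only [ArithmeticFunction.natCoe_apply, ArithmeticFunction.id_apply] at h
  rw [← h, totient_eq_prod_of_squarefree hn]
  have h2 := ArithmeticFunction.isMultiplicative_moebius.map_prod_of_subset_primeFactors n
    n.primeFactors subset_rfl
  rw [Nat.prod_primeFactors_of_squarefree hn] at h2
  rw [h2, Int.cast_prod, ← prod_mul_distrib]
  refine prod_congr rfl fun p hp ↦ ?_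
  rw [ArithmeticFunction.moebius_apply_prime (Nat.prime_of_mem_primeFactors hp)]
  push_cast; ring

lemma FR_eq (R : ℝ) (n : ℕ) : FR R n = ∑ r ∈ Icc 1 ⌊R⌋₊, (moebius r : ℝ) ^ 2 / r.totient *
    ∑ d ∈ r.divisors with d ∣ n, (moebius d : ℝ) * d := by
  refine sum_congr rfl fun r hr ↦ ?_
  by_cases hs : Squarefree r
  · have h1 : r.divisors.filter (· ∣ n) = (r.gcd n).divisors := by
      ext d
      have := hs.ne_zero
      simp [Nat.dvd_gcd_iff, this, Nat.gcd_eq_zero_iff]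
    rw [h1, ← moebius_mul_totient (hs.squarefree_of_dvd (Nat.gcd_dvd_left r n)), Int.gcd_natCast_natCast]
    ring
  · rw [ArithmeticFunction.moebius_eq_zero_of_not_squarefree hs]
    simp

/-- The multiplicative weight equal to `(d, m)` if `(d, m) ∣ a` and to `0` otherwise. -/
noncomputable def gcdWeight (m : ℕ) (a : ℤ) : ArithmeticFunction ℝ :=
  ⟨fun d ↦ if d ≠ 0 ∧ (d.gcd m : ℤ) ∣ a then (d.gcd m : ℝ) else 0, by simp⟩

lemma gcdWeight_apply {m d : ℕ} (hd : d ≠ 0) (a : ℤ) :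
    gcdWeight m a d = if (d.gcd m : ℤ) ∣ a then (d.gcd m : ℝ) else 0 := by
  simp [gcdWeight, hd]

lemma isMultiplicative_gcdWeight (m : ℕ) (a : ℤ) : (gcdWeight m a).IsMultiplicative := by
  rw [ArithmeticFunction.IsMultiplicative.iff_ne_zero]
  refine ⟨by simp [gcdWeight], fun {d e} hd he h ↦ ?_⟩
  rw [gcdWeight_apply (mul_ne_zero hd he), gcdWeight_apply hd, gcdWeight_apply he,
    Nat.gcd_comm _ m, h.gcd_mul m, Nat.gcd_comm m, Nat.gcd_comm m]
  have hc : IsCoprime (d.gcd m : ℤ) (e.gcd m) := by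
    rw [Nat.isCoprime_iff_coprime]
    simpa only [Nat.gcd_comm] using h.gcd_both m m
  have : ((d.gcd m * e.gcd m : ℕ) : ℤ) ∣ a ↔ (d.gcd m : ℤ) ∣ a ∧ (e.gcd m : ℤ) ∣ a := by
    push_cast
    exact ⟨fun h ↦ ⟨dvd_of_mul_right_dvd h, dvd_of_mul_left_dvd h⟩, fun h ↦ hc.mul_dvd h.1 h.2⟩
  simp only [this]
  by_cases h1 : (d.gcd m : ℤ) ∣ a <;> by_cases h2 : (e.gcd m : ℤ) ∣ a <;> simp [h1, h2]

lemma sum_divisors_moebius_sq_mul_prod {m : ℕ} (hm : m ≠ 0) (g : ℕ → ℝ) :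
    ∑ r ∈ m.divisors, (moebius r : ℝ) ^ 2 * ∏ p ∈ r.primeFactors, g p =
      ∏ p ∈ m.primeFactors, (1 + g p) := by
  have h1 : ∑ r ∈ m.divisors, (moebius r : ℝ) ^ 2 * ∏ p ∈ r.primeFactors, g p =
      ∑ r ∈ m.divisors with Squarefree r, ∏ p ∈ r.primeFactors, g p := by
    rw [sum_filter]
    refine sum_congr rfl fun r _ ↦ ?_
    split_ifs with h
    · have := ArithmeticFunction.moebius_sq_eq_one_of_squarefree h
      rw [show (moebius r : ℝ) ^ 2 = 1 by exact_mod_cast this, one_mul]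
    · simp [ArithmeticFunction.moebius_eq_zero_of_not_squarefree h]
  have h2 : (UniqueFactorizationMonoid.normalizedFactors m).toFinset = m.primeFactors := by
    rw [Nat.factors_eq]; rfl
  rw [h1, Nat.sum_divisors_filter_squarefree hm, h2, prod_one_add]
  refine sum_congr rfl fun t ht ↦ ?_
  have h3 := Nat.primeFactors_prod (s := t) fun p hp ↦
    Nat.prime_of_mem_primeFactors (mem_powerset.1 ht hp)
  rw [prod_val, show ∏ p ∈ t, id p = ∏ p ∈ t, p from rfl, h3]

/-- The local density of `F_R` at level `r`. -/
noncomputable def density (m : ℕ) (a : ℤ) (r : ℕ) : ℝ :=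
  (moebius r : ℝ) ^ 2 / r.totient * ∑ d ∈ r.divisors, (moebius d : ℝ) * gcdWeight m a d

lemma density_eq (m : ℕ) (a : ℤ) (r : ℕ) : density m a r =
    (moebius r : ℝ) ^ 2 * ∏ p ∈ r.primeFactors, ((1 - gcdWeight m a p) / ((p : ℝ) - 1)) := by
  rw [density]
  by_cases hr : Squarefree r
  · rw [← (isMultiplicative_gcdWeight m a).prodPrimeFactors_one_sub_of_squarefree _ hr,
      totient_eq_prod_of_squarefree hr, prod_div_distrib]
    ring
  · simp [ArithmeticFunction.moebius_eq_zero_of_not_squarefree hr]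

lemma abs_density_le_one (m : ℕ) (a : ℤ) (r : ℕ) : |density m a r| ≤ 1 := by
  rw [density_eq, abs_mul, abs_prod]
  refine mul_le_one₀ ?_ (prod_nonneg fun _ _ ↦ abs_nonneg _) (prod_le_one (fun _ _ ↦ abs_nonneg _) ?_)
  · rw [abs_of_nonneg (sq_nonneg _), sq_le_one_iff_abs_le_one]
    exact_mod_cast ArithmeticFunction.abs_moebius_le_one
  · intro p hp
    have hp' := Nat.prime_of_mem_primeFactors hp
    have h2 : (2 : ℝ) ≤ p := by exact_mod_cast hp'.two_le
    rw [abs_div, abs_of_pos (by linarith : (0 : ℝ) < p - 1), div_le_one (by linarith), abs_le,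
      gcdWeight_apply hp'.ne_zero]
    have h3 : (p.gcd m : ℝ) ≤ p := by exact_mod_cast Nat.gcd_le_left m hp'.pos
    have h4 : (0 : ℝ) ≤ p.gcd m := by positivity
    split_ifs <;> constructor <;> linarith

lemma density_eq_zero {m r : ℕ} (a : ℤ) (hm : m ≠ 0) (h : ¬ r ∣ m) : density m a r = 0 := by
  rw [density_eq]
  by_cases hr : Squarefree r
  · have : ¬ r.primeFactors ⊆ m.primeFactors := by
      rw [← Nat.prod_primeFactors_dvd_iff hm, Nat.prod_primeFactors_of_squarefree hr]
      exact h
    obtain ⟨p, hp, hpm⟩ := not_subset.1 this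
    have hp' := Nat.prime_of_mem_primeFactors hp
    have : p.gcd m = 1 := (Nat.Prime.coprime_iff_not_dvd hp').2 fun h ↦
      hpm (Nat.mem_primeFactors.2 ⟨hp', h, hm⟩)
    rw [prod_eq_zero hp, mul_zero]
    rw [gcdWeight_apply hp'.ne_zero]
    simp [this]
  · simp [ArithmeticFunction.moebius_eq_zero_of_not_squarefree hr]

lemma sum_divisors_density {m : ℕ} (hm : m ≠ 0) (a : ℤ) :
    ∑ r ∈ m.divisors, density m a r = if IsCoprime a m then (m : ℝ) / m.totient else 0 := by
  simp_rw [density_eq]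
  rw [sum_divisors_moebius_sq_mul_prod hm]
  have key {p : ℕ} (hp : p ∈ m.primeFactors) : 1 + (1 - gcdWeight m a p) / ((p : ℝ) - 1) =
      if (p : ℤ) ∣ a then 0 else (1 - (p : ℝ)⁻¹)⁻¹ := by
    have hp' := Nat.prime_of_mem_primeFactors hp
    have h2 : (2 : ℝ) ≤ p := by exact_mod_cast hp'.two_le
    rw [gcdWeight_apply hp'.ne_zero, Nat.gcd_eq_left (Nat.dvd_of_mem_primeFactors hp)]
    split_ifs <;> field_simp [show (p : ℝ) - 1 ≠ 0 by linarith] <;> ring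
  rw [prod_congr rfl fun p hp ↦ key hp]
  have hc : IsCoprime a m ↔ ∀ p ∈ m.primeFactors, ¬ (p : ℤ) ∣ a := by
    rw [Int.isCoprime_iff_gcd_eq_one]
    change Nat.Coprime a.natAbs m ↔ _
    rw [Nat.coprime_comm]
    constructor
    · intro h p hp hpa
      have hp' := Nat.prime_of_mem_primeFactors hp
      exact Nat.not_coprime_of_dvd_of_dvd hp'.one_lt (Nat.dvd_of_mem_primeFactors hp)
        (Int.natCast_dvd.1 hpa) h
    · intro h
      refine Nat.coprime_of_dvd fun p hp h1 h2 ↦ ?_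
      exact h p (Nat.mem_primeFactors.2 ⟨hp, h1, hm⟩) (Int.natCast_dvd.2 h2)
  split_ifs with h
  · rw [hc] at h
    rw [prod_congr rfl fun p hp ↦ if_neg (h p hp), prod_inv_distrib]
    have h1 := Nat.totient_eq_mul_prod_factors m
    have h2 : (m.totient : ℝ) = m * ∏ p ∈ m.primeFactors, (1 - (p : ℝ)⁻¹) := by
      have := congrArg (Rat.cast : ℚ → ℝ) h1
      push_cast at this
      exact this
    have h3 : (m.totient : ℝ) ≠ 0 := by
      exact_mod_cast (Nat.totient_pos.2 hm.bot_lt).ne'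
    rw [h2] at h3 ⊢
    field_simp [right_ne_zero_of_mul h3]
  · rw [hc] at h
    push Not at h
    obtain ⟨p, hp, hpa⟩ := h
    exact prod_eq_zero hp (if_pos hpa)

end SiegelWalfisz

namespace SiegelWalfisz

open ArithmeticFunction (moebius)

lemma sum_divisors_div_totient_le {r : ℕ} (hr : Squarefree r) :
    (∑ d ∈ r.divisors, (d : ℝ)) / r.totient ≤
      ∑ d ∈ r.divisors, (4 : ℝ) ^ #d.primeFactors / d := by
  have hr0 := hr.ne_zero
  have hd {d : ℕ} (h : d ∈ r.divisors) : Squarefree d :=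
    hr.squarefree_of_dvd (Nat.dvd_of_mem_divisors h)
  have hμ {d : ℕ} (h : d ∈ r.divisors) : (moebius d : ℝ) ^ 2 = 1 := by
    exact_mod_cast ArithmeticFunction.moebius_sq_eq_one_of_squarefree (hd h)
  have h1 : ∑ d ∈ r.divisors, (d : ℝ) = ∏ p ∈ r.primeFactors, (1 + (p : ℝ)) := by
    rw [← sum_divisors_moebius_sq_mul_prod hr0]
    refine sum_congr rfl fun d h ↦ ?_
    rw [hμ h, one_mul, ← Nat.cast_prod, Nat.prod_primeFactors_of_squarefree (hd h)]
  have h2 : ∑ d ∈ r.divisors, (4 : ℝ) ^ #d.primeFactors / d =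
      ∏ p ∈ r.primeFactors, (1 + 4 / (p : ℝ)) := by
    rw [← sum_divisors_moebius_sq_mul_prod hr0]
    refine sum_congr rfl fun d h ↦ ?_
    rw [hμ h, one_mul, prod_div_distrib, prod_const, ← Nat.cast_prod,
      Nat.prod_primeFactors_of_squarefree (hd h)]
  rw [h1, h2, totient_eq_prod_of_squarefree hr, ← prod_div_distrib]
  have hp {p : ℕ} (h : p ∈ r.primeFactors) : (2 : ℝ) ≤ p := by
    exact_mod_cast (Nat.prime_of_mem_primeFactors h).two_le
  refine prod_le_prod (fun p h ↦ ?_) fun p h ↦ ?_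
  · have := hp h
    exact div_nonneg (by linarith) (by linarith)
  · have := hp h
    rw [div_le_iff₀ (by linarith), ← sub_nonneg]
    have : (1 + 4 / (p : ℝ)) * (p - 1) - (1 + p) = 2 * (p - 2) / p := by
      field_simp; ring
    rw [this]
    exact div_nonneg (by linarith) (by linarith)

lemma exists_sum_sigma_div_totient_le : ∃ C : ℝ, 0 < C ∧ ∀ K : ℕ,
    ∑ r ∈ Icc 1 K, (moebius r : ℝ) ^ 2 / r.totient * ∑ d ∈ r.divisors, (d : ℝ) ≤ C * K := by
  obtain ⟨C, hC1, hC⟩ := exists_four_pow_primeFactors_le (ε := 1 / 2) (by norm_num)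
  have hs : Summable fun n : ℕ ↦ 1 / (n : ℝ) ^ (3 / 2 : ℝ) :=
    Real.summable_one_div_nat_rpow.2 (by norm_num)
  have hs0 : 0 ≤ ∑' n : ℕ, 1 / (n : ℝ) ^ (3 / 2 : ℝ) := tsum_nonneg fun n ↦ by positivity
  refine ⟨C * (∑' n : ℕ, 1 / (n : ℝ) ^ (3 / 2 : ℝ) + 1), by positivity, fun K ↦ ?_⟩
  calc ∑ r ∈ Icc 1 K, (moebius r : ℝ) ^ 2 / r.totient * ∑ d ∈ r.divisors, (d : ℝ)
      ≤ ∑ r ∈ Icc 1 K, ∑ d ∈ r.divisors, (4 : ℝ) ^ #d.primeFactors / d := by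
        refine sum_le_sum fun r _ ↦ ?_
        by_cases hr : Squarefree r
        · have := ArithmeticFunction.moebius_sq_eq_one_of_squarefree hr
          rw [show (moebius r : ℝ) ^ 2 = 1 by exact_mod_cast this, one_div_mul_eq_div]
          exact sum_divisors_div_totient_le hr
        · rw [ArithmeticFunction.moebius_eq_zero_of_not_squarefree hr]
          simp only [Int.cast_zero, ne_eq, OfNat.ofNat_ne_zero, not_false_eq_true, zero_pow,
            zero_div, zero_mul]
          positivity
    _ = ∑ d ∈ Icc 1 K, ∑ r ∈ Ioc 0 K with d ∣ r, (4 : ℝ) ^ #d.primeFactors / d := by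
        refine sum_comm' fun r d ↦ ?_
        simp only [mem_Icc, Nat.mem_divisors, mem_filter, mem_Ioc]
        constructor
        · rintro ⟨⟨h1, h2⟩, h3, -⟩
          exact ⟨⟨⟨by lia, h2⟩, h3⟩, Nat.pos_of_dvd_of_pos h3 h1, (Nat.le_of_dvd h1 h3).trans h2⟩
        · rintro ⟨⟨⟨h1, h2⟩, h3⟩, -⟩
          exact ⟨⟨h1, h2⟩, h3, by lia⟩
    _ ≤ ∑ d ∈ Icc 1 K, C * K * (1 / (d : ℝ) ^ (3 / 2 : ℝ)) := by
        refine sum_le_sum fun d hd ↦ ?_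
        have hd1 := (mem_Icc.1 hd).1
        have hd0 : (0 : ℝ) < d := by exact_mod_cast hd1
        rw [sum_const, Nat.Ioc_filter_dvd_card_eq_div, nsmul_eq_mul]
        have h1 := hC d (by lia)
        have h2 : ((K / d : ℕ) : ℝ) ≤ K / d := Nat.cast_div_le
        have h3 : (d : ℝ) ^ (3 / 2 : ℝ) * d ^ (1 / 2 : ℝ) = d * d := by
          rw [← rpow_add hd0, ← sq, ← rpow_natCast]; norm_num
        calc ((K / d : ℕ) : ℝ) * ((4 : ℝ) ^ #d.primeFactors / d)
            ≤ K / d * (C * (d : ℝ) ^ (1 / 2 : ℝ) / d) := by gcongr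
          _ = C * K * (d : ℝ) ^ (1 / 2 : ℝ) / (d * d) := by ring
          _ = C * K * (1 / (d : ℝ) ^ (3 / 2 : ℝ)) := by rw [← h3]; field_simp
    _ ≤ C * K * (∑' n : ℕ, 1 / (n : ℝ) ^ (3 / 2 : ℝ)) := by
        rw [← mul_sum]
        gcongr
        exact hs.sum_le_tsum _ fun n _ ↦ by positivity
    _ ≤ _ := by
        have : 0 ≤ C * K := by positivity
        linarith

lemma sum_density_eq_sum_divisors {m K : ℕ} (hm : m ≠ 0) (a : ℤ) :
    ∑ r ∈ Icc 1 K, density m a r = ∑ r ∈ m.divisors with r ≤ K, density m a r := by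
  symm
  refine sum_subset_zero_on_sdiff (fun r hr ↦ ?_) (fun r hr ↦ ?_) fun _ _ ↦ rfl
  · rw [mem_filter] at hr
    exact mem_Icc.2 ⟨Nat.pos_of_mem_divisors hr.1, hr.2⟩
  · simp only [mem_sdiff, mem_Icc, mem_filter, Nat.mem_divisors] at hr
    exact density_eq_zero a hm fun h ↦ hr.2 ⟨⟨h, hm⟩, hr.1.2⟩

lemma sum_density {m K : ℕ} (hm : m ≠ 0) (hK : m ≤ K) (a : ℤ) :
    ∑ r ∈ Icc 1 K, density m a r = if IsCoprime a m then (m : ℝ) / m.totient else 0 := by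
  rw [sum_density_eq_sum_divisors hm, filter_true_of_mem fun r hr ↦ ?_, sum_divisors_density hm]
  exact (Nat.divisor_le hr).trans hK

lemma abs_sum_density_le {m : ℕ} (hm : m ≠ 0) (K : ℕ) (a : ℤ) :
    |∑ r ∈ Icc 1 K, density m a r| ≤ m := by
  rw [sum_density_eq_sum_divisors hm]
  refine (abs_sum_le_sum_abs _ _).trans ?_
  refine (sum_le_card_nsmul _ _ 1 fun r _ ↦ abs_density_le_one m a r).trans ?_
  rw [nsmul_eq_mul, mul_one]
  exact_mod_cast (card_filter_le _ _).trans (Nat.card_divisors_le_self m)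

lemma abs_sum_FR_sub_le {l u m : ℕ} (hlu : l ≤ u) (hm : m ≠ 0) (a : ℤ) (R : ℝ) :
    |∑ n ∈ (Ioc l u).filter (fun n : ℕ ↦ (m : ℤ) ∣ (n : ℤ) - a), FR R n -
      ((u : ℝ) - l) / m * ∑ r ∈ Icc 1 ⌊R⌋₊, density m a r| ≤
      ∑ r ∈ Icc 1 ⌊R⌋₊, (moebius r : ℝ) ^ 2 / r.totient * ∑ d ∈ r.divisors, (d : ℝ) := by
  have h1 : ∑ n ∈ (Ioc l u).filter (fun n : ℕ ↦ (m : ℤ) ∣ (n : ℤ) - a), FR R n =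
      ∑ r ∈ Icc 1 ⌊R⌋₊, (moebius r : ℝ) ^ 2 / r.totient * ∑ d ∈ r.divisors,
        (moebius d : ℝ) * d * #((Ioc l u).filter fun n : ℕ ↦ ((m : ℤ) ∣ (n : ℤ) - a) ∧ d ∣ n) := by
    simp_rw [FR_eq]
    rw [sum_comm]
    refine sum_congr rfl fun r _ ↦ ?_
    rw [← mul_sum]
    simp_rw [sum_filter (fun d ↦ d ∣ _)]
    rw [sum_comm]
    congr 1
    refine sum_congr rfl fun d _ ↦ ?_
    rw [← sum_filter, filter_filter, sum_const, nsmul_eq_mul, mul_comm]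
  rw [h1, mul_sum, ← sum_sub_distrib]
  refine (abs_sum_le_sum_abs _ _).trans (sum_le_sum fun r hr ↦ ?_)
  rw [density, mul_left_comm, ← mul_sub, abs_mul, abs_of_nonneg (by positivity)]
  gcongr
  rw [mul_sum, ← sum_sub_distrib]
  refine (abs_sum_le_sum_abs _ _).trans (sum_le_sum fun d hd ↦ ?_)
  have hd0 : d ≠ 0 := (Nat.pos_of_mem_divisors hd).ne'
  have h2 := abs_card_progression_sub_le hlu hd0 hm a
  have h3 : ((u : ℝ) - l) / m * (moebius d * gcdWeight m a d) = moebius d * d *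
      if (d.gcd m : ℤ) ∣ a then ((u : ℝ) - l) / (d.lcm m : ℕ) else 0 := by
    rw [gcdWeight_apply hd0]
    split_ifs
    · have h4 : (d.gcd m : ℝ) * (d.lcm m : ℕ) = d * m := by exact_mod_cast Nat.gcd_mul_lcm d m
      have h5 : ((d.lcm m : ℕ) : ℝ) ≠ 0 := by exact_mod_cast Nat.lcm_ne_zero hd0 hm
      have h6 : (m : ℝ) ≠ 0 := by exact_mod_cast hm
      field_simp
      linear_combination (moebius d : ℝ) * (u - l) * h4
    · simp
  rw [h3, ← mul_sub, abs_mul, abs_mul, Nat.abs_cast]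
  have h7 : |(moebius d : ℝ)| ≤ 1 := by exact_mod_cast ArithmeticFunction.abs_moebius_le_one
  calc |(moebius d : ℝ)| * d * _ ≤ 1 * d * 1 := by gcongr
    _ = d := by ring

end SiegelWalfisz

namespace SiegelWalfisz

open ArithmeticFunction (moebius vonMangoldt)
open ArithmeticFunction.vonMangoldt (residueClass)

lemma sum_vonMangoldt_filter_eq {l u : ℕ} (hlu : l ≤ u) (m : ℕ) (a : ℤ) :
    ∑ n ∈ (Ioc l u).filter (fun n : ℕ ↦ (m : ℤ) ∣ (n : ℤ) - a), vonMangoldt n =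
      ∑ n ∈ Icc 1 u, residueClass (a : ZMod m) n - ∑ n ∈ Icc 1 l, residueClass (a : ZMod m) n := by
  have h1 (k : ℕ) : Icc 1 k = Ioc 0 k := rfl
  rw [h1, h1, ← sum_Ioc_consecutive _ (Nat.zero_le l) hlu, add_sub_cancel_left, sum_filter]
  refine sum_congr rfl fun n _ ↦ ?_
  rw [residueClass, Set.indicator_apply]
  refine if_congr ?_ rfl rfl
  rw [Set.mem_ofPred_eq, eq_comm, ← Int.cast_natCast (R := ZMod m) n,
    ZMod.intCast_eq_intCast_iff_dvd_sub]

/-- The Siegel-Walfisz theorem on an interval, for arbitrary residue classes. -/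
lemma exists_abs_sum_vonMangoldt_progression_sub_le {A : ℝ} (hA : 0 ≤ A) (B : ℝ) :
    ∃ C : ℝ, 0 < C ∧ ∀ x : ℝ, 3 ≤ x → ∀ m : ℕ, m ≠ 0 → (m : ℝ) ≤ 2 * Real.log x ^ A →
      ∀ (a : ℤ) (l u : ℕ), l ≤ u → (u : ℝ) ≤ x →
        |∑ n ∈ (Ioc l u).filter (fun n : ℕ ↦ (m : ℤ) ∣ (n : ℤ) - a), vonMangoldt n -
          ((u : ℝ) - l) * if IsCoprime a m then (m.totient : ℝ)⁻¹ else 0| ≤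
          C * (x / Real.log x ^ B) := by
  obtain ⟨C₁, hC₁, h₁⟩ := siegel_walfisz hA B
  obtain ⟨C₂, hC₂, h₂⟩ := exists_log_rpow_le (A + 2 + B)
  refine ⟨2 * C₁ + 16 * C₂, by positivity, fun x hx m hm hmx a l u hlu hux ↦ ?_⟩
  have hL : 1 ≤ Real.log x := by
    rw [Real.le_log_iff_exp_le (by linarith)]
    linarith [Real.exp_one_lt_d9]
  have hL0 : 0 < Real.log x := by linarith
  have hX : 0 ≤ x / Real.log x ^ B := by positivity
  split_ifs with h
  · have : NeZero m := ⟨hm⟩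
    have ha : IsUnit (a : ZMod m) := (ZMod.coe_int_isUnit_iff_isCoprime a m).2 h.symm
    have h3 := h₁ x hx m hmx _ ha u (by positivity) hux
    have h4 := h₁ x hx m hmx _ ha l (by positivity) ((Nat.cast_le.2 hlu).trans hux)
    rw [Nat.floor_natCast] at h3 h4
    rw [sum_vonMangoldt_filter_eq hlu]
    have h5 := abs_sub _ _ |>.trans (add_le_add h3 h4)
    have : 0 ≤ C₂ * (x / Real.log x ^ B) := by positivity
    refine le_trans (le_of_eq ?_) (h5.trans (by linarith))
    congr 1
    ring
  · rw [mul_zero, sub_zero, abs_of_nonneg (sum_nonneg fun _ _ ↦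
      ArithmeticFunction.vonMangoldt_nonneg)]
    have h3 : ∑ n ∈ (Ioc l u).filter (fun n : ℕ ↦ (m : ℤ) ∣ (n : ℤ) - a), vonMangoldt n ≤
        ∑ n ∈ (Icc 1 u).filter (fun n ↦ ¬ n.Coprime m), vonMangoldt n := by
      refine sum_le_sum_of_subset_of_nonneg (fun n hn ↦ ?_) fun _ _ _ ↦
        ArithmeticFunction.vonMangoldt_nonneg
      rw [mem_filter, mem_Ioc] at hn
      rw [mem_filter, mem_Icc]
      refine ⟨by lia, fun hc ↦ h ?_⟩
      obtain ⟨k, hk⟩ := hn.2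
      rw [← Nat.isCoprime_iff_coprime] at hc
      have : (a : ℤ) = n + m * (-k) := by linarith
      rw [this]
      exact (IsCoprime.add_mul_left_left_iff).2 hc
    have h4 := h3.trans (sum_vonMangoldt_not_coprime_le hm)
    have h5 : Real.log u ≤ Real.log x := by
      rcases Nat.eq_zero_or_pos u with rfl | hu
      · simpa using hL0.le
      · exact Real.log_le_log (by exact_mod_cast hu) hux
    have h6 : 0 ≤ Real.log u := Real.log_natCast_nonneg u
    have h7 := h₂ x hx
    have h8 : √x ≤ x := by
      rw [Real.sqrt_le_left (by linarith)]
      nlinarith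
    have h9 : Real.log x ^ (A + 2) ≤ C₂ * (x / Real.log x ^ B) := by
      rw [← mul_div_assoc, le_div_iff₀ (by positivity), ← rpow_add hL0]
      exact h7.trans (by gcongr)
    calc _ ≤ (m : ℝ) * (2 * (Real.log u + 1) ^ 2) := h4
      _ ≤ (2 * Real.log x ^ A) * (2 * (Real.log x + Real.log x) ^ 2) := by gcongr
      _ = 16 * Real.log x ^ (A + 2) := by
        rw [rpow_add hL0, rpow_two]; ring
      _ ≤ 16 * (C₂ * (x / Real.log x ^ B)) := by gcongr
      _ ≤ _ := by
        have : 0 ≤ C₁ * (x / Real.log x ^ B) := by positivity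
        linarith

end SiegelWalfisz

open SiegelWalfisz in
/-- average of `ψ* - ρ_R*` over large moduli. -/
theorem psi_minus_rho_large_moduli (A B : ℝ) (hA : 1 ≤ A) (hB : 1 ≤ B) :
    ∃ C : ℝ, 0 < C ∧ ∀ x : ℝ, 3 ≤ x → ∀ N : ℝ, 1 ≤ N → N ≤ Real.log x ^ A →
      ∀ R : ℝ, N ≤ R → R ≤ x / Real.log x ^ (A + B) →
      ∀ a : ℤ, a ≠ 0 → |(a : ℝ)| < x / N →
      |∑ q ∈ Finset.Ioc ⌊x / N⌋₊ ⌊x⌋₊, (psiStar x q a - rhoStar R x q a)|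
        ≤ C * (x / Real.log x ^ B + |(a : ℝ)| * Real.log (2 * N)) := by
  obtain ⟨C₁, hC₁, h₁⟩ :=
    exists_abs_sum_vonMangoldt_progression_sub_le (A := A) (by linarith) (A + B)
  obtain ⟨C₂, hC₂, h₂⟩ := exists_sum_sigma_div_totient_le
  obtain ⟨C₃, hC₃, h₃⟩ := exists_log_rpow_le (A + B)
  refine ⟨2 * (C₁ + C₂) + 4 * C₃ + 4, by positivity,
    fun x hx N hN hNx R hNR hRx a _ hax ↦ ?_⟩
  have hx0 : 0 < x := by linarith
  have hL : 1 ≤ Real.log x := by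
    rw [Real.le_log_iff_exp_le (by linarith)]
    linarith [Real.exp_one_lt_d9]
  have hL0 : 0 < Real.log x := by linarith
  set L := Real.log x
  have hN0 : 0 < N := by linarith
  have hxN : 0 ≤ x / N := by positivity
  have hfl := Nat.floor_le hN0.le
  have hfl' := Nat.lt_floor_add_one N
  have hQl := Nat.floor_le hxN
  have hQl' := Nat.lt_floor_add_one (x / N)
  have hXl := Nat.floor_le hx0.le
  have hNxN : N * (x / N) = x := mul_div_cancel₀ x hN0.ne'
  have ha := abs_lt.1 hax
  set M := ⌊N⌋₊ + 1 with hM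
  have hMN : (M : ℝ) ≤ 2 * N := by rw [hM]; push_cast; linarith
  have hNM : N ≤ M := by rw [hM]; push_cast; linarith
  set Q₀ := ⌊x / N⌋₊
  set X := ⌊x⌋₊
  have haQ : |a| ≤ Q₀ := by
    have : a.natAbs ≤ Q₀ := Nat.le_floor (by rw [Nat.cast_natAbs, Int.cast_abs]; exact hax.le)
    rw [Int.abs_eq_natAbs]
    exact_mod_cast this
  have hQX : Q₀ ≤ X := Nat.floor_le_floor (div_le_self hx0.le hN)
  have hbd : (X : ℤ) - a < (M + 1) * (Q₀ + 1) := by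
    have : (X : ℝ) - a < (M + 1) * (Q₀ + 1) := by
      calc (X : ℝ) - a < (N + 1) * (x / N) := by linarith
        _ ≤ (M + 1) * (Q₀ + 1) := by gcongr
    exact_mod_cast this
  have hre (f : ℕ → ℝ) := sum_large_moduli_eq haQ hQX hbd f
  rw [sum_sub_distrib]
  simp only [psiStar, rhoStar]
  rw [hre, hre fun n ↦ FR R n, ← sum_sub_distrib]
  set l : ℕ → ℕ := fun m ↦ (a + m * Q₀).toNat
  set u : ℕ → ℕ := fun m ↦ (min (X : ℤ) (a + m * X)).toNat
  have hR0 : 0 ≤ R := by linarith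
  have hterm : ∀ m ∈ Icc 1 M,
      |∑ n ∈ (Ioc (l m) (u m)).filter (fun n : ℕ ↦ (m : ℤ) ∣ (n : ℤ) - a),
          ArithmeticFunction.vonMangoldt n -
        ∑ n ∈ (Ioc (l m) (u m)).filter (fun n : ℕ ↦ (m : ℤ) ∣ (n : ℤ) - a), FR R n| ≤
      (C₁ + C₂) * (x / L ^ (A + B)) + if m = M then 2 * (|(a : ℝ)| + M) else 0 := by
    intro m hm
    rw [mem_Icc] at hm
    have hm0 : m ≠ 0 := by lia
    have hE : 0 ≤ if m = M then 2 * (|(a : ℝ)| + M) else 0 := by positivity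
    rcases le_total (u m) (l m) with hul | hlu
    · rw [Ioc_eq_empty_of_le hul]
      simp only [filter_empty, sum_empty, sub_self, abs_zero]
      positivity
    have hux : (u m : ℝ) ≤ x := by
      refine le_trans ?_ hXl
      have : u m ≤ X := by simp only [u]; lia
      exact_mod_cast this
    have hmM : (m : ℝ) ≤ M := by exact_mod_cast hm.2
    have e₁ := h₁ x hx m hm0 (by linarith) a (l m) (u m) hlu hux
    have e₂ := abs_sum_FR_sub_le hlu hm0 a R
    have e₃ := h₂ ⌊R⌋₊
    have e₄ := Nat.floor_le hR0
    have e₅ : C₂ * (⌊R⌋₊ : ℝ) ≤ C₂ * (x / L ^ (A + B)) := by gcongr; linarith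
    have e₆ : |((u m : ℝ) - l m) * (if IsCoprime a m then (m.totient : ℝ)⁻¹ else 0) -
        ((u m : ℝ) - l m) / m * ∑ r ∈ Icc 1 ⌊R⌋₊, density m a r| ≤
        if m = M then 2 * (|(a : ℝ)| + M) else 0 := by
      have hmr : (0 : ℝ) < m := by exact_mod_cast hm0.bot_lt
      by_cases hmM' : m = M
      · rw [if_pos hmM', ← hmM']
        have f₁ : (0 : ℝ) ≤ u m - l m := sub_nonneg.2 (by exact_mod_cast hlu)
        have f₂ : (u m : ℝ) - l m ≤ |(a : ℝ)| + m := by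
          have : a + m * Q₀ ≤ (l m : ℤ) := Int.self_le_toNat _
          have h : (a : ℝ) + m * Q₀ ≤ l m := by exact_mod_cast this
          have h' : N * (x / N) ≤ m * (Q₀ + 1) := by rw [hmM']; gcongr
          linarith [neg_abs_le (a : ℝ)]
        have f₃ : |if IsCoprime a m then (m.totient : ℝ)⁻¹ else 0| ≤ 1 := by
          split_ifs
          · rw [abs_of_nonneg (by positivity)]
            exact inv_le_one_of_one_le₀ (by exact_mod_cast Nat.totient_pos.2 hm0.bot_lt)
          · simp
        have f₄ : |(∑ r ∈ Icc 1 ⌊R⌋₊, density m a r) / m| ≤ 1 := by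
          rw [abs_div, Nat.abs_cast, div_le_one hmr]
          exact abs_sum_density_le hm0 _ a
        rw [div_mul_eq_mul_div, mul_div_assoc, ← mul_sub, abs_mul, abs_of_nonneg f₁, mul_comm]
        refine mul_le_mul ((abs_sub _ _).trans ?_) f₂ f₁ (by norm_num)
        linarith
      · rw [if_neg hmM', sum_density hm0
          ((show m ≤ ⌊N⌋₊ by lia).trans (Nat.floor_le_floor hNR))]
        have h : (m.totient : ℝ) ≠ 0 := by exact_mod_cast (Nat.totient_pos.2 hm0.bot_lt).ne'
        refine abs_nonpos_iff.2 ?_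
        split_ifs
        · field_simp
          ring
        · simp
    rw [abs_le] at e₁ e₂ e₆ ⊢
    constructor <;> linarith
  refine (abs_sum_le_sum_abs _ _).trans ((sum_le_sum hterm).trans ?_)
  rw [sum_add_distrib, sum_const, Nat.card_Icc, nsmul_eq_mul, sum_ite_eq',
    if_pos (mem_Icc.2 ⟨by lia, le_rfl⟩), Nat.add_sub_cancel]
  have hY : 0 ≤ x / L ^ (A + B) := by positivity
  have g₁ : M * ((C₁ + C₂) * (x / L ^ (A + B))) ≤ 2 * (C₁ + C₂) * (x / L ^ B) := by
    calc M * ((C₁ + C₂) * (x / L ^ (A + B)))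
        ≤ (2 * L ^ A) * ((C₁ + C₂) * (x / L ^ (A + B))) := by gcongr; linarith
      _ = 2 * (C₁ + C₂) * (x / L ^ B) := by
        rw [rpow_add hL0]; field_simp
  have g₂ : N ≤ C₃ * (x / L ^ B) := by
    have h8 : √x ≤ x := by
      rw [Real.sqrt_le_left (by linarith)]
      nlinarith
    rw [← mul_div_assoc, le_div_iff₀ (by positivity)]
    calc N * L ^ B ≤ L ^ A * L ^ B := by gcongr
      _ = L ^ (A + B) := (rpow_add hL0 _ _).symm
      _ ≤ C₃ * √x := h₃ x hx
      _ ≤ C₃ * x := by gcongr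
  have g₃ : 1 / 2 ≤ Real.log (2 * N) := by
    have : Real.log 2 ≤ Real.log (2 * N) := Real.log_le_log (by norm_num) (by linarith)
    linarith [Real.log_two_gt_d9]
  have g₄ : |(a : ℝ)| * (1 / 2) ≤ |(a : ℝ)| * Real.log (2 * N) := by gcongr
  have g₅ : 0 ≤ x / L ^ B := by positivity
  have g₆ : 0 ≤ (2 * (C₁ + C₂) + 4 * C₃) * (|(a : ℝ)| * Real.log (2 * N)) := by positivity
  linarith
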